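/- arXiv:math/0508647 — 2 statements merged into one kernel-verified Lean document; each statement's English description precedes it below -/
import Mathlib

section
/- Let s ≥ 3 be an integer and let G be a finite group generated by an involution a and an element b of order s such that ab has order 3. If |G| ≡ 2 (mod 4), then the Cayley graph Cay(G,{a,b,b⁻¹}) has a Hamilton cycle. -/
/-- The Cayley graph `Cay(G, {a, b, b⁻¹})`: vertices are the elements of `G`,
with `g` adjacent to `h` iff `g⁻¹ * h ∈ {a, b, b⁻¹}`. -/
def cayleyGraph {G : Type*} [Group G] (a b : G) : SimpleGraph G :=
  SimpleGraph.fromRel (fun g h => g⁻¹ * h ∈ ({a, b, b⁻¹} : Set G))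

/-- **Rado's theorem**: a family of finite sets has a transversal of full rank as soon as the union
of any subfamily has rank at least the size of the subfamily. -/
theorem exists_transversal_of_card_le_rank {ι ε : Type*} [DecidableEq ι] [DecidableEq ε]
    [Nonempty ε] (r : Finset ε → ℤ) (hr0 : r ∅ ≤ 0) (hmono : ∀ X Y, X ⊆ Y → r X ≤ r Y)
    (hsub : ∀ X Y, r (X ∪ Y) + r (X ∩ Y) ≤ r X + r Y) (O : Finset ι) (A : ι → Finset ε)
    (hA : ∀ U ⊆ O, (U.card : ℤ) ≤ r (U.biUnion A)) :
    ∃ φ : ι → ε, (∀ i ∈ O, φ i ∈ A i) ∧ (O.card : ℤ) ≤ r (O.image φ) := by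
  induction hn : ∑ i ∈ O, (A i).card using Nat.strong_induction_on generalizing A with
  | _ n ih =>
  by_cases hone : ∀ i ∈ O, (A i).card ≤ 1
  · have hex : ∀ i, ∃ x, i ∈ O → A i = {x} := by
      intro i
      by_cases hi : i ∈ O
      · have h1 := hA {i} (by simpa using hi)
        have h2 : (A i).card ≠ 0 := by
          intro h0
          rw [Finset.card_eq_zero] at h0
          simp [h0] at h1
          omega
        obtain ⟨x, hx⟩ := Finset.card_eq_one.1 (show (A i).card = 1 by have := hone i hi; omega)
        exact ⟨x, fun _ => hx⟩
      · exact ⟨Classical.arbitrary _, fun h => absurd h hi⟩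
    choose φ hφ using hex
    refine ⟨φ, fun i hi => by simp [hφ i hi], ?_⟩
    have : O.image φ = O.biUnion A := by
      ext x
      simp only [Finset.mem_image, Finset.mem_biUnion]
      constructor
      · rintro ⟨i, hi, rfl⟩
        exact ⟨i, hi, by simp [hφ i hi]⟩
      · rintro ⟨i, hi, hx⟩
        rw [hφ i hi, Finset.mem_singleton] at hx
        exact ⟨i, hi, hx.symm⟩
    rw [this]
    exact hA O subset_rfl
  · push Not at hone
    obtain ⟨v, hv, hcard⟩ := hone
    obtain ⟨e, he, f, hf, hef⟩ := Finset.one_lt_card.1 hcard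
    have key : ∀ x ∈ A v, (∃ φ : ι → ε, (∀ i ∈ O, φ i ∈ A i) ∧ (O.card : ℤ) ≤ r (O.image φ)) ∨
        ∃ U ⊆ O, v ∉ U ∧ r (U.biUnion A ∪ (A v).erase x) ≤ U.card := by
      intro x hx
      set A' : ι → Finset ε := Function.update A v ((A v).erase x) with hA'
      have hle : ∀ i, A' i ⊆ A i := by
        intro i
        by_cases hi : i = v
        · subst hi; simpa [hA'] using Finset.erase_subset _ _
        · simp [hA', hi]
      by_cases hU : ∀ U ⊆ O, (U.card : ℤ) ≤ r (U.biUnion A')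
      · left
        obtain ⟨φ, h1, h2⟩ := ih (∑ i ∈ O, (A' i).card) (by
          rw [← hn]
          refine Finset.sum_lt_sum (fun i _ => Finset.card_le_card (hle i)) ⟨v, hv, ?_⟩
          simpa [hA'] using Finset.card_erase_lt_of_mem hx) A' hU rfl
        exact ⟨φ, fun i hi => hle i (h1 i hi), h2⟩
      · right
        push Not at hU
        obtain ⟨U, hUO, hlt⟩ := hU
        have hcongr : ∀ W : Finset ι, v ∉ W → W.biUnion A' = W.biUnion A := fun W hW =>
          Finset.biUnion_congr rfl fun i hi => by
            have : i ≠ v := by rintro rfl; exact hW hi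
            simp [hA', this]
        have hvU : v ∈ U := by
          by_contra hvU
          rw [hcongr U hvU] at hlt
          exact absurd (hA U hUO) (not_le.2 hlt)
        refine ⟨U.erase v, (Finset.erase_subset _ _).trans hUO, by simp, ?_⟩
        have : U.biUnion A' = (U.erase v).biUnion A ∪ (A v).erase x := by
          conv_lhs => rw [← Finset.insert_erase hvU]
          rw [Finset.biUnion_insert, hcongr _ (by simp), Finset.union_comm]
          simp [hA']
        rw [← this]
        have := Finset.card_erase_add_one hvU
        omega
    rcases key e he with h | ⟨U, hUO, hvU, hU⟩
    · exact h
    rcases key f hf with h | ⟨W, hWO, hvW, hW⟩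
    · exact h
    exfalso
    have h1 := hsub (U.biUnion A ∪ (A v).erase e) (W.biUnion A ∪ (A v).erase f)
    have h2 : (insert v (U ∪ W)).biUnion A ⊆
        (U.biUnion A ∪ (A v).erase e) ∪ (W.biUnion A ∪ (A v).erase f) := by
      intro x
      simp only [Finset.mem_biUnion, Finset.mem_insert, Finset.mem_union, Finset.mem_erase]
      rintro ⟨i, rfl | hi | hi, hx⟩
      · by_cases hxe : x = e
        · subst hxe; exact Or.inr (Or.inr ⟨hef, hx⟩)
        · exact Or.inl (Or.inr ⟨hxe, hx⟩)
      · exact Or.inl (Or.inl ⟨i, hi, hx⟩)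
      · exact Or.inr (Or.inl ⟨i, hi, hx⟩)
    have h3 : (U ∩ W).biUnion A ⊆
        (U.biUnion A ∪ (A v).erase e) ∩ (W.biUnion A ∪ (A v).erase f) := by
      intro x
      simp only [Finset.mem_biUnion, Finset.mem_inter, Finset.mem_union]
      rintro ⟨i, ⟨hi, hi'⟩, hx⟩
      exact ⟨Or.inl ⟨i, hi, hx⟩, Or.inl ⟨i, hi', hx⟩⟩
    have h4 := hA (insert v (U ∪ W)) (Finset.insert_subset hv (Finset.union_subset hUO hWO))
    have h5 := hA (U ∩ W) (Finset.inter_subset_left.trans hUO)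
    rw [Finset.card_insert_of_notMem (by simp [hvU, hvW])] at h4
    have h6 := Finset.card_union_add_card_inter U W
    have h7 := hmono _ _ h2
    have h8 := hmono _ _ h3
    push_cast at h4
    omega

set_option linter.unusedSectionVars false

namespace Multigraph

open Finset

variable {V ε : Type*} [Fintype V] [DecidableEq V] [DecidableEq ε] (s t : ε → V)

/-- Being connected by the edges in `K`, where the edge `e` joins `s e` to `t e`. -/
def connSetoid (K : Finset ε) : Setoid V :=
  Relation.EqvGen.setoid fun u v => ∃ e ∈ K, s e = u ∧ t e = v

open Classical in
/-- The vertex set of the connected component of `v` in the multigraph with edge set `K`. -/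
noncomputable def comp (K : Finset ε) (v : V) : Finset V :=
  univ.filter fun w => connSetoid s t K v w

/-- The vertex sets of the connected components of the multigraph with edge set `K`. -/
noncomputable def comps (K : Finset ε) : Finset (Finset V) :=
  univ.image (comp s t K)

variable {s t} {K L : Finset ε} {u v w : V} {C D : Finset V} {e : ε}

theorem mem_comp : w ∈ comp s t K v ↔ connSetoid s t K v w := by
  simp [comp]

theorem mem_comp_self : v ∈ comp s t K v := mem_comp.2 (Setoid.refl' _ _)

theorem comp_eq_iff : comp s t K v = comp s t K w ↔ w ∈ comp s t K v := by
  constructor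
  · intro h; rw [h]; exact mem_comp_self
  · intro h
    rw [mem_comp] at h
    ext x
    rw [mem_comp, mem_comp]
    exact ⟨fun hx => Setoid.trans' _ (Setoid.symm' _ h) hx, fun hx => Setoid.trans' _ h hx⟩

theorem comp_eq_of_mem (he : e ∈ K) : comp s t K (s e) = comp s t K (t e) :=
  comp_eq_iff.2 (mem_comp.2 (Relation.EqvGen.rel _ _ ⟨e, he, rfl, rfl⟩))

theorem comp_subset (hv : v ∈ D) (hD : ∀ e ∈ K, (s e ∈ D ↔ t e ∈ D)) : comp s t K v ⊆ D := by
  have key : ∀ x y, connSetoid s t K x y → (x ∈ D ↔ y ∈ D) := by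
    intro x y h
    induction h with
    | rel x y h => obtain ⟨e, he, rfl, rfl⟩ := h; exact hD e he
    | refl x => rfl
    | symm x y _ ih => exact ih.symm
    | trans x y z _ _ ih1 ih2 => exact ih1.trans ih2
  exact fun w hw => (key v w (mem_comp.1 hw)).1 hv

theorem comp_mono (h : L ⊆ K) : comp s t L v ⊆ comp s t K v :=
  comp_subset mem_comp_self fun e he => by
    rw [← comp_eq_iff, ← comp_eq_iff, comp_eq_of_mem (h he)]

theorem comp_mem_comps : comp s t K v ∈ comps s t K := by simp [comps]

theorem mem_comps_iff (hC : C ∈ comps s t K) : v ∈ C ↔ comp s t K v = C := by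
  obtain ⟨w, -, rfl⟩ := mem_image.1 hC
  rw [← comp_eq_iff]
  exact eq_comm

theorem nonempty_of_mem_comps (hC : C ∈ comps s t K) : C.Nonempty := by
  obtain ⟨w, -, rfl⟩ := mem_image.1 hC
  exact ⟨w, mem_comp_self⟩

theorem mem_comps_closed (hC : C ∈ comps s t K) (he : e ∈ K) : s e ∈ C ↔ t e ∈ C := by
  rw [mem_comps_iff hC, mem_comps_iff hC, comp_eq_of_mem he]

theorem eq_of_mem_of_mem (hC : C ∈ comps s t K) (hD : D ∈ comps s t K) (h : v ∈ C) (h' : v ∈ D) :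
    C = D :=
  ((mem_comps_iff hC).1 h).symm.trans ((mem_comps_iff hD).1 h')

theorem card_comps_empty : (comps s t (∅ : Finset ε)).card = Fintype.card V := by
  rw [comps, card_image_of_injective, card_univ]
  intro v w h
  have h1 : comp s t (∅ : Finset ε) v ⊆ {v} := comp_subset (by simp) (by simp)
  have h2 : w ∈ comp s t (∅ : Finset ε) v := by rw [h]; exact mem_comp_self
  exact (mem_singleton.1 (h1 h2)).symm

variable (s t) in
/-- The functions which are constant on the components of the multigraph with edge set `K`. -/
def potentials (K : Finset ε) : Submodule ℚ (V → ℚ) where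
  carrier := {f | ∀ e ∈ K, f (s e) = f (t e)}
  add_mem' hf hg e he := by simp [hf e he, hg e he]
  zero_mem' := by simp
  smul_mem' c f hf e he := by simp [hf e he]

theorem finrank_potentials (K : Finset ε) :
    Module.finrank ℚ (potentials s t K) = (comps s t K).card := by
  let g : V → comps s t K := fun v => ⟨comp s t K v, comp_mem_comps⟩
  have hg : Function.Surjective g := by
    rintro ⟨C, hC⟩
    obtain ⟨v, hv⟩ := nonempty_of_mem_comps hC
    exact ⟨v, Subtype.ext ((mem_comps_iff hC).1 hv)⟩
  have hrange : LinearMap.range (LinearMap.funLeft ℚ ℚ g) = potentials s t K := by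
    ext f
    constructor
    · rintro ⟨F, rfl⟩ e he
      simp only [LinearMap.funLeft_apply]
      congr 1
      exact Subtype.ext (comp_eq_of_mem he)
    · intro hf
      have key : ∀ x y, connSetoid s t K x y → f x = f y := by
        intro x y h
        induction h with
        | rel x y h => obtain ⟨e, he, rfl, rfl⟩ := h; exact hf e he
        | refl x => rfl
        | symm x y _ ih => exact ih.symm
        | trans x y z _ _ ih1 ih2 => exact ih1.trans ih2
      refine ⟨fun C => f (Function.surjInv hg C), ?_⟩
      ext v
      simp only [LinearMap.funLeft_apply]
      apply key
      rw [← mem_comp, ← comp_eq_iff]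
      exact congrArg Subtype.val (Function.surjInv_eq hg (g v))
  rw [← hrange, LinearMap.finrank_range_of_inj
    (LinearMap.funLeft_injective_of_surjective ℚ ℚ g hg)]
  simp

theorem card_comps_anti (h : L ⊆ K) : (comps s t K).card ≤ (comps s t L).card := by
  rw [← finrank_potentials, ← finrank_potentials]
  exact Submodule.finrank_mono fun f hf e he => hf e (h he)

theorem card_comps_supermodular (K L : Finset ε) :
    (comps s t K).card + (comps s t L).card ≤
      (comps s t (K ∪ L)).card + (comps s t (K ∩ L)).card := by
  simp only [← finrank_potentials]
  have h := Submodule.finrank_sup_add_finrank_inf_eq (potentials s t K) (potentials s t L)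
  have h1 : potentials s t K ⊓ potentials s t L = potentials s t (K ∪ L) := by
    ext f
    constructor
    · rintro ⟨h1, h2⟩ e he
      rcases mem_union.1 he with he | he
      exacts [h1 e he, h2 e he]
    · intro h
      exact ⟨fun e he => h e (mem_union_left _ he), fun e he => h e (mem_union_right _ he)⟩
  have h2 : potentials s t K ⊔ potentials s t L ≤ potentials s t (K ∩ L) :=
    sup_le (fun f hf e he => hf e (mem_inter.1 he).1) (fun f hf e he => hf e (mem_inter.1 he).2)
  have h3 := Submodule.finrank_mono h2
  rw [h1] at h
  omega

theorem card_comps_le_insert (K : Finset ε) (e : ε) :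
    (comps s t K).card ≤ (comps s t (insert e K)).card + 1 := by
  simp only [← finrank_potentials]
  let φ : (V → ℚ) →ₗ[ℚ] ℚ := LinearMap.proj (R := ℚ) (φ := fun _ : V => ℚ) (s e) -
    LinearMap.proj (R := ℚ) (φ := fun _ : V => ℚ) (t e)
  have h1 : potentials s t (insert e K) = potentials s t K ⊓ LinearMap.ker φ := by
    ext f
    constructor
    · intro h
      refine ⟨fun x hx => h x (mem_insert_of_mem hx), ?_⟩
      simp [φ, h e (mem_insert_self _ _)]
    · rintro ⟨h1, h2⟩ x hx
      rcases mem_insert.1 hx with rfl | hx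
      · simpa [φ, sub_eq_zero] using h2
      · exact h1 x hx
  have h := Submodule.finrank_sup_add_finrank_inf_eq (potentials s t K) (LinearMap.ker φ)
  have h2 := LinearMap.finrank_range_add_finrank_ker φ
  have h3 : Module.finrank ℚ (LinearMap.range φ) ≤ 1 := by
    simpa using Submodule.finrank_le (LinearMap.range φ)
  have h4 := Submodule.finrank_le (potentials s t K ⊔ LinearMap.ker φ)
  rw [← h1] at h
  omega

theorem card_comps_le_union (K R : Finset ε) :
    (comps s t K).card ≤ (comps s t (K ∪ R)).card + R.card := by
  induction R using Finset.induction_on with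
  | empty => simp
  | insert e R he ih =>
    have := card_comps_le_insert (s := s) (t := t) (K ∪ R) e
    rw [card_insert_of_notMem he, union_insert]
    omega

theorem sum_comps {M : Type*} [AddCommMonoid M] (K : Finset ε) (f : V → M) :
    ∑ C ∈ comps s t K, ∑ v ∈ C, f v = ∑ v, f v := by
  rw [← sum_fiberwise_of_maps_to (s := univ) (t := comps s t K) (g := comp s t K)
    (fun v _ => comp_mem_comps)]
  refine sum_congr rfl fun C hC => sum_congr ?_ fun _ _ => rfl
  ext v
  simp [mem_comps_iff hC]

theorem sum_card_edges (K L : Finset ε) :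
    ∑ C ∈ comps s t K, (L.filter fun e => s e ∈ C).card = L.card := by
  rw [card_eq_sum_card_fiberwise (f := fun e => comp s t K (s e)) (t := comps s t K)
    (fun e _ => comp_mem_comps)]
  refine sum_congr rfl fun C hC => congrArg card ?_
  ext e
  simp [mem_comps_iff hC]

variable (s) in
/-- The number of edges of `K` in the component `D`, plus the number of vertices of `D`, plus the
total label of `D`. If `p` vanishes, this is odd precisely when `D` has even cycle rank. -/
def excess (p : V → ℕ) (K : Finset ε) (D : Finset V) : ℕ :=
  (K.filter fun e => s e ∈ D).card + ∑ v ∈ D, (p v + 1)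

variable (s) in
/-- The weight of a component in Nebeský's condition. -/
def weight (p : V → ℕ) (K : Finset ε) (D : Finset V) : ℕ :=
  if Even (excess s p K D) then 2 else 1

variable (s t) in
/-- The total weight of the components contained in `C`, a union of components. -/
noncomputable def weightOn (p : V → ℕ) (K : Finset ε) (C : Finset V) : ℕ :=
  ∑ D ∈ C.image (comp s t K), weight s p K D

variable (s t) in
/-- The total weight of the components. -/
noncomputable def totalWeight (p : V → ℕ) (K : Finset ε) : ℕ :=
  ∑ D ∈ comps s t K, weight s p K D

variable {p q : V → ℕ} {E : Finset ε}

theorem one_le_weight : 1 ≤ weight s p K D := by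
  unfold weight; split <;> simp

theorem weight_le_two : weight s p K D ≤ 2 := by
  unfold weight; split <;> simp

theorem even_weight_add_excess : Even (weight s p K D + excess s p K D) := by
  unfold weight
  split_ifs with h
  · exact even_two.add h
  · exact odd_one.add_odd (Nat.not_even_iff_odd.1 h)

theorem card_le_totalWeight : (comps s t K).card ≤ totalWeight s t p K := by
  rw [card_eq_sum_ones]
  exact sum_le_sum fun _ _ => one_le_weight

theorem even_totalWeight_add :
    Even (totalWeight s t p K + (K.card + ∑ v, (p v + 1))) := by
  rw [← sum_card_edges (s := s) (t := t) K K, ← sum_comps (s := s) (t := t) K fun v => p v + 1,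
    ← sum_add_distrib, totalWeight, ← sum_add_distrib]
  exact even_sum _ fun D _ => even_weight_add_excess

theorem totalWeight_eq_add_card :
    totalWeight s t p K =
      (comps s t K).card + ((comps s t K).filter fun D => Even (excess s p K D)).card := by
  rw [card_eq_sum_ones, card_filter, ← sum_add_distrib]
  refine sum_congr rfl fun D _ => ?_
  unfold weight
  split_ifs <;> rfl

theorem totalWeight_eq_sum_weightOn (h : L ⊆ K) :
    totalWeight s t p L = ∑ C ∈ comps s t K, weightOn s t p L C := by
  have h1 : comps s t L = (comps s t K).biUnion fun C => C.image (comp s t L) := by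
    ext D
    simp only [comps, mem_image, mem_biUnion, mem_univ, true_and]
    constructor
    · rintro ⟨v, rfl⟩
      exact ⟨_, ⟨v, rfl⟩, v, mem_comp_self, rfl⟩
    · rintro ⟨_, _, v, _, rfl⟩
      exact ⟨v, rfl⟩
  unfold totalWeight weightOn
  rw [h1, sum_biUnion]
  intro C hC C' hC' hne
  rw [Function.onFun, disjoint_left]
  intro D hD hD'
  obtain ⟨v, hv, rfl⟩ := mem_image.1 hD
  obtain ⟨w, hw, hvw⟩ := mem_image.1 hD'
  refine hne (eq_of_mem_of_mem (v := w) hC hC' ?_ hw)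
  rw [← (mem_comps_iff hC).1 hv]
  exact comp_mono h (comp_eq_iff.1 hvw.symm)

theorem weightOn_self (hC : C ∈ comps s t K) : weightOn s t p K C = weight s p K C := by
  have : C.image (comp s t K) = {C} := by
    ext D
    simp only [mem_image, mem_singleton]
    constructor
    · rintro ⟨v, hv, rfl⟩
      exact (mem_comps_iff hC).1 hv
    · rintro rfl
      obtain ⟨v, hv⟩ := nonempty_of_mem_comps hC
      exact ⟨v, hv, (mem_comps_iff hC).1 hv⟩
  rw [weightOn, this, sum_singleton]

theorem comp_subset_of_mem (hC : C ∈ comps s t K) (h : L ⊆ K) (hv : v ∈ C) :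
    comp s t L v ⊆ C := by
  rw [← (mem_comps_iff hC).1 hv]
  exact comp_mono h

theorem comp_subset_of_agree {L L' : Finset ε} (hC : C ∈ comps s t K) (hL : L ⊆ K) (hL' : L' ⊆ K)
    (h : ∀ e ∈ K, s e ∈ C → (e ∈ L ↔ e ∈ L')) (hv : v ∈ C) :
    comp s t L v ⊆ comp s t L' v := by
  refine comp_subset mem_comp_self fun e he => ?_
  by_cases hs : s e ∈ C
  · rw [mem_comps_closed comp_mem_comps ((h e (hL he) hs).1 he)]
  · have ht : t e ∉ C := by rwa [← mem_comps_closed hC (hL he)]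
    exact iff_of_false (fun h => hs (comp_subset_of_mem hC hL' hv h))
      fun h => ht (comp_subset_of_mem hC hL' hv h)

theorem weightOn_congr {L L' : Finset ε} (hC : C ∈ comps s t K) (hL : L ⊆ K) (hL' : L' ⊆ K)
    (h : ∀ e ∈ K, s e ∈ C → (e ∈ L ↔ e ∈ L')) :
    weightOn s t p L C = weightOn s t p L' C := by
  have h1 : ∀ v ∈ C, comp s t L v = comp s t L' v := fun v hv =>
    (comp_subset_of_agree hC hL hL' h hv).antisymm
      (comp_subset_of_agree hC hL' hL (fun e he hs => (h e he hs).symm) hv)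
  unfold weightOn
  rw [image_congr h1]
  refine sum_congr rfl fun D hD => ?_
  obtain ⟨v, hv, rfl⟩ := mem_image.1 hD
  have h2 : (L.filter fun e => s e ∈ comp s t L' v) = L'.filter fun e => s e ∈ comp s t L' v := by
    ext e
    simp only [mem_filter]
    refine and_congr_left fun he => ?_
    have hs := comp_subset_of_mem hC hL' hv he
    exact ⟨fun hm => (h e (hL hm) hs).1 hm, fun hm => (h e (hL' hm) hs).2 hm⟩
  unfold weight excess
  rw [h2]

/-- Raising the label of a single vertex changes the weight of only one component. -/
theorem weightOn_le_add_one (hq : ∀ v ∈ C, v ≠ u → q v = p v) (hC : C ∈ comps s t K)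
    (hL : L ⊆ K) : weightOn s t q L C ≤ weightOn s t p L C + 1 := by
  have h1 : ∀ D ∈ C.image (comp s t L),
      weight s q L D ≤ weight s p L D + if D = comp s t L u then 1 else 0 := by
    intro D hD
    obtain ⟨v, hv, rfl⟩ := mem_image.1 hD
    split_ifs with h
    · have := weight_le_two (s := s) (p := q) (K := L) (D := comp s t L v)
      have := one_le_weight (s := s) (p := p) (K := L) (D := comp s t L v)
      omega
    · have : ∑ x ∈ comp s t L v, (q x + 1) = ∑ x ∈ comp s t L v, (p x + 1) := by
        refine sum_congr rfl fun x hx => ?_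
        rw [hq x (comp_subset_of_mem hC hL hv hx)]
        rintro rfl
        exact h (comp_eq_iff.2 hx)
      unfold weight excess
      rw [this, add_zero]
  refine (sum_le_sum h1).trans ?_
  rw [sum_add_distrib, sum_ite_eq']
  unfold weightOn
  split_ifs <;> omega

theorem weightOn_congr_label (hq : ∀ v ∈ C, q v = p v) (hC : C ∈ comps s t K) (hL : L ⊆ K) :
    weightOn s t q L C = weightOn s t p L C := by
  refine sum_congr rfl fun D hD => ?_
  obtain ⟨v, hv, rfl⟩ := mem_image.1 hD
  have : ∑ x ∈ comp s t L v, (q x + 1) = ∑ x ∈ comp s t L v, (p x + 1) :=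
    sum_congr rfl fun x hx => by rw [hq x (comp_subset_of_mem hC hL hv hx)]
  unfold weight excess
  rw [this]

variable (s t) in
/-- Nebeský's condition for the multigraph with edge set `E` and vertex labels `p`. -/
def Nebesky (p : V → ℕ) (E : Finset ε) : Prop :=
  ∀ K ⊆ E, totalWeight s t p K + K.card ≤ E.card + (comps s t E).card

theorem Nebesky.even (h : Nebesky s t p E) :
    Even (E.card + (comps s t E).card + ∑ v, (p v + 1)) := by
  have h1 := h E subset_rfl
  have h2 := card_le_totalWeight (s := s) (t := t) (p := p) (K := E)
  have h3 := even_totalWeight_add (s := s) (t := t) (p := p) (K := E)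
  rw [show totalWeight s t p E = (comps s t E).card by omega] at h3
  convert h3 using 1
  ring

/-- Nebeský's condition passes to a minimal tight edge set, once a vertex of each component of
even excess has been relabelled. -/
theorem Nebesky.of_minimal_tight (h : Nebesky s t p E) (hK : K ⊆ E)
    (htight : totalWeight s t p K + K.card = E.card + (comps s t E).card)
    (hmin : ∀ L ⊆ K, totalWeight s t p L + L.card = E.card + (comps s t E).card → L = K)
    (hq : ∀ C ∈ comps s t K, Even (excess s p K C) → ∃ u ∈ C, q u = p u + 1 ∧
      ∀ v ∈ C, v ≠ u → q v = p v)
    (hq' : ∀ C ∈ comps s t K, ¬ Even (excess s p K C) → ∀ v ∈ C, q v = p v) :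
    Nebesky s t q K := by
  intro L hL
  rw [totalWeight_eq_sum_weightOn hL, ← sum_card_edges (s := s) (t := t) K L,
    ← sum_card_edges (s := s) (t := t) K K, card_eq_sum_ones, ← sum_add_distrib,
    ← sum_add_distrib]
  refine sum_le_sum fun C hC => ?_
  set L' := K.filter fun e => s e ∈ C → e ∈ L with hL'
  have hL'K : L' ⊆ K := filter_subset _ _
  have hcard : L'.card + (K.filter fun e => s e ∈ C).card =
      K.card + (L.filter fun e => s e ∈ C).card := by
    rw [← card_filter_add_card_filter_not (s := L') (fun e => s e ∈ C),
      ← card_filter_add_card_filter_not (s := K) (fun e => s e ∈ C)]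
    have h1 : (L'.filter fun e => s e ∈ C) = L.filter fun e => s e ∈ C := by
      ext e
      simp only [hL', mem_filter]
      exact ⟨fun h => ⟨h.1.2 h.2, h.2⟩, fun h => ⟨⟨hL h.1, fun _ => h.1⟩, h.2⟩⟩
    have h2 : (L'.filter fun e => ¬ s e ∈ C) = K.filter fun e => ¬ s e ∈ C := by
      ext e
      simp only [hL', mem_filter]
      exact ⟨fun h => ⟨h.1.1, h.2⟩, fun h => ⟨⟨h.1, fun h' => absurd h' h.2⟩, h.2⟩⟩
    rw [h1, h2]
    ring
  have hweight : totalWeight s t p L' + weight s p K C =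
      totalWeight s t p K + weightOn s t p L C := by
    rw [totalWeight_eq_sum_weightOn hL'K, totalWeight, ← add_sum_erase _ _ hC,
      ← add_sum_erase _ _ hC]
    have h1 : weightOn s t p L' C = weightOn s t p L C :=
      weightOn_congr hC hL'K hL fun e he hs => by simp [hL', he, hs]
    have h2 : ∀ C' ∈ (comps s t K).erase C, weightOn s t p L' C' = weight s p K C' := by
      intro C' hC'
      obtain ⟨hne, hC'⟩ := mem_erase.1 hC'
      rw [← weightOn_self hC']
      refine weightOn_congr hC' hL'K subset_rfl fun e he hs => ?_
      have : s e ∉ C := fun h => hne (eq_of_mem_of_mem hC' hC hs h)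
      simp [hL', he, this]
    rw [h1, sum_congr rfl h2]
    ring
  have hN := h L' (hL'K.trans hK)
  by_cases heven : Even (excess s p K C)
  · obtain ⟨u, hu, hqu, hqv⟩ := hq C hC heven
    by_cases hLK : L' = K
    · have hLC : ∀ e ∈ K, s e ∈ C → (e ∈ L ↔ e ∈ K) := by
        intro e he hs
        rw [← hLK] at he
        exact ⟨fun h => hL h, fun _ => (mem_filter.1 he).2 hs⟩
      rw [weightOn_congr hC hL subset_rfl hLC, weightOn_self hC]
      have hodd : ¬ Even (excess s q K C) := by
        have : excess s q K C = excess s p K C + 1 := by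
          unfold excess
          rw [← add_sum_erase _ _ hu, ← add_sum_erase _ _ hu, hqu,
            sum_congr rfl fun v hv => by rw [hqv v (mem_erase.1 hv).2 (mem_erase.1 hv).1]]
          ring
        rw [this, Nat.even_add_one, not_not]
        exact heven
      have : (L.filter fun e => s e ∈ C).card ≤ (K.filter fun e => s e ∈ C).card :=
        card_le_card (filter_subset_filter _ hL)
      rw [weight, if_neg hodd]
      omega
    · have h1 : totalWeight s t p L' + L'.card ≠ E.card + (comps s t E).card :=
        fun h => hLK (hmin L' hL'K h)
      have h2 := even_totalWeight_add (s := s) (t := t) (p := p) (K := L')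
      have h3 := h.even
      have h4 := weightOn_le_add_one (q := q) (p := p) hqv hC hL
      have h5 := weight_le_two (s := s) (p := p) (K := K) (D := C)
      have h6 : totalWeight s t p L' + L'.card + 2 ≤ E.card + (comps s t E).card := by
        rw [Nat.even_iff] at h2 h3
        omega
      omega
  · have h1 := weightOn_congr_label (hq' C hC heven) hC hL
    have h2 : weight s p K C = 1 := by rw [weight, if_neg heven]
    omega

/-- **Nebeský's theorem**, labelled version: under Nebeský's condition there is a spanning forest
whose remaining edges can be oriented with in-degrees congruent to the labels modulo two. -/
theorem Nebesky.exists_forest (h : Nebesky s t p E) :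
    ∃ T ⊆ E, ∃ head : ε → V, (∀ e, head e = s e ∨ head e = t e) ∧
      (comps s t T).card = (comps s t E).card ∧
      T.card + (comps s t E).card = Fintype.card V ∧
      ∀ v, Even (p v + ((E \ T).filter fun e => head e = v).card) := by
  induction hn : E.card using Nat.strong_induction_on generalizing E p with
  | _ n ih =>
  rcases E.eq_empty_or_nonempty with rfl | hE
  · refine ⟨∅, subset_rfl, s, fun e => Or.inl rfl, rfl, by simp [card_comps_empty], fun v => ?_⟩
    have h1 := h ∅ subset_rfl
    rw [totalWeight_eq_add_card] at h1
    have h2 : ((comps s t ∅).filter fun D => Even (excess s p ∅ D)).card = 0 := by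
      simp only [card_empty] at h1; omega
    rw [card_eq_zero, filter_eq_empty_iff] at h2
    have h3 := h2 (comp_mem_comps (v := v))
    have h4 : comp s t (∅ : Finset ε) v = {v} :=
      (comp_subset (by simp) (by simp)).antisymm (by simp [mem_comp_self])
    rw [h4] at h3
    simpa [excess, Nat.even_add_one] using h3
  obtain ⟨e₀, he₀⟩ := hE
  have : Nonempty ε := ⟨e₀⟩
  set tight := E.powerset.filter fun K =>
    totalWeight s t p K + K.card = E.card + (comps s t E).card with htight_def
  have hmem : E.erase e₀ ∈ tight := by
    have h1 := h _ (erase_subset e₀ E)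
    have h2 := even_totalWeight_add (s := s) (t := t) (p := p) (K := E.erase e₀)
    have h3 := h.even
    have h4 := card_le_totalWeight (s := s) (t := t) (p := p) (K := E.erase e₀)
    have h5 := card_comps_anti (s := s) (t := t) (erase_subset e₀ E)
    have h6 := card_erase_add_one he₀
    simp only [htight_def, mem_filter, mem_powerset]
    refine ⟨erase_subset _ _, ?_⟩
    rw [Nat.even_iff] at h2 h3
    omega
  obtain ⟨K, hKt, hKmin⟩ := exists_min_image tight card ⟨_, hmem⟩
  obtain ⟨hKE, hKtight⟩ := mem_filter.1 hKt
  rw [mem_powerset] at hKE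
  have hKcard : K.card < E.card :=
    (hKmin _ hmem).trans_lt (card_erase_lt_of_mem he₀)
  set bad := (comps s t K).filter fun D => Even (excess s p K D) with hbad
  have hbadmem : ∀ C ∈ bad, C ∈ comps s t K := fun C hC => (mem_filter.1 hC).1
  have hsum := totalWeight_eq_add_card (s := s) (t := t) (p := p) (K := K)
  rw [← hbad] at hsum
  let A : Finset V → Finset ε := fun C => (E \ K).filter fun e => s e ∈ C ∨ t e ∈ C
  let r : Finset ε → ℤ := fun X => X.card + (comps s t E).card - (comps s t (E \ X)).card
  obtain ⟨φ, hφA, hφr⟩ := exists_transversal_of_card_le_rank r (by simp [r])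
    (by
      intro X Y hXY
      have h1 := card_comps_le_union (s := s) (t := t) (E \ Y) (Y \ X)
      have h3 : (comps s t (E \ Y ∪ Y \ X)).card ≤ (comps s t (E \ X)).card :=
        card_comps_anti (by
          intro e he
          simp only [mem_sdiff, mem_union] at he ⊢
          tauto)
      have h4 := card_sdiff_add_card_eq_card hXY
      simp only [r]
      omega)
    (by
      intro X Y
      have h1 := card_comps_supermodular (s := s) (t := t) (E \ X) (E \ Y)
      have h2 := card_union_add_card_inter X Y
      have h3 : E \ X ∪ E \ Y = E \ (X ∩ Y) := by
        ext e; simp only [mem_sdiff, mem_union, mem_inter]; tauto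
      have h4 : (E \ X) ∩ (E \ Y) = E \ (X ∪ Y) := by
        ext e; simp only [mem_sdiff, mem_union, mem_inter]; tauto
      rw [h3, h4] at h1
      simp only [r]
      omega)
    bad A
    (by
      intro U hU
      have hXE : U.biUnion A ⊆ E := biUnion_subset.2 fun C _ =>
        (filter_subset _ _).trans sdiff_subset
      have hKX : K ⊆ E \ U.biUnion A := by
        intro e he
        simp only [mem_sdiff, mem_biUnion, A, mem_filter]
        exact ⟨hKE he, fun ⟨_, _, h, _⟩ => h.2 he⟩
      have h1 := h _ (sdiff_subset (s := E) (t := U.biUnion A))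
      rw [totalWeight_eq_add_card] at h1
      have h2 : U ⊆ (comps s t (E \ U.biUnion A)).filter
          fun D => Even (excess s p (E \ U.biUnion A) D) := by
        intro C hC
        have hCK := hbadmem C (hU hC)
        obtain ⟨v, hv⟩ := nonempty_of_mem_comps hCK
        have hnot : ∀ e ∈ E \ U.biUnion A, s e ∈ C ∨ t e ∈ C → e ∈ K := by
          intro e he hor
          by_contra heK
          obtain ⟨h1, h2⟩ := mem_sdiff.1 he
          exact h2 (mem_biUnion.2 ⟨C, hC, mem_filter.2 ⟨mem_sdiff.2 ⟨h1, heK⟩, hor⟩⟩)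
        have h3 : comp s t (E \ U.biUnion A) v = C := by
          refine (comp_subset hv fun e he => ?_).antisymm ?_
          · constructor
            · intro hs
              exact (mem_comps_closed hCK (hnot e he (Or.inl hs))).1 hs
            · intro ht
              exact (mem_comps_closed hCK (hnot e he (Or.inr ht))).2 ht
          · rw [← (mem_comps_iff hCK).1 hv]
            exact comp_mono hKX
        refine mem_filter.2 ⟨h3 ▸ comp_mem_comps, ?_⟩
        have h4 : ((E \ U.biUnion A).filter fun e => s e ∈ C) = K.filter fun e => s e ∈ C := by
          ext e
          simp only [mem_filter]
          exact and_congr_left fun hs => ⟨fun he => hnot e he (Or.inl hs), fun he => hKX he⟩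
        have h5 := (mem_filter.1 (hU hC)).2
        unfold excess at h5 ⊢
        rwa [h4]
      have h3 := card_le_card h2
      have h4 := card_sdiff_add_card_eq_card hXE
      simp only [r]
      omega)
  set R := bad.image φ with hR
  have hRsub : R ⊆ E \ K := by
    intro e he
    obtain ⟨C, hC, rfl⟩ := mem_image.1 he
    exact (mem_filter.1 (hφA C hC)).1
  have hRle : R.card ≤ bad.card := card_image_le
  have hcompsR := card_comps_anti (s := s) (t := t) (sdiff_subset (s := E) (t := R))
  simp only [r] at hφr
  have hRcard : R.card = bad.card := by omega
  have hRcomps : (comps s t (E \ R)).card = (comps s t E).card := by omega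
  have hinj : Set.InjOn φ bad := card_image_iff.1 hRcard
  let u : Finset V → V := fun C => if s (φ C) ∈ C then s (φ C) else t (φ C)
  have hu : ∀ C ∈ bad, u C ∈ C := by
    intro C hC
    simp only [u]
    split_ifs with h1
    · exact h1
    · exact (mem_filter.1 (hφA C hC)).2.resolve_left h1
  let q : V → ℕ := fun v => p v + (bad.filter fun C => u C = v).card
  have hq0 : ∀ C ∈ comps s t K, ∀ v ∈ C, (C ∈ bad → v ≠ u C) → q v = p v := by
    intro C hC v hv hne
    simp only [q, Nat.add_eq_left, card_eq_zero, filter_eq_empty_iff]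
    rintro C' hC' rfl
    have : C' = C := eq_of_mem_of_mem (hbadmem C' hC') hC (hu C' hC') hv
    subst this
    exact hne hC' rfl
  obtain ⟨T, hTK, head, hhead, hTcomps, hTcard, hTeven⟩ :=
    ih K.card (hn ▸ hKcard) (h.of_minimal_tight (q := q) hKE hKtight
      (fun L hLK hL => eq_of_subset_of_card_le hLK
        (hKmin L (mem_filter.2 ⟨mem_powerset.2 (hLK.trans hKE), hL⟩)))
      (by
        intro C hC heven
        have hCb : C ∈ bad := mem_filter.2 ⟨hC, heven⟩
        refine ⟨u C, hu C hCb, ?_, fun v hv hne => hq0 C hC v hv fun _ => hne⟩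
        have : (bad.filter fun C' => u C' = u C) = {C} := by
          ext C'
          simp only [mem_filter, mem_singleton]
          constructor
          · rintro ⟨hC', huu⟩
            exact eq_of_mem_of_mem (hbadmem C' hC') hC (hu C' hC') (huu ▸ hu C hCb)
          · rintro rfl
            exact ⟨hCb, rfl⟩
        simp [q, this])
      (by
        intro C hC hodd v hv
        exact hq0 C hC v hv fun hCb => absurd (mem_filter.1 hCb).2 hodd)) rfl
  have hKR : ∀ e ∈ R, e ∉ K := fun e he => (mem_sdiff.1 (hRsub he)).2
  have hsdiff : E \ (T ∪ ((E \ K) \ R)) = K \ T ∪ R := by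
    ext e
    have h1 : e ∈ T → e ∈ K := fun h => hTK h
    have h2 : e ∈ R → e ∈ E \ K := fun h => hRsub h
    have h3 : e ∈ K → e ∈ E := fun h => hKE h
    simp only [mem_sdiff, mem_union] at h2 ⊢
    tauto
  have hdisj : Disjoint (K \ T) R := disjoint_left.2 fun e he he' => hKR e he' (mem_sdiff.1 he).1
  have hdisj' : Disjoint T ((E \ K) \ R) := disjoint_left.2 fun e he he' =>
    (mem_sdiff.1 (mem_sdiff.1 he').1).2 (hTK he)
  have hER : K ∪ (T ∪ ((E \ K) \ R)) = E \ R := by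
    ext e
    have h1 : e ∈ T → e ∈ K := fun h => hTK h
    have h2 : e ∈ R → e ∈ E \ K := fun h => hRsub h
    have h3 : e ∈ K → e ∈ E := fun h => hKE h
    simp only [mem_sdiff, mem_union] at h2 ⊢
    tauto
  have hTE : T ∪ ((E \ K) \ R) ⊆ E :=
    union_subset (hTK.trans hKE) (sdiff_subset.trans sdiff_subset)
  refine ⟨T ∪ ((E \ K) \ R), hTE,
    fun e => if e ∈ R then u (Function.invFunOn φ bad e) else head e, ?_, ?_, ?_, ?_⟩
  · intro e
    dsimp only
    split_ifs with he
    · have h1 : φ (Function.invFunOn φ bad e) = e :=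
        Function.invFunOn_eq (by simpa using mem_image.1 he)
      simp only [u]
      rw [h1]
      split_ifs
      · exact Or.inl rfl
      · exact Or.inr rfl
    · exact hhead e
  · have h1 := card_comps_supermodular (s := s) (t := t) K (T ∪ ((E \ K) \ R))
    have h2 : (comps s t (K ∩ (T ∪ ((E \ K) \ R)))).card ≤ (comps s t T).card :=
      card_comps_anti (subset_inter hTK subset_union_left)
    have h3 := card_comps_anti (s := s) (t := t) hTE
    rw [hER] at h1
    omega
  · rw [card_union_of_disjoint hdisj']
    have h1 := card_sdiff_add_card_eq_card hKE
    have h2 := card_sdiff_add_card_eq_card hRsub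
    omega
  · intro v
    rw [hsdiff, filter_union, card_union_of_disjoint
      (disjoint_filter_filter hdisj)]
    have h1 : ((K \ T).filter fun e =>
        (if e ∈ R then u (Function.invFunOn φ bad e) else head e) = v) =
        (K \ T).filter fun e => head e = v := by
      refine filter_congr fun e he => ?_
      rw [if_neg fun he' => hKR e he' (mem_sdiff.1 he).1]
    have h2 : (R.filter fun e =>
        (if e ∈ R then u (Function.invFunOn φ bad e) else head e) = v) =
        (bad.filter fun C => u C = v).image φ := by
      have h3 : ∀ C ∈ bad, Function.invFunOn φ bad (φ C) = C := fun C hC =>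
        hinj.leftInvOn_invFunOn hC
      ext e
      simp only [mem_filter, mem_image]
      constructor
      · rintro ⟨he, hev⟩
        rw [if_pos he] at hev
        obtain ⟨C, hC, rfl⟩ := mem_image.1 he
        rw [h3 C hC] at hev
        exact ⟨C, ⟨hC, hev⟩, rfl⟩
      · rintro ⟨C, ⟨hC, hev⟩, rfl⟩
        have he : φ C ∈ R := mem_image_of_mem _ hC
        rw [if_pos he, h3 C hC]
        exact ⟨he, hev⟩
    rw [h1, h2, card_image_of_injOn (hinj.mono fun C hC => (mem_filter.1 hC).1)]
    have h3 := hTeven v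
    simp only [q] at h3
    convert h3 using 1
    ring

end Multigraph

/-- A graph is Hamiltonian as soon as some map that sends every vertex to a neighbour connects any
two vertices by iteration. -/
theorem SimpleGraph.isHamiltonian_of_reflTransGen {V : Type*} [Fintype V] [DecidableEq V]
    {Γ : SimpleGraph V} (f : V → V) (hf : ∀ v, Γ.Adj v (f v))
    (hreach : ∀ u v, Relation.ReflTransGen (fun u v => f u = v) u v) (hV : 3 ≤ Fintype.card V) :
    Γ.IsHamiltonian := by
  intro _
  have hiter : ∀ u v, ∃ n, f^[n] u = v := by
    intro u v
    induction hreach u v with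
    | refl => exact ⟨0, rfl⟩
    | tail _ h ih =>
      obtain ⟨n, rfl⟩ := ih
      exact ⟨n + 1, by rw [Function.iterate_succ_apply', h]⟩
  have : Nonempty V := Fintype.card_pos_iff.1 (by omega)
  obtain ⟨v₀⟩ := this
  have hpos : 0 < Function.minimalPeriod f v₀ := by
    obtain ⟨n, hn⟩ := hiter (f v₀) v₀
    exact Function.IsPeriodicPt.minimalPeriod_pos (n := n + 1) n.succ_pos hn
  have hbij : Function.Bijective fun i : Fin (Function.minimalPeriod f v₀) => f^[i] v₀ := by
    refine ⟨fun i j hij =>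
      Fin.ext (Function.iterate_injOn_Iio_minimalPeriod i.2 j.2 hij), fun v => ?_⟩
    obtain ⟨n, hn⟩ := hiter v₀ v
    exact ⟨⟨n % Function.minimalPeriod f v₀, Nat.mod_lt _ hpos⟩,
      by simpa [Function.iterate_mod_minimalPeriod_eq] using hn⟩
  have hcard : Function.minimalPeriod f v₀ = Fintype.card V := by
    simpa using Fintype.card_of_bijective hbij
  obtain ⟨m, hm⟩ : ∃ m, Function.minimalPeriod f v₀ = m + 3 :=
    ⟨Function.minimalPeriod f v₀ - 3, by omega⟩
  rw [hm] at hbij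
  have hsucc : ∀ i : Fin (m + 3), f^[(i + 1 : Fin (m + 3))] v₀ = f (f^[i] v₀) := by
    intro i
    have h := Function.iterate_mod_minimalPeriod_eq (f := f) (x := v₀) (n := i + 1)
    rw [hm] at h
    rw [Fin.val_add, Fin.val_one, h, Function.iterate_succ_apply']
  let φ : SimpleGraph.cycleGraph (m + 3) →g Γ :=
    ⟨fun i => f^[i] v₀, by
      intro i j hij
      rw [SimpleGraph.cycleGraph_adj] at hij
      rcases hij with h | h
      · rw [sub_eq_iff_eq_add'.1 h, hsucc]
        exact (hf _).symm
      · rw [sub_eq_iff_eq_add'.1 h, hsucc]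
        exact hf _⟩
  refine ⟨_, _, SimpleGraph.Walk.IsHamiltonianCycle.map (f := φ) hbij
    (SimpleGraph.Walk.isHamiltonianCycle_iff_isCycle_and_length_eq.2
      ⟨SimpleGraph.cycleGraph.isCycle_cycle (n := m), ?_⟩)⟩
  rw [SimpleGraph.cycleGraph.length_cycle, Fintype.card_fin]

namespace CayleyTriangle

open Finset
open scoped Pointwise

variable {G : Type*} [Group G] [DecidableEq G] {a x : G} {U W : Finset G}

/-- The number of edges `{h, h * a}` leaving `U`. -/
def cut (a : G) (U : Finset G) : ℕ :=
  (U.filter fun h => h * a ∉ U).card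

theorem even_cut_add_card (ha : a * a = 1) (ha1 : a ≠ 1) : Even (cut a U + U.card) := by
  have h1 : Even (U.filter fun h => h * a ∈ U).card := by
    rw [← ZMod.natCast_eq_zero_iff_even, card_eq_sum_ones, Nat.cast_sum]
    refine sum_involution (fun h _ => h * a) ?_ ?_ ?_ ?_
    · intros; decide
    · intro h _ _; simpa using ha1
    · intro h hh
      simp only [mem_filter] at hh
      simp [mul_assoc, ha, hh]
    · intro h _; simp [mul_assoc, ha]
  have h2 := card_filter_add_card_filter_not (s := U) fun h => h * a ∈ U
  have h3 : cut a U + U.card = 2 * cut a U + (U.filter fun h => h * a ∈ U).card := by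
    unfold cut; omega
  rw [h3]
  exact (even_two_mul _).add h1

theorem mem_smul_iff {g h : G} : h ∈ g • U ↔ g⁻¹ * h ∈ U := by
  rw [← inv_smul_mem_iff, smul_eq_mul]

theorem cut_smul (g : G) : cut a (g • U) = cut a U := by
  refine card_bij' (fun h _ => g⁻¹ * h) (fun h _ => g * h) ?_ ?_ ?_ ?_ <;>
    simp +contextual [mem_smul_iff, mul_assoc]

/-- `U` is a union of left cosets of the subgroup generated by `x`. -/
def Saturated (x : G) (U : Finset G) : Prop :=
  ∀ h, h ∈ U ↔ h * x ∈ U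

theorem Saturated.union (hU : Saturated x U) (hW : Saturated x W) : Saturated x (U ∪ W) :=
  fun h => by rw [mem_union, mem_union, hU h, hW h]

theorem Saturated.inter (hU : Saturated x U) (hW : Saturated x W) : Saturated x (U ∩ W) :=
  fun h => by rw [mem_inter, mem_inter, hU h, hW h]

theorem Saturated.sdiff (hU : Saturated x U) (hW : Saturated x W) : Saturated x (U \ W) :=
  fun h => by rw [mem_sdiff, mem_sdiff, hU h, hW h]

theorem Saturated.smul (hU : Saturated x U) (g : G) : Saturated x (g • U) :=
  fun h => by simp [mem_smul_iff, hU (g⁻¹ * h), mul_assoc]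

theorem ne_one_and_mul_self_ne_one (hx : orderOf x = 3) : x ≠ 1 ∧ x * x ≠ 1 := by
  refine ⟨by rintro rfl; simp at hx, fun h => ?_⟩
  have := orderOf_dvd_of_pow_eq_one (x := x) (n := 2) (by rw [sq, h])
  rw [hx] at this
  revert this; decide

theorem Saturated.three_le_card (hx : orderOf x = 3) (hU : Saturated x U) (h : U.Nonempty) :
    3 ≤ U.card := by
  obtain ⟨g, hg⟩ := h
  obtain ⟨h1, h2⟩ := ne_one_and_mul_self_ne_one hx
  rw [← card_eq_three.2 ⟨g, g * x, g * x * x, by simpa using h1, by simpa [mul_assoc] using h2,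
    by simpa using h1, rfl⟩]
  refine card_le_card fun k hk => ?_
  simp only [mem_insert, mem_singleton] at hk
  rcases hk with rfl | rfl | rfl
  · exact hg
  · exact (hU _).1 hg
  · exact (hU _).1 ((hU _).1 hg)

theorem cut_eq_zero_or_card (hU : ∀ g : G, (g • U ∩ U).Nonempty → g • U = U) :
    cut a U = 0 ∨ cut a U = U.card := by
  by_cases h : ∃ h ∈ U, h * a ∈ U
  · obtain ⟨h, hh, hha⟩ := h
    left
    rw [cut, card_eq_zero, filter_eq_empty_iff]
    intro k hk
    have h1 : (k * h⁻¹) • U = U :=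
      hU _ ⟨k, by simp [mem_smul_iff, hk, hh]⟩
    rw [not_not, ← h1]
    simpa [mem_smul_iff, mul_assoc] using hha
  · right
    push Not at h
    rw [cut, filter_true_of_mem h]

variable [Fintype G]

theorem cut_eq_sum : cut a U = ∑ h, if h ∈ U ∧ h * a ∉ U then 1 else 0 := by
  rw [cut, card_eq_sum_ones, sum_filter, ← sum_filter_add_sum_filter_not univ (· ∈ U)]
  simp [ite_and, filter_not]

theorem cut_compl (ha : a * a = 1) : cut a Uᶜ = cut a U := by
  refine card_bij' (fun h _ => h * a) (fun h _ => h * a) ?_ ?_ ?_ ?_ <;>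
    simp +contextual [mul_assoc, ha]

theorem cut_union_add_cut_inter_le : cut a (U ∪ W) + cut a (U ∩ W) ≤ cut a U + cut a W := by
  simp only [cut_eq_sum, ← sum_add_distrib]
  refine sum_le_sum fun h _ => ?_
  by_cases h1 : h ∈ U <;> by_cases h2 : h ∈ W <;> by_cases h3 : h * a ∈ U <;>
    by_cases h4 : h * a ∈ W <;> simp [h1, h2, h3, h4]

theorem cut_sdiff_add_cut_sdiff_le (ha : a * a = 1) :
    cut a (U \ W) + cut a (W \ U) ≤ cut a U + cut a W := by
  have h := cut_union_add_cut_inter_le (a := a) (U := U) (W := Wᶜ)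
  rw [cut_compl ha (U := W), ← cut_compl ha (U := U ∪ Wᶜ)] at h
  have h1 : (U ∪ Wᶜ)ᶜ = W \ U := by ext; simp; tauto
  have h2 : U ∩ Wᶜ = U \ W := by ext; simp
  rw [h1, h2] at h
  omega

theorem Saturated.compl (hU : Saturated x U) : Saturated x Uᶜ :=
  fun h => by rw [mem_compl, mem_compl, hU h]

theorem eq_univ_of_cut_eq_zero (hgen : Subgroup.closure ({a, x} : Set G) = ⊤) (ha : a * a = 1)
    (hU : Saturated x U) (h : U.Nonempty) (h0 : cut a U = 0) : U = univ := by
  have ha' : Saturated a U := by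
    have : ∀ h ∈ U, h * a ∈ U := by simpa [cut, filter_eq_empty_iff] using h0
    exact fun h => ⟨this h, fun h' => by simpa [mul_assoc, ha] using this _ h'⟩
  have key : ∀ k ∈ Subgroup.closure ({a, x} : Set G), Saturated k U := by
    intro k hk
    induction hk using Subgroup.closure_induction with
    | mem k hk => rcases hk with rfl | rfl <;> assumption
    | one => intro; simp
    | mul k l _ _ hk hl => intro h; rw [hk h, hl (h * k), mul_assoc]
    | inv k _ hk => intro h; rw [hk (h * k⁻¹)]; simp
  obtain ⟨g, hg⟩ := h
  refine eq_univ_of_forall fun h => ?_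
  simpa using (key (g⁻¹ * h) (by simp [hgen]) g).1 hg

theorem exists_smul_ne (hgen : Subgroup.closure ({a, x} : Set G) = ⊤) (ha : a * a = 1)
    (hU : Saturated x U) (h : U.Nonempty) (h' : Uᶜ.Nonempty) (hlt : cut a U < U.card) :
    ∃ g : G, (g • U ∩ U).Nonempty ∧ (g • U \ U).Nonempty ∧ (U \ g • U).Nonempty := by
  by_contra! hcon
  have h1 : ∀ g : G, (g • U ∩ U).Nonempty → g • U = U := by
    intro g hg
    by_cases h2 : (g • U \ U).Nonempty
    · exact (eq_of_subset_of_card_le (sdiff_eq_empty_iff_subset.1 (hcon g hg h2))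
        (by simp)).symm
    · rw [not_nonempty_iff_eq_empty, sdiff_eq_empty_iff_subset] at h2
      exact eq_of_subset_of_card_le h2 (by simp)
  rcases cut_eq_zero_or_card (a := a) h1 with h2 | h2
  · rw [eq_univ_of_cut_eq_zero hgen ha hU h h2] at h'
    simp at h'
  · omega

theorem nonempty_compl_union_smul (g : G) (hle : U.card ≤ Uᶜ.card) (h : (g • U ∩ U).Nonempty) :
    (g • U ∪ U)ᶜ.Nonempty := by
  rw [← card_pos, card_compl]
  rw [card_compl] at hle
  have h1 := card_union_add_card_inter (g • U) U
  have h2 := card_pos.2 h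
  have h3 := card_le_univ U
  have h4 := card_smul_finset g U
  have h5 := card_pos.2 (h.mono inter_subset_right)
  omega

theorem three_le_cut (hgen : Subgroup.closure ({a, x} : Set G) = ⊤) (ha : a * a = 1)
    (hx : orderOf x = 3) (hU : Saturated x U) (h : U.Nonempty) (h' : Uᶜ.Nonempty) :
    3 ≤ cut a U := by
  classical
  let S : Finset (Finset G) := univ.filter fun U => Saturated x U ∧ U.Nonempty ∧ Uᶜ.Nonempty
  have hS : ∀ {U}, U ∈ S ↔ Saturated x U ∧ U.Nonempty ∧ Uᶜ.Nonempty := by simp [S]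
  obtain ⟨V, hV, hVmin⟩ := S.exists_min_image (cut a) ⟨U, hS.2 ⟨hU, h, h'⟩⟩
  obtain ⟨W, hW, hWmin⟩ := (S.filter fun W => cut a W = cut a V).exists_min_image card
    ⟨V, by simp [hV]⟩
  obtain ⟨hWS, hWV⟩ := mem_filter.1 hW
  obtain ⟨h1, h2, h3⟩ := hS.1 hWS
  have hle : W.card ≤ Wᶜ.card := hWmin _ (mem_filter.2
    ⟨hS.2 ⟨h1.compl, h3, by simpa using h2⟩, by rw [cut_compl ha, hWV]⟩)
  by_contra! hlt
  have hV3 := hVmin U (hS.2 ⟨hU, h, h'⟩)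
  obtain ⟨g, hg, -, hg'⟩ := exists_smul_ne hgen ha h1 h2 h3
    (by have := h1.three_le_card hx h2; omega)
  have h4 := cut_union_add_cut_inter_le (a := a) (U := g • W) (W := W)
  have hint : g • W ∩ W ∈ S := hS.2 ⟨(h1.smul g).inter h1, hg,
    h3.mono (compl_subset_compl.2 inter_subset_right)⟩
  have hun : g • W ∪ W ∈ S := hS.2 ⟨(h1.smul g).union h1, h2.mono subset_union_right,
    nonempty_compl_union_smul g hle hg⟩
  have h5 := hVmin _ hint
  have h6 := hVmin _ hun
  rw [cut_smul] at h4
  have h7 := hWmin (g • W ∩ W) (mem_filter.2 ⟨hint, by omega⟩)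
  have h8 := card_inter_add_card_sdiff W (g • W)
  have h9 := card_pos.2 hg'
  rw [inter_comm] at h7
  omega

theorem card_le_three_of_cut_eq_three (hgen : Subgroup.closure ({a, x} : Set G) = ⊤)
    (ha : a * a = 1) (ha1 : a ≠ 1) (hx : orderOf x = 3) (hU : Saturated x U)
    (hcut : cut a U = 3) : U.card ≤ 3 ∨ Uᶜ.card ≤ 3 := by
  classical
  by_contra! hcon
  let S : Finset (Finset G) :=
    univ.filter fun U => Saturated x U ∧ cut a U = 3 ∧ 3 < U.card ∧ 3 < Uᶜ.card
  have hS : ∀ {U}, U ∈ S ↔ Saturated x U ∧ cut a U = 3 ∧ 3 < U.card ∧ 3 < Uᶜ.card := by simp [S]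
  obtain ⟨W, hW, hWmin⟩ := S.exists_min_image card ⟨U, hS.2 ⟨hU, hcut, hcon⟩⟩
  obtain ⟨h1, h2, h3, h4⟩ := hS.1 hW
  have hle : W.card ≤ Wᶜ.card :=
    hWmin _ (hS.2 ⟨h1.compl, by rw [cut_compl ha, h2], h4, by simpa using h3⟩)
  have hne : W.Nonempty := card_pos.1 (by omega)
  have hne' : Wᶜ.Nonempty := card_pos.1 (by omega)
  obtain ⟨g, hg, hg1, hg2⟩ := exists_smul_ne hgen ha h1 hne hne' (by omega)
  have small : ∀ X ⊂ W, Saturated x X → cut a X = 3 → X.card ≤ 3 := by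
    intro X hX hXs hXc
    by_contra! hX3
    have h5 := hWmin X (hS.2 ⟨hXs, hXc, hX3,
      h4.trans_le (card_le_card (compl_subset_compl.2 hX.subset))⟩)
    exact absurd (card_lt_card hX) (not_lt.2 h5)
  have sat := h1.smul g
  have c3 : ∀ X, Saturated x X → X.Nonempty → Xᶜ.Nonempty → 3 ≤ cut a X :=
    fun X => three_le_cut hgen ha hx
  have h5 := cut_union_add_cut_inter_le (a := a) (U := g • W) (W := W)
  have h6 := cut_sdiff_add_cut_sdiff_le (U := g • W) (W := W) ha
  rw [cut_smul, h2] at h5 h6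
  have h7 := c3 _ (sat.inter h1) hg (hne'.mono (compl_subset_compl.2 inter_subset_right))
  have h8 := c3 _ (sat.union h1) (hne.mono subset_union_right) (nonempty_compl_union_smul g hle hg)
  have h9 := c3 _ (sat.sdiff h1) hg1 (hne.mono fun k hk => by simp [hk])
  have h10 := c3 _ (h1.sdiff sat) hg2 (hne'.mono (compl_subset_compl.2 sdiff_subset))
  have h11 := small (g • W ∩ W) (ssubset_of_ne_of_subset (fun h => by
    rw [inter_eq_right, ← sdiff_eq_empty_iff_subset] at h; simp [h] at hg2) inter_subset_right)
    (sat.inter h1) (by omega)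
  have h12 := small (W \ g • W) (ssubset_of_ne_of_subset (fun h => by
    rw [_root_.sdiff_eq_self_iff_disjoint, disjoint_iff_inter_eq_empty] at h
    simp [h] at hg) sdiff_subset) (h1.sdiff sat) (by omega)
  have h13 := (sat.inter h1).three_le_card hx hg
  have h14 := (h1.sdiff sat).three_le_card hx hg2
  have h15 := card_inter_add_card_sdiff W (g • W)
  rw [inter_comm] at h15
  have h16 := even_cut_add_card (U := W) ha ha1
  rw [h2, Nat.even_iff] at h16
  omega

/-- The left coset `{h, h * x, h * x * x}` of `h`. -/
abbrev triangle (x h : G) : G ⧸ Subgroup.zpowers x := QuotientGroup.mk h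

theorem triangle_eq_iff (hx : orderOf x = 3) {g h : G} :
    triangle x h = triangle x g ↔ h = g ∨ h = g * x ∨ h = g * x * x := by
  have : Finset.range 3 = {0, 1, 2} := rfl
  have hfin : IsOfFinOrder x := by rw [← orderOf_pos_iff, hx]; norm_num
  rw [eq_comm, QuotientGroup.eq, hfin.mem_zpowers_iff_mem_range_orderOf, hx, this]
  simp only [image_insert, image_singleton, mem_insert, mem_singleton, pow_zero, pow_one, sq,
    inv_mul_eq_iff_eq_mul, mul_one, mul_assoc]

theorem triangle_mul (h : G) : triangle x (h * x) = triangle x h := by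
  rw [eq_comm, QuotientGroup.eq]
  simp

theorem filter_triangle_eq (hx : orderOf x = 3) [DecidableEq (G ⧸ Subgroup.zpowers x)] (g : G) :
    (univ.filter fun h => triangle x h = triangle x g) = {g, g * x, g * x * x} := by
  ext h
  simp [triangle_eq_iff hx]

section

variable [DecidableEq (G ⧸ Subgroup.zpowers x)] {D X : Finset (G ⧸ Subgroup.zpowers x)}
  {E K : Finset G}

theorem card_filter_triangle_eq (hx : orderOf x = 3) (v : G ⧸ Subgroup.zpowers x) :
    (univ.filter fun h => triangle x h = v).card = 3 := by
  obtain ⟨g, rfl⟩ := QuotientGroup.mk_surjective v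
  obtain ⟨h1, h2⟩ := ne_one_and_mul_self_ne_one hx
  rw [filter_triangle_eq hx]
  exact card_eq_three.2 ⟨g, g * x, g * x * x, by simpa using h1, by simpa [mul_assoc] using h2,
    by simpa using h1, rfl⟩

theorem card_filter_triangle_mem (hx : orderOf x = 3) (D : Finset (G ⧸ Subgroup.zpowers x)) :
    (univ.filter fun h => triangle x h ∈ D).card = 3 * D.card := by
  rw [card_eq_sum_card_fiberwise (f := triangle x) (t := D) (by intro h; simp), mul_comm,
    ← smul_eq_mul, ← sum_const]
  refine sum_congr rfl fun v hv => ?_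
  rw [← card_filter_triangle_eq hx v, filter_filter]
  congr 1
  ext h
  simp only [mem_filter, mem_univ, true_and, and_iff_right_iff_imp]
  rintro rfl
  exact hv

theorem saturated_filter_triangle_mem (D : Finset (G ⧸ Subgroup.zpowers x)) :
    Saturated x (univ.filter fun h => triangle x h ∈ D) :=
  fun h => by simp only [mem_filter, mem_univ, true_and, triangle_mul]

theorem eq_univ_of_closed (hgen : Subgroup.closure ({a, x} : Set G) = ⊤) (ha : a * a = 1)
    [Fintype (G ⧸ Subgroup.zpowers x)] (hD : D.Nonempty)
    (h : ∀ h, triangle x h ∈ D → triangle x (h * a) ∈ D) : D = univ := by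
  have h1 := eq_univ_of_cut_eq_zero hgen ha (saturated_filter_triangle_mem D)
    (by
      obtain ⟨v, hv⟩ := hD
      obtain ⟨g, rfl⟩ := QuotientGroup.mk_surjective v
      exact ⟨g, by simpa using hv⟩)
    (by simpa [cut, filter_eq_empty_iff] using h)
  refine eq_univ_of_forall fun v => ?_
  obtain ⟨g, rfl⟩ := QuotientGroup.mk_surjective v
  have := mem_univ g
  rw [← h1] at this
  simpa using this

theorem exists_transversal (ha : a * a = 1) (ha1 : a ≠ 1) :
    ∃ E : Finset G, ∀ h, h ∈ E ↔ h * a ∉ E := by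
  let e := Fintype.equivFin G
  refine ⟨univ.filter fun h => e h < e (h * a), fun h => ?_⟩
  have : e h ≠ e (h * a) := by simpa using ha1
  simp only [mem_filter, mem_univ, true_and, mul_assoc, ha, mul_one, not_lt]
  exact ⟨le_of_lt, fun h => lt_of_le_of_ne h this⟩

theorem sum_eq_sum_transversal (ha : a * a = 1) (hE : ∀ h, h ∈ E ↔ h * a ∉ E) (f : G → ℕ) :
    ∑ h, f h = ∑ h ∈ E, (f h + f (h * a)) := by
  rw [sum_add_distrib, ← sum_add_sum_compl E]
  congr 1
  refine sum_bij' (fun h _ => h * a) (fun h _ => h * a) ?_ ?_ ?_ ?_ ?_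
  · intro h hh
    by_contra hh'
    exact mem_compl.1 hh ((hE h).2 hh')
  · exact fun h hh => mem_compl.2 fun hh' => (hE h).1 hh hh'
  all_goals simp [mul_assoc, ha]

theorem cut_add_le (hx : orderOf x = 3) (ha : a * a = 1) (hE : ∀ h, h ∈ E ↔ h * a ∉ E)
    (hK : K ⊆ E) (hD : ∀ h ∈ K, triangle x h ∈ D ↔ triangle x (h * a) ∈ D) :
    cut a (univ.filter fun h => triangle x h ∈ D) +
      2 * (K.filter fun h => triangle x h ∈ D).card ≤ 3 * D.card := by
  have h1 : (K.filter fun h => triangle x h ∈ D).card =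
      ∑ h ∈ E, if h ∈ K ∧ triangle x h ∈ D then 1 else 0 := by
    rw [← card_filter]
    congr 1
    ext h
    simp only [mem_filter]
    exact ⟨fun h => ⟨hK h.1, h⟩, fun h => h.2⟩
  rw [← card_filter_triangle_mem hx D, cut_eq_sum, h1, card_filter, sum_eq_sum_transversal ha hE,
    sum_eq_sum_transversal ha hE, mul_sum, ← sum_add_distrib]
  refine sum_le_sum fun h _ => ?_
  have h2 := hD h
  clear hD hE h1 hK
  by_cases h3 : h ∈ K <;> by_cases h4 : triangle x h ∈ D <;>
    by_cases h5 : triangle x (h * a) ∈ D <;> simp_all [mul_assoc]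

/-- The cubic multigraph obtained by contracting the left cosets of `x` satisfies Nebeský's
condition. -/
theorem nebesky (hgen : Subgroup.closure ({a, x} : Set G) = ⊤) (ha : a * a = 1) (ha1 : a ≠ 1)
    (hx : orderOf x = 3) (hcard : Fintype.card G % 4 = 2) [Fintype (G ⧸ Subgroup.zpowers x)]
    (hE : ∀ h, h ∈ E ↔ h * a ∉ E) :
    Multigraph.Nebesky (triangle x) (fun h => triangle x (h * a)) (fun _ => 0) E := by
  classical
  intro K hK
  have hE1 : 2 * E.card = Fintype.card G := by
    have := sum_eq_sum_transversal ha hE fun _ => 1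
    simp only [sum_const, smul_eq_mul, mul_one, card_univ] at this
    omega
  have hV : 3 * Fintype.card (G ⧸ Subgroup.zpowers x) = Fintype.card G := by
    have := card_filter_triangle_mem hx univ
    simpa using this.symm
  have hEn : 1 ≤ (Multigraph.comps (triangle x) (fun h => triangle x (h * a)) E).card :=
    card_pos.2 ⟨_, Multigraph.comp_mem_comps (v := triangle x 1)⟩
  by_cases huniv : univ ∈ Multigraph.comps (triangle x) (fun h => triangle x (h * a)) K
  · have h1 : Multigraph.comps (triangle x) (fun h => triangle x (h * a)) K = {univ} := by
      refine eq_singleton_iff_unique_mem.2 ⟨huniv, fun C hC => ?_⟩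
      obtain ⟨v, hv⟩ := Multigraph.nonempty_of_mem_comps hC
      exact Multigraph.eq_of_mem_of_mem hC huniv hv (mem_univ v)
    rw [Multigraph.totalWeight, h1, sum_singleton]
    by_cases hKE : K = E
    · subst hKE
      rw [Multigraph.weight, if_neg]
      · omega
      · simp only [Multigraph.excess, mem_univ, filter_true, zero_add, sum_const, smul_eq_mul,
          mul_one, card_univ]
        rw [Nat.even_iff]
        omega
    · have h2 := card_lt_card (ssubset_of_subset_of_ne hK hKE)
      have h3 := Multigraph.weight_le_two (s := triangle x) (p := fun _ => 0) (K := K)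
        (D := univ)
      omega
  · have h1 : ∀ C ∈ Multigraph.comps (triangle x) (fun h => triangle x (h * a)) K,
        2 * Multigraph.weight (triangle x) (fun _ => 0) K C +
          2 * (K.filter fun h => triangle x h ∈ C).card ≤ 3 * C.card := by
      intro C hC
      have hne := Multigraph.nonempty_of_mem_comps hC
      have hcompl : Cᶜ.Nonempty := by
        rw [nonempty_iff_ne_empty, Ne, compl_eq_empty_iff]
        rintro rfl
        exact huniv hC
      have hUc : (univ.filter fun h => triangle x h ∈ C)ᶜ =
          univ.filter fun h => triangle x h ∈ Cᶜ := by
        ext; simp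
      have hU := saturated_filter_triangle_mem C
      have h2 := cut_add_le hx ha hE hK fun h hh => Multigraph.mem_comps_closed hC hh
      have h3 := card_filter_triangle_mem hx C
      have h4 := card_filter_triangle_mem hx Cᶜ
      have h5 := three_le_cut hgen ha hx hU (card_pos.1 (by have := card_pos.2 hne; omega))
        (card_pos.1 (by have := card_pos.2 hcompl; rw [hUc]; omega))
      have h6 := card_le_three_of_cut_eq_three hgen ha ha1 hx hU
      have h7 := card_add_card_compl C
      have h8 := card_pos.2 hne
      have h9 := card_pos.2 hcompl
      rw [hUc, h3, h4] at h6
      have h10 : Multigraph.excess (triangle x) (fun _ => 0) K C =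
          (K.filter fun h => triangle x h ∈ C).card + C.card := by
        simp [Multigraph.excess]
      rw [Multigraph.weight, h10]
      split_ifs with h11
      · rw [Nat.even_iff] at h11
        omega
      · omega
    have h2 := sum_le_sum h1
    rw [sum_add_distrib, ← mul_sum, ← mul_sum, ← mul_sum, Multigraph.sum_card_edges] at h2
    have h3 := Multigraph.sum_comps (s := triangle x) (t := fun h => triangle x (h * a)) K
      fun _ => 1
    simp only [sum_const, smul_eq_mul, mul_one, card_univ] at h3
    rw [h3] at h2
    unfold Multigraph.totalWeight
    omega

theorem triangle_mul_ne (ha : a * a = 1) (ha1 : a ≠ 1) (hx : orderOf x = 3) (h : G) :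
    triangle x (h * a) ≠ triangle x h := by
  rw [ne_comm, Ne, QuotientGroup.eq, inv_mul_cancel_left]
  intro hmem
  have h1 := orderOf_dvd_of_mem_zpowers hmem
  rw [orderOf_eq_prime (by rw [sq, ha]) ha1, hx] at h1
  revert h1; decide

theorem exists_tree_darts (hgen : Subgroup.closure ({a, x} : Set G) = ⊤) (ha : a * a = 1)
    (ha1 : a ≠ 1) (hx : orderOf x = 3) (hcard : Fintype.card G % 4 = 2)
    [Fintype (G ⧸ Subgroup.zpowers x)] :
    ∃ D H : Finset G, (∀ h, h ∈ D ↔ h * a ∈ D) ∧ (∀ h, h ∉ D → (h ∈ H ↔ h * a ∉ H)) ∧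
      Disjoint D H ∧ (∀ v, Even (H.filter fun h => triangle x h = v).card) ∧
      (∀ X : Finset (G ⧸ Subgroup.zpowers x), X.Nonempty →
        (∀ h ∈ D, triangle x h ∈ X → triangle x (h * a) ∈ X) → X = univ) ∧
      ∀ X : Finset (G ⧸ Subgroup.zpowers x), X.Nonempty →
        (D.filter fun h => triangle x h ∈ X ∧ triangle x (h * a) ∈ X).card + 2 ≤ 2 * X.card := by
  classical
  obtain ⟨E, hE⟩ := exists_transversal (G := G) ha ha1
  obtain ⟨T, hTE, head, hhead, hTc, hTcard, heven⟩ :=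
    (nebesky hgen ha ha1 hx hcard hE).exists_forest
  have hloop := triangle_mul_ne ha ha1 hx
  have haa : ∀ h : G, h * a * a = h := fun h => by rw [mul_assoc, ha, mul_one]
  have hEc : (Multigraph.comps (triangle x) (fun h => triangle x (h * a)) E).card = 1 := by
    rw [card_eq_one]
    refine ⟨univ, eq_singleton_iff_unique_mem.2 ?_⟩
    have h1 : ∀ C ∈ Multigraph.comps (triangle x) (fun h => triangle x (h * a)) E, C = univ := by
      refine fun C hC => eq_univ_of_closed hgen ha (Multigraph.nonempty_of_mem_comps hC) ?_
      intro h hh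
      by_cases h2 : h ∈ E
      · exact (Multigraph.mem_comps_closed hC h2).1 hh
      · have h3 : h * a ∈ E := by rwa [hE, haa]
        have h4 := Multigraph.mem_comps_closed hC h3
        rw [haa] at h4
        exact h4.2 hh
    have h2 := Multigraph.comp_mem_comps (s := triangle x) (t := fun h => triangle x (h * a))
      (K := E) (v := triangle x 1)
    exact ⟨h1 _ h2 ▸ h2, h1⟩
  rw [hEc] at hTc hTcard
  refine ⟨univ.filter fun h => h ∈ T ∨ h * a ∈ T, univ.filter fun h =>
    h ∈ E \ T ∧ head h = triangle x h ∨ h * a ∈ E \ T ∧ head (h * a) = triangle x h,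
    fun h => ?_, fun h hh => ?_, ?_, fun v => ?_, fun X hX hcl => ?_, fun X hX => ?_⟩
  · simp [haa, or_comm]
  · simp only [mem_filter, mem_univ, true_and, not_or, mem_sdiff, haa] at hh ⊢
    simp only [hh.1, hh.2, not_false_eq_true, and_true]
    by_cases h1 : h ∈ E
    · have h2 := (hE h).1 h1
      simp only [h1, h2, true_and, false_and, or_false]
      rcases hhead h with h3 | h3
      · simp [h3, (hloop h).symm]
      · simp [h3, hloop h]
    · have h2 : h * a ∈ E := by rwa [hE, haa]
      simp only [h1, h2, true_and, false_and, false_or]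
      rcases hhead (h * a) with h3 | h3
      · simp [h3, hloop h]
      · simp [h3, haa, (hloop h).symm]
  · rw [disjoint_left]
    intro h hh
    simp only [mem_filter, mem_univ, true_and, mem_sdiff] at hh ⊢
    rcases hh with hh | hh
    · simp [hh, (hE h).1 (hTE hh)]
    · have h1 := (hE (h * a)).1 (hTE hh)
      rw [haa] at h1
      simp [hh, h1]
  · have h1 := heven v
    rw [zero_add] at h1
    convert h1 using 1
    refine card_bij' (fun h _ => if h ∈ E then h else h * a)
      (fun e _ => if head e = triangle x e then e else e * a) ?_ ?_ ?_ ?_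
    · intro h hh
      simp only [mem_filter, mem_univ, true_and, mem_sdiff] at hh ⊢
      obtain ⟨hh | hh, rfl⟩ := hh
      · simp [hh]
      · have h2 := (hE (h * a)).1 hh.1.1
        rw [haa] at h2
        simp [hh, h2]
    · intro e he
      simp only [mem_filter, mem_univ, true_and, mem_sdiff] at he ⊢
      obtain ⟨he, rfl⟩ := he
      rcases hhead e with h2 | h2
      · simp [h2, he]
      · simp [h2, he, hloop, haa]
    · intro h hh
      simp only [mem_filter, mem_univ, true_and, mem_sdiff] at hh ⊢
      obtain ⟨hh | hh, rfl⟩ := hh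
      · simp [hh]
      · have h2 := (hE (h * a)).1 hh.1.1
        rw [haa] at h2
        simp [h2, hh.2, (hloop h).symm, haa]
    · intro e he
      simp only [mem_filter, mem_sdiff] at he ⊢
      obtain ⟨he, rfl⟩ := he
      rcases hhead e with h2 | h2
      · simp [h2, he]
      · simp [h2, hloop, haa, (hE e).1 he.1]
  · obtain ⟨C, hC⟩ := card_eq_one.1 hTc
    obtain ⟨v, hv⟩ := hX
    have h1 : ∀ w, Multigraph.comp (triangle x) (fun h => triangle x (h * a)) T w = C := fun w => by
      have := Multigraph.comp_mem_comps (s := triangle x) (t := fun h => triangle x (h * a))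
        (K := T) (v := w)
      simpa [hC] using this
    refine eq_univ_of_forall fun w => Multigraph.comp_subset hv (fun e he => ?_)
      (Multigraph.comp_eq_iff.1 ((h1 v).trans (h1 w).symm))
    simp only [mem_filter, mem_univ, true_and] at hcl
    refine ⟨hcl e (Or.inl he), fun h2 => ?_⟩
    have := hcl (e * a) (Or.inr (by rwa [haa])) h2
    rwa [haa] at this
  · have h1 : ((univ.filter fun h => h ∈ T ∨ h * a ∈ T).filter fun h =>
        triangle x h ∈ X ∧ triangle x (h * a) ∈ X).card =
        2 * (T.filter fun h => triangle x h ∈ X ∧ triangle x (h * a) ∈ X).card := by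
      have h2 : (T.filter fun h => triangle x h ∈ X ∧ triangle x (h * a) ∈ X) =
          E.filter fun h => h ∈ T ∧ triangle x h ∈ X ∧ triangle x (h * a) ∈ X := by
        ext h
        simp only [mem_filter]
        exact ⟨fun h => ⟨hTE h.1, h⟩, fun h => h.2⟩
      rw [h2, filter_filter, card_filter, card_filter, sum_eq_sum_transversal ha hE, mul_sum]
      refine sum_congr rfl fun h hh => ?_
      have h2 : h * a ∉ T := fun h3 => (hE h).1 hh (hTE h3)
      by_cases h3 : h ∈ T <;> by_cases h4 : triangle x h ∈ X <;>
        by_cases h5 : triangle x (h * a) ∈ X <;> simp [h2, h3, h4, h5, haa]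
    set L := T.filter fun h => triangle x h ∈ X ∧ triangle x (h * a) ∈ X with hL
    have h2 := Multigraph.card_comps_le_union (s := triangle x)
      (t := fun h => triangle x (h * a)) L (T \ L)
    rw [union_sdiff_of_subset (filter_subset _ _), hTc] at h2
    have h3 := card_sdiff_add_card_eq_card (filter_subset
      (fun h => triangle x h ∈ X ∧ triangle x (h * a) ∈ X) T)
    rw [← hL] at h3
    obtain ⟨v, hv⟩ := hX
    have h4 : insert (Multigraph.comp (triangle x) (fun h => triangle x (h * a)) L v)
        (Xᶜ.image fun w => {w}) ⊆
        Multigraph.comps (triangle x) (fun h => triangle x (h * a)) L := by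
      refine insert_subset Multigraph.comp_mem_comps fun C hC => ?_
      obtain ⟨w, hw, rfl⟩ := mem_image.1 hC
      rw [mem_compl] at hw
      have h5 : Multigraph.comp (triangle x) (fun h => triangle x (h * a)) L w = {w} := by
        refine (Multigraph.comp_subset (by simp) fun e he => ?_).antisymm
          (by simp [Multigraph.mem_comp_self])
        obtain ⟨-, he1, he2⟩ := mem_filter.1 he
        simp only [mem_singleton]
        exact ⟨fun h => absurd (h ▸ he1) hw, fun h => absurd (h ▸ he2) hw⟩
      rw [← h5]
      exact Multigraph.comp_mem_comps
    have h5 := card_le_card h4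
    rw [card_insert_of_notMem, card_image_of_injective _ singleton_injective] at h5
    · have h6 := card_add_card_compl X
      rw [h1]
      omega
    · intro hC
      obtain ⟨w, hw, hwC⟩ := mem_image.1 hC
      have := Multigraph.mem_comp_self (s := triangle x) (t := fun h => triangle x (h * a))
        (K := L) (v := v)
      rw [← hwC, mem_singleton] at this
      exact mem_compl.1 hw (this ▸ hv)

/-- The cubic multigraph obtained by contracting the left cosets of `x` contains an induced tree
whose complement is independent. -/
theorem exists_induced_tree (hgen : Subgroup.closure ({a, x} : Set G) = ⊤) (ha : a * a = 1)
    (ha1 : a ≠ 1) (hx : orderOf x = 3) (hcard : Fintype.card G % 4 = 2)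
    [Fintype (G ⧸ Subgroup.zpowers x)] :
    ∃ W : Finset (G ⧸ Subgroup.zpowers x), W.Nonempty ∧
      (∀ h, triangle x h ∈ W ∨ triangle x (h * a) ∈ W) ∧
      (∀ X ⊂ W, X.Nonempty → ∃ h, triangle x h ∈ W \ X ∧ triangle x (h * a) ∈ X) ∧
      ∀ X ⊆ W, X.Nonempty →
        (univ.filter fun h => triangle x h ∈ X ∧ triangle x (h * a) ∈ X).card + 2 ≤
          2 * X.card := by
  obtain ⟨D, H, hDa, hDH, hdisj, heven, hconn, hforest⟩ :=
    exists_tree_darts hgen ha ha1 hx hcard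
  have hloop := triangle_mul_ne ha ha1 hx
  have haa : ∀ h : G, h * a * a = h := fun h => by rw [mul_assoc, ha, mul_one]
  let W : Finset (G ⧸ Subgroup.zpowers x) := univ.filter fun v => ∀ h ∈ H, triangle x h ≠ v
  have hW : ∀ {v}, v ∈ W ↔ ∀ h ∈ H, triangle x h ≠ v := by simp [W]
  have hcount : ∀ v ∉ W, (D.filter fun h => triangle x h = v).card ≤ 1 ∧
      ∀ h, triangle x h = v → h ∈ D ∪ H := by
    intro v hv
    simp only [hW, not_forall, not_not] at hv
    obtain ⟨k, hk, hkv⟩ := hv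
    have h1 : 0 < (H.filter fun h => triangle x h = v).card :=
      card_pos.2 ⟨k, mem_filter.2 ⟨hk, hkv⟩⟩
    have h2 := heven v
    have h3 : (D.filter fun h => triangle x h = v).Nonempty := by
      rw [filter_nonempty_iff]
      by_contra! h4
      have h5 := hconn {v} (by simp) fun h hh hh' => absurd (mem_singleton.1 hh') (h4 h hh)
      have h6 : ∀ w, w = v := fun w => by simpa [← h5] using mem_univ w
      exact hloop 1 ((h6 _).trans (h6 _).symm)
    have h4 := card_pos.2 h3
    have h5 : ((D ∪ H).filter fun h => triangle x h = v) ⊆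
        univ.filter fun h => triangle x h = v := filter_subset_filter _ (subset_univ _)
    have h6 := card_le_card h5
    have h7 : ((D ∪ H).filter fun h => triangle x h = v).card =
        (D.filter fun h => triangle x h = v).card + (H.filter fun h => triangle x h = v).card := by
      rw [filter_union, card_union_of_disjoint (disjoint_filter_filter hdisj)]
    rw [card_filter_triangle_eq hx] at h6
    rw [Nat.even_iff] at h2
    refine ⟨by omega, fun h hh => ?_⟩
    have h8 := eq_of_subset_of_card_le h5 (by rw [card_filter_triangle_eq hx]; omega)
    have h9 : h ∈ univ.filter fun h => triangle x h = v := by simpa using hh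
    rw [← h8] at h9
    exact (mem_filter.1 h9).1
  have hcotree : ∀ h ∉ D, triangle x h ∉ W → triangle x (h * a) ∈ W := by
    intro h hh hv
    by_contra hv'
    have h1 := (mem_union.1 ((hcount _ hv).2 h rfl)).resolve_left hh
    have h2 := (mem_union.1 ((hcount _ hv').2 (h * a) rfl)).resolve_left (by rwa [← hDa])
    exact (hDH h hh).1 h1 h2
  have huniq : ∀ h ∈ D, ∀ k ∈ D, triangle x h = triangle x k → triangle x k ∉ W → h = k :=
    fun h hh k hk hhk hv => card_le_one.1 (hcount _ hv).1 h (mem_filter.2 ⟨hh, hhk⟩) k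
      (mem_filter.2 ⟨hk, rfl⟩)
  have hWne : W.Nonempty := by
    by_contra! h1
    have h2 : triangle x (1 : G) ∉ W := by simp [h1]
    simp only [hW, not_forall, not_not] at h2
    obtain ⟨k, hk, -⟩ := h2
    have := hcotree k (disjoint_right.1 hdisj hk) (by simp [h1])
    simp [h1] at this
  refine ⟨W, hWne, fun h => ?_, fun X hXW hX => ?_, fun X hXW hX => ?_⟩
  · by_contra! hcon
    obtain ⟨h1, h2⟩ := hcon
    have h3 : h ∈ D := by
      by_contra h3
      exact h2 (hcotree h h3 h1)
    have h4 := hconn {triangle x h, triangle x (h * a)} (by simp) (by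
      intro k hk hkX
      rcases mem_insert.1 hkX with h5 | h5
      · rw [huniq k hk h h3 h5 h1]; simp
      · rw [huniq k hk _ ((hDa h).1 h3) (mem_singleton.1 h5) h2, haa]; simp)
    obtain ⟨w, hw⟩ := hWne
    have h5 := mem_univ w
    rw [← h4, mem_insert, mem_singleton] at h5
    rcases h5 with rfl | rfl <;> contradiction
  · by_contra! hcon
    obtain ⟨w, hwW, hwX⟩ := exists_of_ssubset hXW
    have hX' : ∀ h, triangle x h ∈ X → triangle x (h * a) ∈ W → triangle x (h * a) ∈ X := by
      intro h h1 h2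
      by_contra h3
      exact hcon (h * a) (mem_sdiff.2 ⟨h2, h3⟩) (by rwa [haa])
    have h1 := hconn (X ∪ univ.filter fun v => v ∉ W ∧ ∃ h ∈ D, triangle x h = v ∧
      triangle x (h * a) ∈ X) (hX.mono subset_union_left) (by
        intro k hk hkX
        simp only [mem_union, mem_filter, mem_univ, true_and] at hkX ⊢
        rcases hkX with hkX | ⟨hkW, h, hh, hhk, hhX⟩
        · by_cases h2 : triangle x (k * a) ∈ W
          · exact Or.inl (hX' k hkX h2)
          · exact Or.inr ⟨h2, k * a, (hDa k).1 hk, rfl, by rwa [haa]⟩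
        · rw [← huniq h hh k hk hhk hkW]
          exact Or.inl hhX)
    have h2 := mem_univ w
    rw [← h1] at h2
    simp [hwW, hwX] at h2
  · refine le_trans (Nat.add_le_add_right (card_le_card fun h hh => ?_) 2) (hforest X hX)
    simp only [mem_filter, mem_univ, true_and] at hh ⊢
    refine ⟨?_, hh⟩
    by_contra hD
    have h1 : h ∉ H := fun h1 => hW.1 (hXW hh.1) h h1 rfl
    have h2 : h * a ∉ H := fun h2 => hW.1 (hXW hh.2) _ h2 rfl
    exact h1 ((hDH h hD).2 h2)

end

section

variable [DecidableEq (G ⧸ Subgroup.zpowers x)] {W X : Finset (G ⧸ Subgroup.zpowers x)}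

/-- Walk around the triangles of `W`, crossing the edges labelled `a` to the other triangles and
back. -/
def next (a x : G) [DecidableEq (G ⧸ Subgroup.zpowers x)] (W : Finset (G ⧸ Subgroup.zpowers x))
    (h : G) : G :=
  if triangle x (h * a) ∈ W then h * a * x else h * a

/-- Reachability under iteration of `next`. -/
def Reach (a x : G) [DecidableEq (G ⧸ Subgroup.zpowers x)]
    (W : Finset (G ⧸ Subgroup.zpowers x)) : G → G → Prop :=
  Relation.ReflTransGen fun h k => next a x W h = k

theorem reach_mul_a {h : G} (hh : triangle x (h * a) ∉ W) : Reach a x W h (h * a) :=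
  .single (if_neg hh)

theorem reach_mul_x (ha : a * a = 1) {h : G} (hh : triangle x h ∈ W) :
    Reach a x W (h * a) (h * x) := by
  have : h * a * a = h := by rw [mul_assoc, ha, mul_one]
  refine .single ?_
  rw [next, this, if_pos hh]

/-- The vertices on the triangles of `W` and their neighbours form a single orbit of `next`. -/
def SingleOrbit (a x : G) [DecidableEq (G ⧸ Subgroup.zpowers x)]
    (W : Finset (G ⧸ Subgroup.zpowers x)) : Prop :=
  ∀ h k, (triangle x h ∈ W ∨ triangle x (h * a) ∈ W) →
    (triangle x k ∈ W ∨ triangle x (k * a) ∈ W) → Reach a x W h k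

theorem mul_x_mul_x_mul_x (hx : orderOf x = 3) (g : G) : g * x * x * x = g := by
  rw [mul_assoc, mul_assoc, ← mul_assoc x, ← pow_three', ← hx, pow_orderOf_eq_one, mul_one]

theorem reach_hexagon (ha : a * a = 1) {g : G} (hg : triangle x g ∈ W)
    (h1 : triangle x (g * x * a) ∉ W) (h2 : triangle x (g * x * x * a) ∉ W) :
    Reach a x W (g * a) (g * x) ∧ Reach a x W (g * x) (g * x * a) ∧
      Reach a x W (g * x * a) (g * x * x) ∧ Reach a x W (g * x * x) (g * x * x * a) ∧
      Reach a x W (g * x * x * a) (g * x * x * x) :=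
  ⟨reach_mul_x ha hg, reach_mul_a h1, reach_mul_x ha (by rwa [triangle_mul]), reach_mul_a h2,
    reach_mul_x ha (by rwa [triangle_mul, triangle_mul])⟩

theorem mem_hexagon (ha : a * a = 1) (hx : orderOf x = 3) {g h : G}
    (hh : triangle x h = triangle x g ∨ triangle x (h * a) = triangle x g) :
    h = g ∨ h = g * x ∨ h = g * x * x ∨ h = g * a ∨ h = g * x * a ∨ h = g * x * x * a := by
  simp only [triangle_eq_iff hx] at hh
  have h1 : ∀ k, h * a = k ↔ h = k * a := fun k =>
    ⟨fun h => by rw [← h, mul_assoc, ha, mul_one], fun h => by rw [h, mul_assoc, ha, mul_one]⟩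
  simp only [h1] at hh
  tauto

theorem singleOrbit_singleton (ha : a * a = 1) (ha1 : a ≠ 1) (hx : orderOf x = 3) (g : G) :
    SingleOrbit a x {triangle x g} := by
  have hx3 := mul_x_mul_x_mul_x hx g
  have hloop : ∀ k, triangle x k = triangle x g →
      triangle x (k * a) ∉ ({triangle x g} : Finset _) :=
    fun k hk h => triangle_mul_ne ha ha1 hx k ((mem_singleton.1 h).trans hk.symm)
  have p0 := reach_mul_a (hloop g rfl)
  obtain ⟨p1, p2, p3, p4, p5⟩ := reach_hexagon (g := g) ha (mem_singleton_self _)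
    (hloop _ (triangle_mul _)) (hloop _ ((triangle_mul _).trans (triangle_mul _)))
  rw [hx3] at p5
  have key : ∀ h, (triangle x h ∈ ({triangle x g} : Finset _) ∨
      triangle x (h * a) ∈ ({triangle x g} : Finset _)) →
      Reach a x {triangle x g} g h ∧ Reach a x {triangle x g} h g := by
    intro h hh
    simp only [mem_singleton] at hh
    rcases mem_hexagon ha hx hh with rfl | rfl | rfl | rfl | rfl | rfl
    · exact ⟨.refl, .refl⟩
    · exact ⟨p0.trans p1, p2.trans <| p3.trans <| p4.trans p5⟩
    · exact ⟨p0.trans <| p1.trans <| p2.trans p3, p4.trans p5⟩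
    · exact ⟨p0, p1.trans <| p2.trans <| p3.trans <| p4.trans p5⟩
    · exact ⟨p0.trans <| p1.trans p2, p3.trans <| p4.trans p5⟩
    · exact ⟨p0.trans <| p1.trans <| p2.trans <| p3.trans p4, p5⟩
  exact fun h k hh hk => (key h hh).2.trans (key k hk).1

theorem SingleOrbit.insert (ha : a * a = 1) (ha1 : a ≠ 1) (hx : orderOf x = 3)
    (hW : SingleOrbit a x W) {g : G} (hg : triangle x g ∉ W) (h0 : triangle x (g * a) ∈ W)
    (h1 : triangle x (g * x * a) ∉ W) (h2 : triangle x (g * x * x * a) ∉ W) :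
    SingleOrbit a x (insert (triangle x g) W) := by
  have hx3 := mul_x_mul_x_mul_x hx g
  have haa : ∀ h : G, h * a * a = h := fun h => by rw [mul_assoc, ha, mul_one]
  have hloop : ∀ k, triangle x k = triangle x g → triangle x (k * a) ∉ W →
      triangle x (k * a) ∉ Insert.insert (triangle x g) W :=
    fun k hk h h' => (mem_insert.1 h').elim
      (fun h' => triangle_mul_ne ha ha1 hx k (h'.trans hk.symm)) h
  obtain ⟨p1, p2, p3, p4, p5⟩ := reach_hexagon (g := g) ha (mem_insert_self _ W)
    (hloop _ (triangle_mul _) h1) (hloop _ ((triangle_mul _).trans (triangle_mul _)) h2)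
  rw [hx3] at p5
  have hold : ∀ h k, (triangle x h ∈ W ∨ triangle x (h * a) ∈ W) → Reach a x W h k →
      Reach a x (Insert.insert (triangle x g) W) h k := by
    intro h k hh hhk
    induction hhk using Relation.ReflTransGen.head_induction_on with
    | refl => exact .refl
    | @head h l hstep _ ih =>
      have hl : triangle x l ∈ W ∨ triangle x (l * a) ∈ W := by
        rw [← hstep, next]
        split_ifs with h3
        · exact Or.inl (by rwa [triangle_mul])
        · exact Or.inr (by rw [haa]; tauto)
      refine Relation.ReflTransGen.trans ?_ (ih hl)
      by_cases h3 : triangle x (h * a) = triangle x g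
      · have h4 : next a x W h = h * a := if_neg (by rwa [h3])
        rw [h4] at hstep
        subst hstep
        have h5 : triangle x h ∈ W := hh.resolve_right (by rwa [h3])
        have h6 : h = h * a * a := (haa h).symm
        rcases (triangle_eq_iff hx).1 h3 with h7 | h7 | h7
        · rw [h7]
          rw [show h = g * a by rw [h6, h7]]
          exact p1.trans <| p2.trans <| p3.trans <| p4.trans p5
        · rw [h6, h7] at h5
          exact absurd h5 h1
        · rw [h6, h7] at h5
          exact absurd h5 h2
      · refine .single ?_
        rw [← hstep, next, next]
        simp only [mem_insert, h3, false_or]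
  have hga : triangle x (g * a) ∈ W ∨ triangle x (g * a * a) ∈ W := Or.inl h0
  have hg' : triangle x g ∈ W ∨ triangle x (g * a) ∈ W := Or.inr h0
  have p0 := hold _ _ hg' (hW g (g * a) hg' hga)
  have key : ∀ h, (triangle x h ∈ Insert.insert (triangle x g) W ∨
      triangle x (h * a) ∈ Insert.insert (triangle x g) W) →
      Reach a x (Insert.insert (triangle x g) W) (g * a) h ∧
        Reach a x (Insert.insert (triangle x g) W) h g := by
    intro h hh
    by_cases hhW : triangle x h ∈ W ∨ triangle x (h * a) ∈ W
    · exact ⟨hold _ _ hga (hW _ _ hga hhW), hold _ _ hhW (hW _ _ hhW hg')⟩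
    · simp only [mem_insert] at hh
      rcases mem_hexagon ha hx (g := g) (h := h) (by tauto) with rfl | rfl | rfl | rfl | rfl | rfl
      · exact absurd hg' hhW
      · exact ⟨p1, p2.trans <| p3.trans <| p4.trans p5⟩
      · exact ⟨p1.trans <| p2.trans p3, p4.trans p5⟩
      · exact absurd hga hhW
      · exact ⟨p1.trans p2, p3.trans <| p4.trans p5⟩
      · exact ⟨p1.trans <| p2.trans <| p3.trans p4, p5⟩
  exact fun h k hh hk => (key h hh).2.trans <| p0.trans (key k hk).1

/-- The darts of the contracted multigraph with both ends in `X`. -/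
def dartsIn (a x : G) [DecidableEq (G ⧸ Subgroup.zpowers x)]
    (X : Finset (G ⧸ Subgroup.zpowers x)) : Finset G :=
  univ.filter fun h => triangle x h ∈ X ∧ triangle x (h * a) ∈ X

theorem card_dartsIn_insert (ha : a * a = 1) {v : G ⧸ Subgroup.zpowers x} (hv : v ∉ X)
    {F : Finset G} (hF : ∀ h ∈ F, triangle x h = v ∧ triangle x (h * a) ∈ X) :
    (dartsIn a x X).card + 2 * F.card ≤ (dartsIn a x (insert v X)).card := by
  have haa : ∀ h : G, h * a * a = h := fun h => by rw [mul_assoc, ha, mul_one]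
  have h1 : Disjoint (dartsIn a x X) F := disjoint_left.2 fun h hh hh' =>
    hv ((hF h hh').1 ▸ (mem_filter.1 hh).2.1)
  have h2 : Disjoint (dartsIn a x X ∪ F) (F.image (· * a)) := by
    refine disjoint_right.2 fun h hh hh' => ?_
    obtain ⟨k, hk, rfl⟩ := mem_image.1 hh
    obtain ⟨h3, h4⟩ := hF k hk
    rcases mem_union.1 hh' with h5 | h5
    · have := (mem_filter.1 h5).2.2
      rw [haa, h3] at this
      exact hv this
    · exact hv ((hF _ h5).1 ▸ h4)
  have h3 : (F.image (· * a)).card = F.card :=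
    card_image_of_injective _ (mul_left_injective a)
  rw [two_mul, ← add_assoc, ← card_union_of_disjoint h1, ← h3, ← card_union_of_disjoint h2]
  refine card_le_card fun h hh => ?_
  simp only [dartsIn, mem_union, mem_image, mem_filter, mem_univ, true_and, mem_insert] at hh ⊢
  rcases hh with (hh | hh) | ⟨k, hk, rfl⟩
  · tauto
  · have := hF h hh
    tauto
  · have := hF k hk
    rw [haa]
    tauto

theorem singleOrbit_of_tree (ha : a * a = 1) (ha1 : a ≠ 1) (hx : orderOf x = 3)
    (hW : W.Nonempty)
    (hconn : ∀ X ⊂ W, X.Nonempty → ∃ h, triangle x h ∈ W \ X ∧ triangle x (h * a) ∈ X)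
    (hforest : ∀ X ⊆ W, X.Nonempty → (dartsIn a x X).card + 2 ≤ 2 * X.card) :
    SingleOrbit a x W := by
  have key : ∀ n < W.card, ∃ X ⊆ W, X.card = n + 1 ∧ 2 * X.card ≤ (dartsIn a x X).card + 2 ∧
      SingleOrbit a x X := by
    intro n hn
    induction n with
    | zero =>
      obtain ⟨v, hv⟩ := hW
      obtain ⟨g, rfl⟩ := QuotientGroup.mk_surjective v
      exact ⟨{triangle x g}, by simpa using hv, by simp, by simp,
        singleOrbit_singleton ha ha1 hx g⟩
    | succ n ih =>
      obtain ⟨X, hXW, hXn, hXd, hX⟩ := ih (by omega)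
      obtain ⟨g, hg, hga⟩ := hconn X (ssubset_of_subset_of_ne hXW (by rintro rfl; omega))
        (card_pos.1 (by omega))
      obtain ⟨hgW, hgX⟩ := mem_sdiff.1 hg
      have h1 := card_insert_of_notMem hgX
      have hsub := insert_subset hgW hXW
      have h2 := hforest _ hsub (insert_nonempty _ _)
      have hleaf : ∀ k, k ≠ g → triangle x k = triangle x g → triangle x (k * a) ∉ X := by
        intro k hkg hk hkX
        have h3 := card_dartsIn_insert ha hgX (F := {k, g}) (by simp [hk, hkX, hga])
        rw [card_pair hkg] at h3
        omega
      have h3 := card_dartsIn_insert ha hgX (F := {g}) (by simp [hga])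
      rw [card_singleton] at h3
      obtain ⟨hne1, hne2⟩ := ne_one_and_mul_self_ne_one hx
      exact ⟨_, hsub, by omega, by omega, hX.insert ha ha1 hx hgX hga
        (hleaf _ (by simpa using hne1) (triangle_mul _))
        (hleaf _ (by simpa [mul_assoc] using hne2) ((triangle_mul _).trans (triangle_mul _)))⟩
  have hpos := card_pos.2 hW
  obtain ⟨X, hXW, hXn, -, hX⟩ := key (W.card - 1) (by omega)
  rwa [eq_of_subset_of_card_le hXW (by omega)] at hX

end

end CayleyTriangle

/-- If `G` is a finite group generated by an involution `a` and an element `b` of order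
`s ≥ 3` with `ab` of order `3`, and `|G| ≡ 2 (mod 4)`, then `Cay(G, {a, b, b⁻¹})`
has a Hamilton cycle. -/
theorem stmt0 {G : Type*} [Group G] [Fintype G] [DecidableEq G] (a b : G) (s : ℕ)
    (hs : 3 ≤ s) (ha : orderOf a = 2) (hb : orderOf b = s) (hab : orderOf (a * b) = 3)
    (hgen : Subgroup.closure ({a, b} : Set G) = ⊤)
    (hcard : Fintype.card G % 4 = 2) :
    (cayleyGraph a b).IsHamiltonian := by
  classical
  have : Fintype (G ⧸ Subgroup.zpowers (a * b)) := Fintype.ofFinite _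
  have ha1 : a ≠ 1 := by rintro rfl; simp at ha
  have hb1 : b ≠ 1 := by rintro rfl; simp at hb; omega
  have haa : a * a = 1 := by rw [← sq, ← ha, pow_orderOf_eq_one]
  have hgen' : Subgroup.closure ({a, a * b} : Set G) = ⊤ := by
    rw [eq_top_iff, ← hgen, Subgroup.closure_le]
    have h1 : a ∈ Subgroup.closure ({a, a * b} : Set G) := Subgroup.subset_closure (by simp)
    have h2 : a * b ∈ Subgroup.closure ({a, a * b} : Set G) := Subgroup.subset_closure (by simp)
    rintro _ (rfl | rfl)
    · exact h1
    · have := mul_mem h1 h2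
      rwa [← mul_assoc, haa, one_mul] at this
  obtain ⟨W, hW, hindep, hconn, hforest⟩ :=
    CayleyTriangle.exists_induced_tree hgen' haa ha1 hab hcard
  have horbit := CayleyTriangle.singleOrbit_of_tree haa ha1 hab hW hconn hforest
  refine SimpleGraph.isHamiltonian_of_reflTransGen (CayleyTriangle.next a (a * b) W) (fun h => ?_)
    (fun h k => horbit h k (hindep h) (hindep k)) ?_
  · rw [CayleyTriangle.next, mul_assoc h, ← mul_assoc a, haa, one_mul]
    split_ifs <;> simp [cayleyGraph, SimpleGraph.fromRel_adj, ha1, hb1]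
  · have h1 := orderOf_le_card_univ (x := a * b)
    omega
end

section
/- Let s ≥ 3 be an integer and let G be a finite group generated by an involution a and an element b of order s such that ab has order 3. If |G| ≡ 0 (mod 4), then the Cayley graph Cay(G,{a,b,b⁻¹}) contains a cycle of length |G| − 2. -/
open Module

section AlternatingForms

variable {V : Type*} [AddCommGroup V] [Module ℝ V]

/-- The radical of the restriction of a bilinear form to a subspace. -/
def radical (B : LinearMap.BilinForm ℝ V) (Z : Submodule ℝ V) : Submodule ℝ V where
  carrier := {x | x ∈ Z ∧ ∀ z ∈ Z, B x z = 0}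
  add_mem' := by
    rintro x y ⟨hx, hx'⟩ ⟨hy, hy'⟩
    exact ⟨Z.add_mem hx hy, fun z hz => by simp [hx' z hz, hy' z hz]⟩
  zero_mem' := ⟨Z.zero_mem, by simp⟩
  smul_mem' := by
    rintro c x ⟨hx, hx'⟩
    exact ⟨Z.smul_mem c hx, fun z hz => by simp [hx' z hz]⟩

theorem mem_radical {B : LinearMap.BilinForm ℝ V} {Z : Submodule ℝ V} {x : V} :
    x ∈ radical B Z ↔ x ∈ Z ∧ ∀ z ∈ Z, B x z = 0 := Iff.rfl

theorem radical_le (B : LinearMap.BilinForm ℝ V) (Z : Submodule ℝ V) : radical B Z ≤ Z :=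
  fun _ hx => hx.1

theorem radical_inf_ker_eq {B : LinearMap.BilinForm ℝ V} (hB : B.IsAlt)
    {Z : Submodule ℝ V} {f : V →ₗ[ℝ] ℝ} (hf : ¬ radical B Z ≤ LinearMap.ker f) :
    radical B (Z ⊓ LinearMap.ker f) = radical B Z ⊓ LinearMap.ker f := by
  obtain ⟨r, hr, hfr⟩ := SetLike.not_le_iff_exists.1 hf
  rw [LinearMap.mem_ker] at hfr
  ext x
  simp only [mem_radical, Submodule.mem_inf, LinearMap.mem_ker]
  constructor
  · rintro ⟨⟨hxZ, hx⟩, h⟩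
    refine ⟨⟨hxZ, fun z hz => ?_⟩, hx⟩
    have h1 := h (z - (f z / f r) • r) ⟨Z.sub_mem hz (Z.smul_mem _ hr.1), by simp [hfr]⟩
    have h2 : B x r = 0 := by rw [← hB.neg_eq, hr.2 x hxZ, neg_zero]
    simpa [h2] using h1
  · rintro ⟨⟨hxZ, h⟩, hx⟩
    exact ⟨⟨hxZ, hx⟩, fun z hz => h z hz.1⟩

/-- The alternating form `p ∧ q`. -/
noncomputable def wedge (p q : Dual ℝ V) : LinearMap.BilinForm ℝ V :=
  p.smulRight q - q.smulRight p

@[simp]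
theorem wedge_apply (p q : Dual ℝ V) (x z : V) : wedge p q x z = p x * q z - q x * p z := by
  simp [wedge]

theorem isAlt_sum_smul_wedge {I : Type*} [Fintype I] (p q : I → Dual ℝ V) (y : I → ℝ) :
    (∑ i, y i • wedge (p i) (q i)).IsAlt := by
  intro x
  simp [LinearMap.sum_apply, mul_comm]

variable [FiniteDimensional ℝ V]

theorem exists_represent_of_radical_le_ker {B : LinearMap.BilinForm ℝ V} (hB : B.IsAlt)
    {Z : Submodule ℝ V} {f : V →ₗ[ℝ] ℝ} (hf : radical B Z ≤ LinearMap.ker f) :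
    ∃ w ∈ Z, ∀ z ∈ Z, f z = B w z := by
  let L : Z →ₗ[ℝ] Dual ℝ Z := B.domRestrict₁₂ Z Z
  have h : f.domRestrict Z ∈ LinearMap.range L.dualMap := by
    rw [LinearMap.range_dualMap_eq_dualAnnihilator_ker, Submodule.mem_dualAnnihilator]
    intro x hx
    have hx' : (x : V) ∈ radical B Z := by
      refine ⟨x.2, fun z hz => ?_⟩
      have := LinearMap.congr_fun (LinearMap.mem_ker.1 hx) ⟨z, hz⟩
      exact this
    simpa using hf hx'
  obtain ⟨ξ, hξ⟩ := h
  obtain ⟨w, rfl⟩ := (evalEquiv ℝ Z).surjective ξ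
  refine ⟨-w, Z.neg_mem w.2, fun z hz => ?_⟩
  have := LinearMap.congr_fun hξ ⟨z, hz⟩
  have h2 : B z w = f z := this
  rw [← h2, map_neg, LinearMap.neg_apply, hB.neg_eq]

/-- The dimension of a subspace plus the dimension of the radical of a form on it. -/
noncomputable def radicalDefect (B : LinearMap.BilinForm ℝ V) (Z : Submodule ℝ V) : ℕ :=
  finrank ℝ Z + finrank ℝ (radical B Z)

theorem finrank_inf_ker_add_one {Z : Submodule ℝ V} {f : V →ₗ[ℝ] ℝ}
    (hf : ¬ Z ≤ LinearMap.ker f) :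
    finrank ℝ (Z ⊓ LinearMap.ker f : Submodule ℝ V) + 1 = finrank ℝ Z := by
  have h1 := LinearMap.finrank_range_add_finrank_ker (f.domRestrict Z)
  have h2 : LinearMap.range (f.domRestrict Z) = ⊤ := by
    apply LinearMap.range_eq_top.2
    apply LinearMap.surjective
    intro h
    apply hf
    intro z hz
    exact LinearMap.congr_fun h ⟨z, hz⟩
  rw [h2, finrank_top, finrank_self] at h1
  have h3 : (LinearMap.ker (f.domRestrict Z)).map Z.subtype = Z ⊓ LinearMap.ker f := by
    ext x
    simp only [Submodule.mem_map, LinearMap.mem_ker, Submodule.mem_inf]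
    constructor
    · rintro ⟨z, hz, rfl⟩
      exact ⟨z.2, hz⟩
    · rintro ⟨hx, hx'⟩
      exact ⟨⟨x, hx⟩, hx', rfl⟩
  rw [← h3, Submodule.finrank_map_subtype_eq]
  omega

theorem finrank_radical_inf_ker {B : LinearMap.BilinForm ℝ V} (hB : B.IsAlt)
    {Z : Submodule ℝ V} {f : V →ₗ[ℝ] ℝ} (hf : ¬ Z ≤ LinearMap.ker f)
    (hr : radical B Z ≤ LinearMap.ker f) :
    finrank ℝ (radical B (Z ⊓ LinearMap.ker f)) = finrank ℝ (radical B Z) + 1 := by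
  obtain ⟨w, hw, hfw⟩ := exists_represent_of_radical_le_ker hB hr
  obtain ⟨u, hu, hfu⟩ := SetLike.not_le_iff_exists.1 hf
  rw [LinearMap.mem_ker] at hfu
  have hBwu : B w u ≠ 0 := by rwa [← hfw u hu]
  let g : V →ₗ[ℝ] ℝ := B.flip u
  have hg : ¬ radical B (Z ⊓ LinearMap.ker f) ≤ LinearMap.ker g := by
    intro h
    refine hBwu (h ⟨⟨hw, ?_⟩, fun z hz => ?_⟩)
    · exact (hfw w hw).trans (hB w)
    · rw [← hfw z hz.1]; exact hz.2
  suffices radical B (Z ⊓ LinearMap.ker f) ⊓ LinearMap.ker g = radical B Z by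
    rw [← finrank_inf_ker_add_one hg, this]
  ext x
  constructor
  · rintro ⟨⟨hx, h⟩, hxu⟩
    refine ⟨hx.1, fun z hz => ?_⟩
    have h1 := h (z - (f z / f u) • u) ⟨Z.sub_mem hz (Z.smul_mem _ hu), by simp [hfu]⟩
    have h2 : B x u = 0 := hxu
    simpa [h2] using h1
  · intro hx
    exact ⟨⟨⟨hx.1, hr hx⟩, fun z hz => hx.2 z hz.1⟩, hx.2 u hu⟩

theorem radicalDefect_le_radicalDefect_inf_ker {B : LinearMap.BilinForm ℝ V} (hB : B.IsAlt)
    {Z : Submodule ℝ V} {f : V →ₗ[ℝ] ℝ} (hr : radical B Z ≤ LinearMap.ker f) :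
    radicalDefect B Z ≤ radicalDefect B (Z ⊓ LinearMap.ker f) := by
  by_cases hf : Z ≤ LinearMap.ker f
  · rw [inf_eq_left.2 hf]
  · have h1 := finrank_inf_ker_add_one hf
    have h2 := finrank_radical_inf_ker hB hf hr
    unfold radicalDefect
    omega

theorem even_radicalDefect {B : LinearMap.BilinForm ℝ V} (hB : B.IsAlt) (Z : Submodule ℝ V) :
    Even (radicalDefect B Z) := by
  induction hn : finrank ℝ Z generalizing Z with
  | zero =>
    have h := Submodule.finrank_mono (radical_le B Z)
    have : finrank ℝ (radical B Z) = 0 := by omega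
    simp [radicalDefect, hn, this]
  | succ n ih =>
    have hZ : Z ≠ ⊥ := by rintro rfl; simp at hn
    obtain ⟨z, hz, hz0⟩ := Z.ne_bot_iff.1 hZ
    obtain ⟨f, hf⟩ : ∃ f : V →ₗ[ℝ] ℝ, f z ≠ 0 := by
      by_contra! h
      exact hz0 ((forall_dual_apply_eq_zero_iff ℝ z).1 h)
    have hfZ : ¬ Z ≤ LinearMap.ker f := fun h => hf (h hz)
    have h1 := finrank_inf_ker_add_one hfZ
    have h2 := ih (Z ⊓ LinearMap.ker f) (by omega)
    unfold radicalDefect at h2 ⊢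
    by_cases hr : radical B Z ≤ LinearMap.ker f
    · have h3 := finrank_radical_inf_ker hB hfZ hr
      rw [Nat.even_iff] at *
      omega
    · have h3 := finrank_inf_ker_add_one hr
      rw [radical_inf_ker_eq hB hr] at h2
      rw [Nat.even_iff] at *
      omega

theorem exists_comp_comp_eq {W : Type*} [AddCommGroup W] [Module ℝ W] (L : V →ₗ[ℝ] W) :
    ∃ g : W →ₗ[ℝ] V, ∀ x, L (g (L x)) = L x := by
  obtain ⟨s, hs⟩ := L.rangeRestrict.exists_rightInverse_of_surjective L.range_rangeRestrict
  obtain ⟨g, hg⟩ := LinearMap.exists_extend s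
  refine ⟨g, fun x => ?_⟩
  have h1 : g (L x) = s (L.rangeRestrict x) := by rw [← hg]; rfl
  have h2 := LinearMap.congr_fun hs (L.rangeRestrict x)
  rw [h1]
  exact congrArg Subtype.val h2

theorem finite_setOf_finrank_radical_lt (B C : LinearMap.BilinForm ℝ V) (Z : Submodule ℝ V) :
    {t : ℝ | finrank ℝ (radical B Z) < finrank ℝ (radical (B + t • C) Z)}.Finite := by
  let L : LinearMap.BilinForm ℝ V → (Z →ₗ[ℝ] Dual ℝ Z) := fun B => B.domRestrict₁₂ Z Z
  have hL : ∀ B, finrank ℝ (radical B Z) = finrank ℝ (LinearMap.ker (L B)) := by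
    intro B
    have : (LinearMap.ker (L B)).map Z.subtype = radical B Z := by
      ext x
      constructor
      · rintro ⟨x, hx, rfl⟩
        exact ⟨x.2, fun z hz => LinearMap.congr_fun (LinearMap.mem_ker.1 hx) ⟨z, hz⟩⟩
      · rintro ⟨hx, h⟩
        exact ⟨⟨x, hx⟩, LinearMap.ext fun z => h z z.2, rfl⟩
    rw [← this, Submodule.finrank_map_subtype_eq]
  obtain ⟨g, hgL⟩ := exists_comp_comp_eq (L B)
  let A : Z →ₗ[ℝ] Z := g ∘ₗ L C
  refine ((Module.End.finite_hasEigenvalue (f := A)).image (fun μ => -μ⁻¹)).subset ?_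
  intro t ht
  rw [Set.mem_ofPred_eq, hL, hL] at ht
  by_contra hne
  refine ht.not_ge ?_
  have hLt : ∀ x ∈ LinearMap.ker (L (B + t • C)), L B x = -(t • L C x) := by
    intro x hx
    rw [eq_neg_iff_add_eq_zero]
    exact hx
  let f : LinearMap.ker (L (B + t • C)) →ₗ[ℝ] LinearMap.ker (L B) :=
    LinearMap.codRestrict _ ((LinearMap.id - g ∘ₗ L B).domRestrict _) fun x => by
      simp [hgL]
  refine LinearMap.finrank_le_finrank_of_injective (f := f) ?_
  rw [injective_iff_map_eq_zero]
  rintro ⟨x, hx⟩ h0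
  have h1 : x - g (L B x) = 0 := congrArg Subtype.val h0
  rw [hLt x hx, map_neg, map_smul, sub_neg_eq_add] at h1
  by_contra hx0
  have hx0' : x ≠ 0 := fun h => hx0 (Subtype.ext h)
  have ht0 : t ≠ 0 := by
    rintro rfl
    simp [hx0'] at h1
  refine hne ⟨-t⁻¹, ?_, by simp⟩
  refine Module.End.hasEigenvalue_of_hasEigenvector (x := x) ⟨?_, hx0'⟩
  rw [Module.End.mem_eigenspace_iff]
  have h2 : t • A x = -x := by
    rw [eq_neg_iff_add_eq_zero, add_comm]; exact h1
  rw [← smul_right_injective _ ht0 |>.eq_iff]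
  simp [h2, smul_smul, ht0]

theorem finrank_radical_add_smul_wedge_lt {B : LinearMap.BilinForm ℝ V} (hB : B.IsAlt)
    {p q : Dual ℝ V} {Z : Submodule ℝ V} {x z : V} (hx : x ∈ radical B Z) (hz : z ∈ radical B Z)
    (hxz : wedge p q x z ≠ 0) {t : ℝ} (ht : t ≠ 0) :
    finrank ℝ (radical (B + t • wedge p q) Z) < finrank ℝ (radical B Z) := by
  apply Submodule.finrank_lt_finrank_of_lt
  rw [wedge_apply] at hxz
  refine lt_of_le_of_ne ?_ ?_
  · intro u hu
    have h : ∀ r ∈ radical B Z, p u * q r - q u * p r = 0 := by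
      intro r hr
      have h1 := hu.2 r hr.1
      have h2 : B u r = 0 := by rw [← hB.neg_eq, hr.2 u hu.1, neg_zero]
      simpa [h2, ht] using h1
    have h1 := h x hx
    have h2 := h z hz
    have hp : p u = 0 := by
      have : p u * (p x * q z - q x * p z) = 0 := by linear_combination p x * h2 - p z * h1
      simpa [hxz] using this
    have hq : q u = 0 := by
      have : q u * (p x * q z - q x * p z) = 0 := by linear_combination q x * h2 - q z * h1
      simpa [hxz] using this
    refine ⟨hu.1, fun v hv => ?_⟩
    simpa [hp, hq] using hu.2 v hv
  · intro h
    rw [← h] at hx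
    have h1 := hx.2 z hz.1
    rw [h] at hx
    have h2 := hx.2 z hz.1
    simp [h2, ht] at h1
    exact hxz h1

theorem exists_generic {ι I : Type*} [Fintype ι] [Fintype I] (Z : ι → Submodule ℝ V)
    (p q : I → Dual ℝ V) :
    ∃ y : I → ℝ, ∀ j i, ∀ x ∈ radical (∑ i, y i • wedge (p i) (q i)) (Z j),
      ∀ z ∈ radical (∑ i, y i • wedge (p i) (q i)) (Z j), wedge (p i) (q i) x z = 0 := by
  classical
  let B : (I → ℝ) → LinearMap.BilinForm ℝ V := fun y => ∑ i, y i • wedge (p i) (q i)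
  let F : (I → ℝ) → ℕ := fun y => ∑ j, finrank ℝ (radical (B y) (Z j))
  obtain ⟨y, hy⟩ : ∃ y, ∀ y', F y ≤ F y' := by
    obtain ⟨y, hy⟩ := WellFounded.has_min (InvImage.wf F Nat.lt_wfRel.wf) Set.univ ⟨0, trivial⟩
    exact ⟨y, fun y' => not_lt.1 (hy.2 y' trivial)⟩
  refine ⟨y, fun j i x hx z hz => ?_⟩
  by_contra hxz
  have hfin : ((⋃ j', {t : ℝ | finrank ℝ (radical (B y) (Z j')) <
      finrank ℝ (radical (B y + t • wedge (p i) (q i)) (Z j'))}) ∪ {0}).Finite :=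
    (Set.finite_iUnion fun j' => finite_setOf_finrank_radical_lt _ _ _).union
      (Set.finite_singleton 0)
  obtain ⟨t, ht⟩ := hfin.exists_notMem
  simp only [Set.mem_union, Set.mem_iUnion, Set.mem_ofPred_eq, not_or, not_exists, not_lt,
    Set.mem_singleton_iff] at ht
  have hB : B (y + Pi.single i t) = B y + t • wedge (p i) (q i) := by
    simp only [B, Pi.add_apply, add_smul, Finset.sum_add_distrib]
    congr 1
    rw [Finset.sum_eq_single i] <;> simp +contextual
  refine (hy (y + Pi.single i t)).not_gt (Finset.sum_lt_sum (fun j' _ => ?_) ⟨j, by simp, ?_⟩)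
  · rw [hB]; exact ht.1 j'
  · rw [hB]
    exact finrank_radical_add_smul_wedge_lt (isAlt_sum_smul_wedge p q y) hx hz hxz ht.2

theorem exists_finset_two_mul_card_eq_finrank {I : Type*} [Fintype I] (p q : I → Dual ℝ V)
    (y : I → ℝ) (hy : radical (∑ i, y i • wedge (p i) (q i)) ⊤ = ⊥) :
    ∃ J : Finset I, 2 * J.card = finrank ℝ V ∧ ∀ x, (∀ i ∈ J, p i x = 0 ∧ q i x = 0) → x = 0 := by
  classical
  let B : Finset I → (I → ℝ) → LinearMap.BilinForm ℝ V :=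
    fun S y => ∑ i ∈ S, y i • wedge (p i) (q i)
  have halt : ∀ S y, (B S y).IsAlt := by
    intro S y x
    simp [B, LinearMap.sum_apply, mul_comm]
  obtain ⟨S, ⟨y, hy⟩, hmin⟩ := WellFounded.has_min (α := Finset I) wellFounded_lt
    {S | ∃ y, radical (B S y) ⊤ = ⊥} ⟨Finset.univ, y, hy⟩
  have hrep : ∀ f : Dual ℝ V, ∃ w, ∀ z, f z = B S y w z := by
    intro f
    obtain ⟨w, -, hw⟩ := exists_represent_of_radical_le_ker (halt S y) (Z := ⊤) (f := f)
      (by rw [hy]; exact bot_le)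
    exact ⟨w, fun z => hw z trivial⟩
  choose w hw using hrep
  have hinj : ∀ x x', (∀ z, B S y x z = B S y x' z) → x = x' := by
    intro x x' h
    have : x - x' ∈ radical (B S y) ⊤ := ⟨trivial, fun z _ => by simp [h z]⟩
    rw [hy] at this
    exact sub_eq_zero.1 ((Submodule.mem_bot ℝ).1 this)
  have hB : ∀ x z, B S y x z = ∑ i ∈ S, y i * (p i x * q i z - q i x * p i z) := by
    intro x z
    simp [B, LinearMap.sum_apply]
  have hpq : ∀ i, p i (w (q i)) = - q i (w (p i)) := by
    intro i
    rw [hw (p i), hw (q i), (halt S y).neg_eq]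
  have hone : ∀ i ∈ S, y i * p i (w (q i)) = 1 := by
    intro i hi
    have hne : radical (B (S.erase i) y) ⊤ ≠ ⊥ := fun h =>
      hmin _ ⟨y, h⟩ (Finset.erase_ssubset hi)
    obtain ⟨x, hx, hx0⟩ := (Submodule.ne_bot_iff _).1 hne
    have hx1 : ∀ z, B S y x z = y i * (p i x * q i z - q i x * p i z) := by
      intro z
      have h1 := hx.2 z trivial
      have h2 : B S y = y i • wedge (p i) (q i) + B (S.erase i) y :=
        (Finset.add_sum_erase S _ hi).symm
      rw [h2, LinearMap.add_apply, LinearMap.add_apply, h1]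
      simp
    have hx2 : x = y i • (p i x • w (q i) - q i x • w (p i)) := by
      apply hinj
      intro z
      rw [hx1]
      simp [← hw]
    have hp := congrArg (p i) hx2
    have hq := congrArg (q i) hx2
    have h0 : p i (w (p i)) = 0 := by rw [hw (p i)]; exact halt S y _
    have h0' : q i (w (q i)) = 0 := by rw [hw (q i)]; exact halt S y _
    simp only [map_smul, map_sub, smul_eq_mul, h0, h0', mul_zero, sub_zero, zero_sub] at hp hq
    by_cases hpx : p i x = 0
    · by_cases hqx : q i x = 0
      · rw [hpx, hqx] at hx2
        simp at hx2
        exact absurd hx2 hx0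
      · apply mul_left_cancel₀ hqx
        rw [hpq]
        linear_combination -hq
    · apply mul_left_cancel₀ hpx
      linear_combination -hp
  refine ⟨S, ?_, fun x hx => ?_⟩
  · have hid : (LinearMap.id : V →ₗ[ℝ] V) =
        ∑ i ∈ S, y i • ((p i).smulRight (w (q i)) - (q i).smulRight (w (p i))) := by
      ext x
      apply hinj
      intro z
      simp only [LinearMap.id_apply, LinearMap.sum_apply, map_sum, LinearMap.smul_apply,
        LinearMap.sub_apply, LinearMap.smulRight_apply, map_smul, map_sub, ← hw, smul_eq_mul]
      exact hB x z
    have htr := congrArg (LinearMap.trace ℝ V) hid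
    rw [LinearMap.trace_id, map_sum] at htr
    have : ∀ i ∈ S, LinearMap.trace ℝ V
        (y i • ((p i).smulRight (w (q i)) - (q i).smulRight (w (p i)))) = 2 := by
      intro i hi
      rw [map_smul, map_sub, LinearMap.trace_smulRight, LinearMap.trace_smulRight, smul_eq_mul]
      linear_combination 2 * hone i hi - y i * hpq i
    rw [Finset.sum_congr rfl this, Finset.sum_const, nsmul_eq_mul] at htr
    have h3 : ((2 * S.card : ℕ) : ℝ) = (finrank ℝ V : ℕ) := by
      push_cast; linarith
    exact_mod_cast h3
  · apply hinj
    intro z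
    rw [hB, map_zero, LinearMap.zero_apply]
    exact Finset.sum_eq_zero fun i hi => by simp [hx i hi]

end AlternatingForms

theorem SimpleGraph.exists_isCycle_length_eq_of_isCycleOn {V : Type*} (X : SimpleGraph V)
    (f : Equiv.Perm V) {s : Finset V} (hs : f.IsCycleOn s) (hcard : 2 < s.card)
    (hadj : ∀ v, X.Adj v (f v)) :
    ∃ (v : V) (p : X.Walk v v), p.IsCycle ∧ p.length = s.card := by
  obtain ⟨v, hv⟩ := Finset.card_pos.1 (by omega : 0 < s.card)
  rw [← SimpleGraph.cycleGraph_isContained_iff hcard]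
  obtain ⟨m, hm⟩ : ∃ m, s.card = m + 2 := ⟨s.card - 2, by omega⟩
  rw [hm]
  have key : ∀ x y : Fin (m + 2), x = y + 1 → (f ^ (x : ℕ)) v = f ((f ^ (y : ℕ)) v) := by
    rintro x y rfl
    rw [← Equiv.Perm.mul_apply, ← pow_succ', hs.pow_apply_eq_pow_apply hv, hm, Fin.val_add,
      Fin.val_one]
    exact Nat.mod_modEq _ _
  refine ⟨⟨⟨fun i => (f ^ (i : ℕ)) v, ?_⟩, ?_⟩⟩
  · intro x y hxy
    rw [SimpleGraph.cycleGraph_adj] at hxy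
    rcases hxy with h | h
    · rw [key x y (by rw [← h]; abel)]
      exact (hadj _).symm
    · rw [key y x (by rw [← h]; abel)]
      exact hadj _
  · intro x y hxy
    change (f ^ (x : ℕ)) v = (f ^ (y : ℕ)) v at hxy
    rw [hs.pow_apply_eq_pow_apply hv, hm] at hxy
    exact Fin.ext (Nat.ModEq.eq_of_lt_of_lt hxy x.2 y.2)

theorem mul_mem_iff_of_forall_mul_mem {G : Type*} [Group G] {k : G} (hk : k * k * k = 1) {U : Set G}
    (hU : ∀ g ∈ U, g * k ∈ U) (g : G) : g * k ∈ U ↔ g ∈ U :=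
  ⟨fun h => by
    have := hU _ (hU _ h)
    rwa [mul_assoc, mul_assoc, ← mul_assoc k, hk, mul_one] at this, hU g⟩

section Cuts

open scoped Pointwise
open Finset

theorem union_ne_univ_of_two_mul_card_le {α : Type*} [Fintype α] [DecidableEq α]
    {U W : Finset α} (h : 2 * #U ≤ Fintype.card α)
    (hUW : #W = #U) (hne : (W ∩ U).Nonempty) : W ∪ U ≠ univ := by
  intro h1
  have h2 := card_union_add_card_inter W U
  have h3 := hne.card_pos
  rw [h1, card_univ] at h2
  omega

variable {G : Type*} [Group G] [DecidableEq G]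

theorem mem_smul_iff_inv_mul_mem {g x : G} {U : Finset G} : x ∈ g • U ↔ g⁻¹ * x ∈ U :=
  inv_smul_mem_iff.symm

/-- The number of arcs `g` from inside `U` to outside, i.e. of `g ∈ U` with `g * a ∉ U`. -/
def cut (a : G) (U : Finset G) : ℕ := #{g ∈ U | g * a ∉ U}

theorem cut_smul (a g : G) (U : Finset G) : cut a (g • U) = cut a U := by
  refine card_bij' (fun x _ => g⁻¹ * x) (fun x _ => g * x) ?_ ?_ ?_ ?_ <;>
    simp [mem_smul_iff_inv_mul_mem, mul_assoc]

theorem even_cut_add_card {a : G} (ha : a * a = 1) (ha1 : a ≠ 1) (U : Finset G) :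
    Even (cut a U + #U) := by
  have h : Even #{g ∈ U | g * a ∈ U} := by
    rw [← ZMod.natCast_eq_zero_iff_even, card_eq_sum_ones, Nat.cast_sum]
    refine sum_involution (fun g _ => g * a) (fun _ _ => by decide)
      (fun g _ _ => by simpa using ha1)
      ?_ ?_ <;> simp +contextual [mul_assoc, ha]
  have h2 := card_filter_add_card_filter_not (s := U) (fun g => g * a ∈ U)
  rw [← h2, cut, add_comm, add_assoc]
  exact h.add (Even.add_self _)

theorem three_dvd_card {k : G} (hk : k * k * k = 1) (hk1 : k ≠ 1) {U : Finset G}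
    (hU : ∀ g, g * k ∈ U ↔ g ∈ U) : 3 ∣ #U := by
  induction h : #U using Nat.strong_induction_on generalizing U with
  | h m ih =>
  subst h
  obtain rfl | ⟨x, hx⟩ := U.eq_empty_or_nonempty
  · simp
  have hkk : k * k ≠ 1 := fun h => hk1 (by simpa [h] using hk)
  have h3 : x * k * k * k = x := by rw [mul_assoc, mul_assoc, ← mul_assoc k, hk, mul_one]
  set H : Finset G := {x, x * k, x * k * k} with hH
  have hHcard : #H = 3 :=
    card_eq_three.2 ⟨_, _, _, by simpa using hk1, by simpa [mul_assoc] using hkk,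
      by simpa using hk1, rfl⟩
  have hHk : ∀ g, g * k ∈ H ↔ g ∈ H := mul_mem_iff_of_forall_mul_mem hk (U := (H : Set G)) (by
    intro g hg
    simp only [hH, coe_insert, coe_singleton] at hg ⊢
    rcases hg with rfl | rfl | rfl <;> simp [h3])
  have hHU : H ⊆ U := by
    simp [hH, insert_subset_iff, hU, hx]
  have hcard := card_sdiff_add_card_eq_card hHU
  have := ih #(U \ H) (by omega) (U := U \ H) (fun g => by simp only [mem_sdiff, hU, hHk]) rfl
  omega

variable [Fintype G]

theorem cut_eq_sum (a : G) (U : Finset G) :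
    cut a U = ∑ g, if g ∈ U ∧ g * a ∉ U then 1 else 0 := by
  rw [cut, ← filter_univ_mem U, filter_filter, card_filter]
  simp

theorem cut_inter_add_cut_union_le (a : G) (U W : Finset G) :
    cut a (U ∩ W) + cut a (U ∪ W) ≤ cut a U + cut a W := by
  simp only [cut_eq_sum, ← sum_add_distrib]
  refine sum_le_sum fun g _ => ?_
  by_cases h1 : g ∈ U <;> by_cases h2 : g ∈ W <;> by_cases h3 : g * a ∈ U <;>
    by_cases h4 : g * a ∈ W <;> simp [h1, h2, h3, h4]

theorem cut_compl {a : G} (ha : a * a = 1) (U : Finset G) : cut a Uᶜ = cut a U := by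
  refine card_bij' (fun g _ => g * a) (fun g _ => g * a) ?_ ?_ ?_ ?_ <;>
    simp +contextual [mul_assoc, ha]

theorem cut_sdiff_add_cut_sdiff_le {a : G} (ha : a * a = 1) (U W : Finset G) :
    cut a (U \ W) + cut a (W \ U) ≤ cut a U + cut a W := by
  have h1 : U \ W = U ∩ Wᶜ := sdiff_eq_inter_compl U W
  have h2 : U ∪ Wᶜ = (W \ U)ᶜ := by
    ext g
    simp only [mem_union, mem_compl, mem_sdiff]
    tauto
  have h3 := cut_inter_add_cut_union_le a U Wᶜ
  rwa [← h1, h2, cut_compl ha, cut_compl ha] at h3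

theorem eq_univ_of_isBlock {a k : G} (hgen : Subgroup.closure {a, k} = ⊤) {U : Finset G}
    (hU : ∀ g, g * k ∈ U ↔ g ∈ U) (hblock : ∀ g : G, (g • U ∩ U).Nonempty → g • U = U) {g : G}
    (hg : g ∈ U) (hga : g * a ∈ U) : U = univ := by
  have hS : (⊤ : Subgroup G) ≤ MulAction.stabilizer G (g⁻¹ • U) := by
    rw [← hgen, Subgroup.closure_le]
    have key : ∀ x, g * x ∈ U → x ∈ MulAction.stabilizer G (g⁻¹ • U) := by
      intro x hx
      have := hblock (g * x * g⁻¹) ⟨g * x, by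
        rw [mem_inter, mem_smul_iff_inv_mul_mem]
        refine ⟨?_, hx⟩
        simpa [mul_assoc] using hg⟩
      rw [MulAction.mem_stabilizer_iff]
      nth_rw 2 [← this]
      simp [smul_smul, mul_assoc]
    rintro x (rfl | rfl)
    · exact key _ hga
    · exact key _ ((hU g).2 hg)
  ext h
  simp only [mem_univ, iff_true]
  have h1 : (g⁻¹ * h) • (g⁻¹ • U) = g⁻¹ • U := hS (Subgroup.mem_top (g⁻¹ * h))
  have h2 : g⁻¹ * h ∈ g⁻¹ • U := by
    rw [← h1, mem_smul_iff_inv_mul_mem, mem_smul_iff_inv_mul_mem]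
    simpa [mul_assoc] using hg
  rw [mem_smul_iff_inv_mul_mem] at h2
  simpa using h2

theorem cut_eq_card_of_isBlock {a k : G} (hgen : Subgroup.closure {a, k} = ⊤) {U : Finset G}
    (hU : ∀ g, g * k ∈ U ↔ g ∈ U) (hblock : ∀ g : G, (g • U ∩ U).Nonempty → g • U = U)
    (huniv : U ≠ univ) : cut a U = #U := by
  rw [cut, filter_true_of_mem]
  exact fun g hg hga => huniv (eq_univ_of_isBlock hgen hU hblock hg hga)

theorem three_le_cut {a k : G} (ha : a * a = 1) (hk : k * k * k = 1)
    (hk1 : k ≠ 1) (hgen : Subgroup.closure {a, k} = ⊤) {U : Finset G}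
    (hU : ∀ g, g * k ∈ U ↔ g ∈ U) (hne : U.Nonempty) (huniv : U ≠ univ) : 3 ≤ cut a U := by
  obtain ⟨A, hA, hmin⟩ := exists_min_image
    {W : Finset G | (∀ g, g * k ∈ W ↔ g ∈ W) ∧ W.Nonempty ∧ W ≠ univ}
    (fun W => toLex (cut a W, #W)) ⟨U, by simpa using ⟨hU, hne, huniv⟩⟩
  simp only [mem_filter, mem_univ, true_and] at hA hmin
  obtain ⟨hAk, hAne, hAuniv⟩ := hA
  have hmin1 : ∀ W : Finset G, (∀ g, g * k ∈ W ↔ g ∈ W) → W.Nonempty → W ≠ univ →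
      cut a A < cut a W ∨ cut a A = cut a W ∧ #A ≤ #W := fun W h1 h2 h3 => by
    simpa [Prod.Lex.le_iff] using hmin W ⟨h1, h2, h3⟩
  have hUA := hmin1 U hU hne huniv
  have h2A : 2 * #A ≤ Fintype.card G := by
    have := hmin1 Aᶜ (fun g => by simp [hAk]) (by
      rw [nonempty_iff_ne_empty]; simpa using hAuniv) (by
      simpa using hAne.ne_empty)
    rw [cut_compl ha] at this
    have := card_add_card_compl A
    omega
  have hblock : ∀ g : G, (g • A ∩ A).Nonempty → g • A = A := by
    intro g hg
    have hgk : ∀ x, x * k ∈ g • A ↔ x ∈ g • A := fun x => by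
      simp [mem_smul_iff_inv_mul_mem, ← mul_assoc, hAk]
    have h1 := hmin1 (g • A ∩ A) (fun x => by simp only [mem_inter, hgk, hAk]) hg (fun h => by
      rw [inter_eq_univ] at h
      exact hAuniv h.2)
    have h2 := hmin1 (g • A ∪ A) (fun x => by simp only [mem_union, hgk, hAk])
      (hg.mono inter_subset_union)
      (union_ne_univ_of_two_mul_card_le h2A (card_smul_finset _ _) hg)
    have h3 := cut_inter_add_cut_union_le a (g • A) A
    rw [cut_smul] at h3
    have h4 : g • A ∩ A = g • A := eq_of_subset_of_card_le inter_subset_left (by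
      rw [card_smul_finset]; omega)
    exact eq_of_subset_of_card_le (inter_eq_left.1 h4) (card_smul_finset _ _).ge
  have h1 := cut_eq_card_of_isBlock hgen hAk hblock hAuniv
  have h2 := Nat.le_of_dvd hAne.card_pos (three_dvd_card hk hk1 hAk)
  omega

theorem four_le_cut {a k : G} (ha : a * a = 1) (ha1 : a ≠ 1) (hk : k * k * k = 1)
    (hk1 : k ≠ 1) (hgen : Subgroup.closure {a, k} = ⊤) {U : Finset G}
    (hU : ∀ g, g * k ∈ U ↔ g ∈ U) (h6 : 6 ≤ #U) (h6' : #U + 6 ≤ Fintype.card G) :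
    4 ≤ cut a U := by
  by_contra! hcut
  obtain ⟨A, hA, hmin⟩ := exists_min_image
    {W : Finset G | (∀ g, g * k ∈ W ↔ g ∈ W) ∧ 6 ≤ #W ∧ #W + 6 ≤ Fintype.card G ∧ cut a W < 4}
    (fun W => #W) ⟨U, by simpa using ⟨hU, h6, h6', hcut⟩⟩
  simp only [mem_filter, mem_univ, true_and] at hA hmin
  obtain ⟨hAk, hA6, hA6', hAcut⟩ := hA
  have huniv : ∀ W : Finset G, #W < Fintype.card G → W ≠ univ := by
    rintro W hW rfl
    exact hW.ne card_univ
  have h3 : ∀ W : Finset G, (∀ g, g * k ∈ W ↔ g ∈ W) → W.Nonempty → W ≠ univ → 3 ≤ cut a W :=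
    fun W h1 h2 h3 => three_le_cut ha hk hk1 hgen h1 h2 h3
  have hA3 := h3 A hAk (card_pos.1 (by omega)) (huniv _ (by omega))
  have hAeven := even_cut_add_card ha ha1 A
  have h2A : 2 * #A ≤ Fintype.card G := by
    have h1 := card_add_card_compl A
    have := hmin Aᶜ ⟨fun g => by simp [hAk], by omega, by omega, by rwa [cut_compl ha]⟩
    omega
  have hblock : ∀ g : G, (g • A ∩ A).Nonempty → g • A = A := by
    intro g hg
    by_contra hne
    have hgk : ∀ x, x * k ∈ g • A ↔ x ∈ g • A := fun x => by
      simp [mem_smul_iff_inv_mul_mem, ← mul_assoc, hAk]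
    have hcard : #(g • A) = #A := card_smul_finset _ _
    have hlt : #(g • A ∩ A) < #A := by
      refine card_lt_card (ssubset_of_subset_of_ne inter_subset_right fun h => hne ?_)
      exact (eq_of_subset_of_card_le (inter_eq_right.1 h) hcard.le).symm
    have hIk : ∀ x, x * k ∈ g • A ∩ A ↔ x ∈ g • A ∩ A := fun x => by
      simp only [mem_inter, hgk, hAk]
    have h1 := h3 _ hIk hg (huniv _ (by omega))
    have h2 := h3 (g • A ∪ A) (fun x => by simp only [mem_union, hgk, hAk])
      (hg.mono inter_subset_union)
      (union_ne_univ_of_two_mul_card_le h2A hcard hg)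
    have h4 := cut_inter_add_cut_union_le a (g • A) A
    rw [cut_smul] at h4
    have h5 : #(g • A ∩ A) = 3 := by
      have hdvd := three_dvd_card hk hk1 hIk
      have hpos := hg.card_pos
      by_contra h
      have := hmin _ ⟨hIk, by omega, by omega, by omega⟩
      omega
    have h6 := card_sdiff_add_card_inter A (g • A)
    have h7 := card_sdiff_add_card_inter (g • A) A
    rw [inter_comm] at h6
    have hDk : ∀ x, x * k ∈ A \ g • A ↔ x ∈ A \ g • A := fun x => by
      simp only [mem_sdiff, hgk, hAk]
    have h8 := h3 _ hDk (card_pos.1 (by omega)) (huniv _ (by omega))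
    have h9 := h3 (g • A \ A) (fun x => by simp only [mem_sdiff, hgk, hAk])
      (card_pos.1 (by omega)) (huniv _ (by omega))
    have h10 := cut_sdiff_add_cut_sdiff_le ha A (g • A)
    rw [cut_smul] at h10
    have h11 : cut a A = 3 := by omega
    rw [h11] at hAeven
    have h12 : #A ≠ 6 := by
      intro h
      rw [h] at hAeven
      exact absurd hAeven (by decide)
    have hdvd := three_dvd_card hk hk1 hAk
    have := hmin _ ⟨hDk, by omega, by omega, by omega⟩
    omega
  have := cut_eq_card_of_isBlock hgen hAk hblock (huniv _ (by omega))
  omega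

end Cuts

section Cycles

open Equiv Equiv.Perm

variable {α : Type*} [Finite α]

theorem Equiv.Perm.SameCycle.eq_of_forall_apply_eq {β : Type*} {f : Perm α} {ψ : α → β}
    (h : ∀ u, ψ (f u) = ψ u) {u v : α} (huv : f.SameCycle u v) : ψ u = ψ v := by
  obtain ⟨i, -, rfl⟩ := huv.exists_pow_eq'
  have : ∀ i : ℕ, ψ ((f ^ i) u) = ψ u := by
    intro i
    induction i with
    | zero => rfl
    | succ i ih => rw [pow_succ', mul_apply, h, ih]
  exact (this i).symm

theorem sameCycle_swap_mul [DecidableEq α] {f : Perm α} {x y : α} (hxy : ¬ f.SameCycle x y) :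
    (swap x y * f).SameCycle x y := by
  by_contra hcon
  have key : ∀ i : ℕ, ((swap x y * f) ^ i) x = (f ^ i) x ∧ (0 < i → (f ^ i) x ≠ x) := by
    intro i
    induction i with
    | zero => simp
    | succ i ih =>
      have hi : ((swap x y * f) ^ (i + 1)) x = swap x y ((f ^ (i + 1)) x) := by
        rw [pow_succ', mul_apply, ih.1, mul_apply, pow_succ', mul_apply]
      have h1 : (f ^ (i + 1)) x ≠ x := by
        intro h
        rw [h, swap_apply_left] at hi
        exact hcon ⟨(i + 1 : ℕ), by rw [zpow_natCast, hi]⟩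
      have h2 : (f ^ (i + 1)) x ≠ y := fun h =>
        hxy ⟨(i + 1 : ℕ), by rw [zpow_natCast, h]⟩
      rw [swap_apply_of_ne_of_ne h1 h2] at hi
      exact ⟨hi, fun _ => h1⟩
  exact (key (orderOf f)).2 (orderOf_pos f) (by rw [pow_orderOf_eq_one, one_apply])

theorem sameCycle_swap_mul_of_sameCycle [DecidableEq α] {f : Perm α} {x y u v : α}
    (hxy : ¬ f.SameCycle x y) (huv : f.SameCycle u v) : (swap x y * f).SameCycle u v := by
  have hxy' := sameCycle_swap_mul hxy
  have key : ∀ u, (swap x y * f).SameCycle u (f u) := by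
    intro u
    have h : (swap x y * f).SameCycle u ((swap x y * f) u) :=
      sameCycle_apply_right.2 (SameCycle.refl _ _)
    rw [mul_apply] at h
    by_cases h1 : f u = x
    · rw [h1, swap_apply_left] at h
      rw [h1]
      exact h.trans hxy'.symm
    by_cases h2 : f u = y
    · rw [h2, swap_apply_right] at h
      rw [h2]
      exact h.trans hxy'
    rwa [swap_apply_of_ne_of_ne h1 h2] at h
  have := huv.eq_of_forall_apply_eq
    (ψ := fun u => (Quotient.mk (SameCycle.setoid (swap x y * f)) u))
    (fun u => Quotient.sound (key u).symm)
  exact Quotient.exact this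

/-- The number of cycles of a permutation, fixed points included. -/
noncomputable def numCycles (f : Perm α) : ℕ := Nat.card (Quotient (SameCycle.setoid f))

theorem numCycles_swap_mul_lt [DecidableEq α] {f : Perm α} {x y : α}
    (hxy : ¬ f.SameCycle x y) : numCycles (swap x y * f) < numCycles f := by
  have := Fintype.ofFinite (Quotient (SameCycle.setoid f))
  have := Fintype.ofFinite (Quotient (SameCycle.setoid (swap x y * f)))
  rw [numCycles, numCycles, Nat.card_eq_fintype_card, Nat.card_eq_fintype_card]
  refine Fintype.card_lt_of_surjective_not_injective
    (Quotient.map' id fun u v huv => sameCycle_swap_mul_of_sameCycle hxy huv) ?_ ?_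
  · intro q
    induction q using Quotient.inductionOn with
    | h u => exact ⟨Quotient.mk _ u, rfl⟩
  · intro hinj
    refine hxy (Quotient.exact (s := SameCycle.setoid f) (hinj ?_))
    exact Quotient.sound (s := SameCycle.setoid (swap x y * f)) (sameCycle_swap_mul hxy)

theorem not_sameCycle_swap_mul [DecidableEq α] {f : Perm α} {x y z : α}
    (hxy : ¬ f.SameCycle x y) (hxz : ¬ f.SameCycle x z) :
    ¬ (swap y z * f).SameCycle x y := by
  classical
  intro h
  let c : α → Quotient (SameCycle.setoid f) := Quotient.mk _
  have hc : ∀ u v, c u = c v ↔ f.SameCycle u v := fun u v => Quotient.eq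
  have hcf : ∀ u, c (f u) = c u := fun u => (hc _ _).2 (sameCycle_apply_left.2 (SameCycle.refl _ _))
  have := h.eq_of_forall_apply_eq (ψ := fun u => if c u = c z then c y else c u) (by
    intro u
    rw [mul_apply]
    by_cases h1 : f u = y
    · rw [h1, swap_apply_left, ← hcf u, h1]
      simp
    by_cases h2 : f u = z
    · rw [h2, swap_apply_right, ← hcf u, h2]
      simp
    rw [swap_apply_of_ne_of_ne h1 h2, hcf])
  rw [if_neg (fun e => hxz ((hc _ _).1 e)), ite_self] at this
  exact hxy ((hc _ _).1 this)

theorem numCycles_swap_mul_swap_mul_add_two_le [DecidableEq α] {f : Perm α} {x y z : α}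
    (hxy : ¬ f.SameCycle x y) (hxz : ¬ f.SameCycle x z) (hyz : ¬ f.SameCycle y z) :
    numCycles (swap x y * (swap y z * f)) + 2 ≤ numCycles f := by
  have h1 := numCycles_swap_mul_lt hyz
  have h2 := numCycles_swap_mul_lt (not_sameCycle_swap_mul hxy hxz)
  omega

theorem two_mul_numCycles_le {f : Perm α} (hf : ∀ u, f u ≠ u) : 2 * numCycles f ≤ Nat.card α := by
  have hq : ∀ q : Quotient (SameCycle.setoid f), Quotient.mk _ (f q.out) = q := fun q =>
    (Quotient.sound (s := SameCycle.setoid f)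
      (sameCycle_apply_left.2 (SameCycle.refl _ _))).trans q.out_eq
  have := Nat.card_le_card_of_injective
    (fun q : Bool × Quotient (SameCycle.setoid f) => if q.1 then f q.2.out else q.2.out) (by
      rintro ⟨i, q⟩ ⟨j, r⟩ h
      have hqr : q = r := by
        have := congrArg (Quotient.mk (SameCycle.setoid f)) h
        cases i <;> cases j <;> simpa [hq] using this
      subst hqr
      cases i <;> cases j <;> simp_all [(hf _).symm])
  rwa [Nat.card_prod, Nat.card_eq_fintype_card (α := Bool), Fintype.card_bool] at this

end Cycles

section Flows

variable {G : Type*} [Group G]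

/-- The real functions `z` on `G` with `z (g * a) = -z g`. -/
def antisymmFun (a : G) : Submodule ℝ (G → ℝ) where
  carrier := {z | ∀ g, z (g * a) = -z g}
  add_mem' hz hw g := by simp only [Pi.add_apply, hz g, hw g]; ring
  zero_mem' g := by simp
  smul_mem' r z hz g := by simp only [Pi.smul_apply, hz g, smul_eq_mul]; ring

/-- The real functions `z` on `G` with `z g + z (g * k) + z (g * k * k) = 0`. -/
def conservedFun (k : G) : Submodule ℝ (G → ℝ) where
  carrier := {z | ∀ g, z g + z (g * k) + z (g * k * k) = 0}
  add_mem' hz hw g := by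
    simp only [Pi.add_apply]
    linear_combination hz g + hw g
  zero_mem' g := by simp
  smul_mem' r z hz g := by
    simp only [Pi.smul_apply, smul_eq_mul]
    linear_combination r * hz g

/-- The real functions on `G` vanishing on `D`. -/
def vanishingFun (D : Set G) : Submodule ℝ (G → ℝ) where
  carrier := {z | ∀ g ∈ D, z g = 0}
  add_mem' hz hw g hg := by simp [hz g hg, hw g hg]
  zero_mem' g _ := rfl
  smul_mem' r z hz g hg := by simp [hz g hg]

/-- The flows on the graph of left cosets of `⟨k⟩`, where the arc `g` joins the coset of `g` to the
coset of `g * a`, which vanish on `D`. -/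
def flows (a k : G) (D : Set G) : Submodule ℝ (G → ℝ) :=
  antisymmFun a ⊓ conservedFun k ⊓ vanishingFun D

theorem mem_flows {a k : G} {D : Set G} {z : G → ℝ} : z ∈ flows a k D ↔
    (∀ g, z (g * a) = -z g) ∧ (∀ g, z g + z (g * k) + z (g * k * k) = 0) ∧ ∀ g ∈ D, z g = 0 := by
  rw [← and_assoc, flows, Submodule.mem_inf, Submodule.mem_inf]
  rfl

open Equiv Equiv.Perm

theorem single_sub_single_mul_mem_conservedFun [DecidableEq G] {k : G} (hk : k * k * k = 1)
    (x : G) : (Pi.single x 1 - Pi.single (x * k) 1 : G → ℝ) ∈ conservedFun k := by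
  intro g
  have h3 : x * k * k * k = x := by rw [mul_assoc, mul_assoc, ← mul_assoc k, hk, mul_one]
  have h1 : g = x * k ↔ g * k * k = x := by
    rw [← mul_left_inj k, ← mul_left_inj k, ← h3, mul_left_inj, mul_left_inj, mul_left_inj,
      mul_left_inj, h3]
  simp only [Pi.sub_apply, Pi.single_apply, mul_left_inj, h1]
  ring

theorem not_sameCycle_of_flows_eq_bot [Finite G] [DecidableEq G] {a k : G} (ha : a * a = 1)
    (hk : k * k * k = 1) {T U : Set G} (hT : ∀ g, g * k ∈ T ↔ g ∈ T) (hTU : T ⊆ U)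
    (hfree : flows a k Uᶜ = ⊥) {f : Perm G}
    (hf : ∀ g, (g * a ∈ T → f g = g * a * k) ∧ (g * a ∉ T → f g = g * a))
    {x y : G} (hx : x ∈ U) (hy : y ∈ U) (hxT : x ∉ T) (hxy : x ≠ y)
    (hxyk : (Pi.single x 1 - Pi.single y 1 : G → ℝ) ∈ conservedFun k) : ¬ f.SameCycle x y := by
  intro hcon
  set W : Submodule ℝ (G → ℝ) := antisymmFun a ⊔ (conservedFun k ⊓ vanishingFun Tᶜ) with hW
  have haW : ∀ g, (Pi.single g 1 - Pi.single (g * a) 1 : G → ℝ) ∈ W := fun g => by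
    refine Submodule.mem_sup_left fun u => ?_
    have h1 : u * a = g ↔ u = g * a := by
      rw [← mul_left_inj a, mul_assoc, ha, mul_one]
    simp only [Pi.sub_apply, Pi.single_apply, mul_left_inj, h1]
    ring
  have hkW : ∀ g ∈ T, (Pi.single g 1 - Pi.single (g * k) 1 : G → ℝ) ∈ W := fun g hg => by
    refine Submodule.mem_sup_right ⟨single_sub_single_mul_mem_conservedFun hk g, fun u hu => ?_⟩
    have h1 : u ≠ g := by
      rintro rfl
      exact hu hg
    have h2 : u ≠ g * k := by
      rintro rfl
      exact hu ((hT g).2 hg)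
    simp [h1, h2]
  have hstep : ∀ g, W.mkQ (Pi.single (f g) 1) = W.mkQ (Pi.single g 1) := fun g => by
    have h1 : W.mkQ (Pi.single (g * a) 1) = W.mkQ (Pi.single g 1) :=
      ((Submodule.Quotient.eq W).2 (haW g)).symm
    by_cases hg : g * a ∈ T
    · rw [(hf g).1 hg, ← h1]
      exact ((Submodule.Quotient.eq W).2 (hkW _ hg)).symm
    · rw [(hf g).2 hg, h1]
  have hmem := (Submodule.Quotient.eq W).1
    (hcon.eq_of_forall_apply_eq (ψ := fun g => W.mkQ (Pi.single g (1 : ℝ))) hstep)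
  obtain ⟨w, hw, c, ⟨hck, hcT⟩, hwc⟩ := Submodule.mem_sup.1 hmem
  have hwU : w ∈ flows a k Uᶜ := by
    obtain rfl : w = Pi.single x 1 - Pi.single y 1 - c := eq_sub_of_add_eq hwc
    refine ⟨⟨hw, Submodule.sub_mem _ hxyk hck⟩, fun u hu => ?_⟩
    have h1 : u ≠ x := by
      rintro rfl
      exact hu hx
    have h2 : u ≠ y := by
      rintro rfl
      exact hu hy
    simp [h1, h2, hcT u fun h => hu (hTU h)]
  rw [hfree, Submodule.mem_bot] at hwU
  have := congrFun hwc x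
  simp [hwU, hcT x hxT, hxy] at this

theorem exists_perm_numCycles_le [Finite G] {a k : G} (ha : a * a = 1) (ha1 : a ≠ 1)
    (hk : k * k * k = 1) (hk1 : k ≠ 1) (T : Set G) (hT : ∀ g, g * k ∈ T ↔ g ∈ T)
    (hfree : flows a k Tᶜ = ⊥) :
    ∃ f : Perm G, (∀ g, (g * a ∈ T → f g = g * a * k) ∧ (g * a ∉ T → f g = g * a)) ∧
      6 * numCycles f + 4 * T.ncard ≤ 3 * Nat.card G := by
  classical
  induction h : T.ncard using Nat.strong_induction_on generalizing T with
  | h m ih =>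
  subst h
  obtain rfl | ⟨x, hx⟩ := T.eq_empty_or_nonempty
  · refine ⟨Equiv.mulRight a, by simp, ?_⟩
    have := two_mul_numCycles_le (f := Equiv.mulRight a) (by simpa using ha1)
    simp
    omega
  have hkk : k * k ≠ 1 := fun h => hk1 (by simpa [h] using hk)
  have hxk : x ≠ x * k := by simpa using hk1
  have hxkk : x ≠ x * k * k := by simpa [mul_assoc] using hkk
  have hxkk' : x * k ≠ x * k * k := by simpa using hk1
  have h3 : ∀ g, g * k * k * k = g := fun g => by
    rw [mul_assoc, mul_assoc, ← mul_assoc k, hk, mul_one]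
  set H : Set G := {x, x * k, x * k * k} with hH
  have hHk : ∀ g, g * k ∈ H ↔ g ∈ H := mul_mem_iff_of_forall_mul_mem hk (by
    rintro g (rfl | rfl | rfl) <;> simp [hH, h3])
  have hHT : H ⊆ T := by
    rintro g (rfl | rfl | rfl) <;> simp [hT, hx]
  have hHcard : H.ncard = 3 := by
    rw [Set.ncard_eq_three]
    exact ⟨_, _, _, hxk, hxkk, hxkk', rfl⟩
  have hcard : (T \ H).ncard + 3 = T.ncard := by
    rw [← hHcard]
    exact Set.ncard_sdiff_add_ncard_of_subset hHT
  have hT' : ∀ g, g * k ∈ T \ H ↔ g ∈ T \ H := fun g => by simp only [Set.mem_sdiff, hT, hHk]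
  have hfree' : flows a k (T \ H)ᶜ = ⊥ := by
    rw [eq_bot_iff, ← hfree]
    intro z hz
    rw [mem_flows] at hz ⊢
    exact ⟨hz.1, hz.2.1, fun g hg => hz.2.2 g fun h => hg h.1⟩
  obtain ⟨f, hf, hcyc⟩ := ih _ (by omega) (T \ H) hT' hfree' rfl
  have hmain : ∀ u ∈ H, ∀ v ∈ H, u ≠ v → ¬ f.SameCycle u v := by
    intro u hu v hv huv
    refine not_sameCycle_of_flows_eq_bot ha hk hT' Set.sdiff_subset hfree hf (hHT hu) (hHT hv)
      (fun h => h.2 hu) huv ?_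
    have hxH : ∀ u ∈ H, (Pi.single x 1 - Pi.single u 1 : G → ℝ) ∈ conservedFun k := by
      have h1 := single_sub_single_mul_mem_conservedFun hk x
      rintro u (rfl | rfl | rfl)
      · rw [sub_self]
        exact Submodule.zero_mem _
      · exact h1
      · simpa using Submodule.add_mem _ h1 (single_sub_single_mul_mem_conservedFun hk (x * k))
    simpa using Submodule.sub_mem _ (hxH v hv) (hxH u hu)
  have hx1 : x ∈ H := by simp [hH]
  have hx2 : x * k ∈ H := by simp [hH]
  have hx3 : x * k * k ∈ H := by simp [hH]
  refine ⟨swap x (x * k) * (swap (x * k) (x * k * k) * f), fun g => ?_, ?_⟩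
  · have hfg := hf g
    simp only [mul_apply]
    by_cases hg : g * a ∈ H
    · rw [hfg.2 fun h => h.2 hg]
      refine ⟨fun _ => ?_, fun h => absurd (hHT hg) h⟩
      rcases hg with h | h | h <;> rw [h]
      · rw [swap_apply_of_ne_of_ne hxk hxkk, swap_apply_left]
      · rw [swap_apply_left, swap_apply_of_ne_of_ne hxkk.symm hxkk'.symm]
      · rw [swap_apply_right, swap_apply_right, h3]
    · have hne : ∀ w, w ∉ H → swap x (x * k) (swap (x * k) (x * k * k) w) = w := by
        intro w hw
        have h1 : w ≠ x := fun h => hw (h ▸ hx1)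
        have h2 : w ≠ x * k := fun h => hw (h ▸ hx2)
        have h3 : w ≠ x * k * k := fun h => hw (h ▸ hx3)
        rw [swap_apply_of_ne_of_ne h2 h3, swap_apply_of_ne_of_ne h1 h2]
      refine ⟨fun h => ?_, fun h => ?_⟩
      · rw [hfg.1 ⟨h, hg⟩, hne _ (by rwa [hHk])]
      · rw [hfg.2 fun h' => h h'.1, hne _ hg]
  · have := numCycles_swap_mul_swap_mul_add_two_le (hmain _ hx1 _ hx2 hxk)
      (hmain _ hx1 _ hx3 hxkk) (hmain _ hx2 _ hx3 hxkk')
    omega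

theorem exists_perm_isCycleOn [Fintype G] [DecidableEq G] {a k : G} (ha : a * a = 1) (ha1 : a ≠ 1)
    (hk : k * k * k = 1) (hk1 : k ≠ 1) (T : Set G) (hT : ∀ g, g * k ∈ T ↔ g ∈ T)
    (hfree : flows a k Tᶜ = ⊥) (h1 : 1 ∉ T) (haT : a ∉ T)
    (hcard : 3 * Fintype.card G ≤ 4 * T.ncard + 12) :
    ∃ f : Perm G, (∀ g, f g = g * a ∨ f g = g * a * k) ∧ f.IsCycleOn ({1, a}ᶜ : Finset G) := by
  obtain ⟨f, hf, hcyc⟩ := exists_perm_numCycles_le ha ha1 hk hk1 T hT hfree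
  rw [Nat.card_eq_fintype_card] at hcyc
  have hf1 : f 1 = a := by simpa using (hf 1).2 (by simpa using haT)
  have hfa : f a = 1 := by simpa [ha] using (hf a).2 (by simpa [ha] using h1)
  refine ⟨f, fun g => ?_, ?_⟩
  · by_cases h : g * a ∈ T
    · exact Or.inr ((hf g).1 h)
    · exact Or.inl ((hf g).2 h)
  have hmem : ∀ g, g ∈ ({1, a}ᶜ : Finset G) ↔ ¬ f.SameCycle 1 g := by
    intro g
    simp only [Finset.mem_compl, Finset.mem_insert, Finset.mem_singleton, not_iff_not]
    refine ⟨?_, fun h => ?_⟩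
    · rintro (rfl | rfl)
      · exact SameCycle.refl _ _
      · exact ⟨1, by simpa using hf1⟩
    · have := h.eq_of_forall_apply_eq (ψ := fun u => (u = 1 ∨ u = a : Prop)) (fun u => by
        rw [← hf1, f.injective.eq_iff, hf1, ← hfa, f.injective.eq_iff, hfa, or_comm])
      simpa using this
  refine ⟨⟨fun x hx => ?_, f.injective.injOn, fun x hx => ⟨f⁻¹ x, ?_, by simp⟩⟩, ?_⟩
  · rw [Finset.mem_coe, hmem] at hx ⊢
    rwa [sameCycle_apply_right]
  · rw [Finset.mem_coe, hmem] at hx ⊢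
    rwa [← sameCycle_apply_right, ← mul_apply, mul_inv_cancel, one_apply]
  intro x hx y hy
  rw [Finset.mem_coe, hmem] at hx hy
  by_contra hxy
  have := Fintype.ofFinite (Quotient (SameCycle.setoid f))
  have hle : 2 < Fintype.card (Quotient (SameCycle.setoid f)) := by
    refine Fintype.two_lt_card_iff.2
      ⟨Quotient.mk _ 1, Quotient.mk _ x, Quotient.mk _ y, ?_, ?_, ?_⟩ <;>
    rw [Ne, Quotient.eq] <;> assumption
  rw [numCycles, Nat.card_eq_fintype_card] at hcyc
  omega

end Flows

theorem LinearMap.BilinForm.finrank_inf_orthogonal_add_finrank {K V : Type*} [Field K]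
    [AddCommGroup V] [Module K V] [FiniteDimensional K V] {B : LinearMap.BilinForm K V}
    (hB : B.Nondegenerate) (hrefl : B.IsRefl) (U W : Submodule K V) :
    finrank K ↥(U ⊓ B.orthogonal W) + finrank K W =
      finrank K U + finrank K ↥(B.orthogonal U ⊓ W) := by
  have h : U ⊓ B.orthogonal W = B.orthogonal (B.orthogonal U ⊔ W) := by
    refine le_antisymm (fun x hx => ?_) (le_inf ?_ (B.orthogonal_le le_sup_right))
    · rw [LinearMap.BilinForm.mem_orthogonal_iff]
      intro n hn
      obtain ⟨u, hu, w, hw, rfl⟩ := Submodule.mem_sup.1 hn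
      have h1 : B u x = 0 := hrefl _ _ (hu x hx.1)
      have h2 : B w x = 0 := hx.2 w hw
      rw [map_add, LinearMap.add_apply, h1, h2, add_zero]
    · exact (B.orthogonal_le le_sup_left).trans
        (LinearMap.BilinForm.orthogonal_orthogonal hB hrefl U).le
  have h1 := LinearMap.BilinForm.finrank_orthogonal hB (B.orthogonal U ⊔ W)
  have h2 := LinearMap.BilinForm.finrank_orthogonal hB U
  have h3 := Submodule.finrank_sup_add_finrank_inf_eq (B.orthogonal U) W
  have h4 := Submodule.finrank_le (B.orthogonal U ⊔ W)
  have h5 := Submodule.finrank_le U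
  rw [h]
  omega

theorem LinearMap.IsProj.finrank_eq_sum {ι : Type*} [Fintype ι] [DecidableEq ι]
    {U : Submodule ℝ (ι → ℝ)} {f : (ι → ℝ) →ₗ[ℝ] ι → ℝ} (hf : LinearMap.IsProj U f) :
    (finrank ℝ U : ℝ) = ∑ i, f (Pi.single i 1) i := by
  rw [← hf.trace, LinearMap.trace_eq_matrix_trace ℝ (Pi.basisFun ℝ ι)]
  simp [Matrix.trace]

section FlowDimension

variable {G : Type*} [Group G]

theorem sum_mul_right_eq [Fintype G] (f : G → ℝ) (x : G) : ∑ g, f (g * x) = ∑ g, f g :=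
  Fintype.sum_equiv (Equiv.mulRight x) _ _ fun _ => rfl

/-- The real functions on `G` which are constant on the left cosets of `⟨k⟩`. -/
def invariantFun (k : G) : Submodule ℝ (G → ℝ) where
  carrier := {z | ∀ g, z (g * k) = z g}
  add_mem' hz hw g := by simp only [Pi.add_apply, hz g, hw g]
  zero_mem' g := by simp
  smul_mem' r z hz g := by simp only [Pi.smul_apply, hz g]

/-- The functions constant on left cosets of `⟨k⟩` and along the arcs outside `D`. -/
def potentials (a k : G) (D : Set G) : Submodule ℝ (G → ℝ) where
  carrier := {z | (∀ g, z (g * k) = z g) ∧ ∀ g ∉ D, z (g * a) = z g}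
  add_mem' hz hw := ⟨fun g => by simp only [Pi.add_apply, hz.1 g, hw.1 g],
    fun g hg => by simp only [Pi.add_apply, hz.2 g hg, hw.2 g hg]⟩
  zero_mem' := ⟨fun g => rfl, fun g _ => rfl⟩
  smul_mem' r z hz := ⟨fun g => by simp only [Pi.smul_apply, hz.1 g],
    fun g hg => by simp only [Pi.smul_apply, hz.2 g hg]⟩

theorem mem_potentials {a k : G} {D : Set G} {z : G → ℝ} : z ∈ potentials a k D ↔
    (∀ g, z (g * k) = z g) ∧ ∀ g ∉ D, z (g * a) = z g := Iff.rfl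

variable [Fintype G]

theorem three_mul_finrank_invariantFun {k : G} (hk : k * k * k = 1) (hk1 : k ≠ 1) :
    3 * finrank ℝ (invariantFun k) = Fintype.card G := by
  classical
  have hkk : k * k ≠ 1 := fun h => hk1 (by simpa [h] using hk)
  have h3 : ∀ g, g * k * k * k = g := fun g => by
    rw [mul_assoc, mul_assoc, ← mul_assoc k, hk, mul_one]
  let f : (G → ℝ) →ₗ[ℝ] G → ℝ :=
    { toFun := fun z g => (z g + z (g * k) + z (g * k * k)) / 3
      map_add' := fun z w => by ext g; simp; ring
      map_smul' := fun r z => by ext g; simp; ring }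
  have hf : LinearMap.IsProj (invariantFun k) f := by
    refine ⟨fun z g => ?_, fun z hz => funext fun g => ?_⟩
    · simp only [f, LinearMap.coe_mk, AddHom.coe_mk, h3]
      ring
    · simp only [f, LinearMap.coe_mk, AddHom.coe_mk, hz (g * k), hz g]
      ring
  have h := hf.finrank_eq_sum
  simp [f, hk1, hkk, mul_assoc] at h
  have h' : (3 : ℝ) * finrank ℝ (invariantFun k) = Fintype.card G := by
    rw [h]
    ring
  exact_mod_cast h'

theorem two_mul_finrank_antisymmFun {a : G} (ha : a * a = 1) (ha1 : a ≠ 1) (D : Set G)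
    (hD : ∀ g, g * a ∈ D ↔ g ∈ D) :
    2 * finrank ℝ ↥(antisymmFun a ⊓ vanishingFun D) = Dᶜ.ncard := by
  classical
  have haa : ∀ g, g * a * a = g := fun g => by rw [mul_assoc, ha, mul_one]
  let f : (G → ℝ) →ₗ[ℝ] G → ℝ :=
    { toFun := fun z g => if g ∈ D then 0 else (z g - z (g * a)) / 2
      map_add' := fun z w => by ext g; by_cases h : g ∈ D <;> simp [h]; ring
      map_smul' := fun r z => by ext g; by_cases h : g ∈ D <;> simp [h]; ring }
  have hf : LinearMap.IsProj (antisymmFun a ⊓ vanishingFun D) f := by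
    refine ⟨fun z => ⟨fun g => ?_, fun g hg => ?_⟩, fun z hz => funext fun g => ?_⟩
    · by_cases h : g ∈ D <;> simp [f, hD, h, haa]
      ring
    · simp [f, hg]
    · by_cases h : g ∈ D
      · simp [f, h, hz.2 g h]
      · simp only [f, LinearMap.coe_mk, AddHom.coe_mk, h, hz.1 g, if_false]
        ring
  have h := hf.finrank_eq_sum
  simp [f, ha1] at h
  have h' : (2 : ℝ) * finrank ℝ ↥(antisymmFun a ⊓ vanishingFun D) = Dᶜ.ncard := by
    rw [h, Set.ncard_eq_toFinset_card']
    have h7 : Dᶜ.toFinset = Finset.univ.filter (· ∉ D) := by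
      ext
      simp
    rw [h7, Finset.card_filter, Nat.cast_sum, Finset.mul_sum]
    refine Finset.sum_congr rfl fun g _ => ?_
    by_cases hg : g ∈ D <;> simp [hg]
  exact_mod_cast h'

theorem finrank_flows_add {a k : G} (ha : a * a = 1) (ha1 : a ≠ 1) (hk : k * k * k = 1)
    (hk1 : k ≠ 1) (D : Set G) (hD : ∀ g, g * a ∈ D ↔ g ∈ D) :
    6 * finrank ℝ (flows a k D) + 2 * Fintype.card G =
      3 * Dᶜ.ncard + 6 * finrank ℝ (potentials a k D) := by
  classical
  have h3 : ∀ g, g * k * k * k = g := fun g => by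
    rw [mul_assoc, mul_assoc, ← mul_assoc k, hk, mul_one]
  let B : LinearMap.BilinForm ℝ (G → ℝ) := dotProductBilin ℝ ℝ
  have hBapply : ∀ z w, B z w = ∑ g, z g * w g := fun z w => rfl
  have hsymm : ∀ z w, B z w = B w z := fun z w => by simp only [hBapply, mul_comm]
  have hrefl : B.IsRefl := fun z w h => by rw [hsymm, h]
  have hB : B.Nondegenerate := by
    constructor
    · intro z hz
      exact dotProduct_eq_zero z hz
    · intro z hz
      exact dotProduct_eq_zero z fun w => by rw [dotProduct_comm]; exact hz w
  have h1 : flows a k D =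
      (antisymmFun a ⊓ vanishingFun D) ⊓ B.orthogonal (invariantFun k) := by
    have : B.orthogonal (invariantFun k) = conservedFun k := by
      ext z
      rw [LinearMap.BilinForm.mem_orthogonal_iff]
      constructor
      · intro h g
        have := h (Pi.single g 1 + Pi.single (g * k) 1 + Pi.single (g * k * k) 1) (fun x => by
          have h1 : x * k = g ↔ x = g * k * k := by
            rw [← mul_left_inj k, ← mul_left_inj k, h3]
          simp only [Pi.add_apply, Pi.single_apply, mul_left_inj, h1]
          ring)
        simpa [hBapply, add_mul, Finset.sum_add_distrib, Pi.single_apply] using this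
      · intro h w hw
        have h4 : ∑ g, w g * z (g * k) = ∑ g, w g * z g := by
          rw [← sum_mul_right_eq (fun g => w g * z g) k]
          simp only [hw _]
        have h5 : ∑ g, w g * z (g * k * k) = ∑ g, w g * z g := by
          rw [← h4, ← sum_mul_right_eq (fun g => w g * z (g * k)) k]
          simp only [hw _]
        have h6 : ∑ g, w g * (z g + z (g * k) + z (g * k * k)) = 0 :=
          Finset.sum_eq_zero fun g _ => by rw [h g, mul_zero]
        simp only [mul_add, Finset.sum_add_distrib, h4, h5] at h6
        rw [hBapply]
        linarith
    rw [this, flows, inf_right_comm]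
  have h2 : potentials a k D = B.orthogonal (antisymmFun a ⊓ vanishingFun D) ⊓ invariantFun k := by
    ext z
    rw [mem_potentials, and_comm, Submodule.mem_inf]
    refine and_congr_left fun _ => ?_
    rw [LinearMap.BilinForm.mem_orthogonal_iff]
    constructor
    · rintro h w ⟨hw, hwD⟩
      have h4 : ∀ g, w (g * a) * z (g * a) = -(w g * z g) := fun g => by
        by_cases hg : g ∈ D
        · rw [hwD g hg, hwD _ ((hD g).2 hg)]; simp
        · rw [h g hg, hw g]; ring
      have h5 := sum_mul_right_eq (fun g => w g * z g) a
      simp only [h4, Finset.sum_neg_distrib] at h5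
      change B w z = 0
      rw [hBapply]
      linarith
    · intro h g hg
      have := h (Pi.single g 1 - Pi.single (g * a) 1) ⟨fun x => by
        have h1 : x * a = g ↔ x = g * a := by
          rw [← mul_left_inj a, mul_assoc, ha, mul_one]
        simp only [Pi.sub_apply, Pi.single_apply, mul_left_inj, h1]
        ring, fun x hx => by
        have h1 : x ≠ g := fun h => hg (h ▸ hx)
        have h2 : x ≠ g * a := fun h => hg ((hD g).1 (h ▸ hx))
        simp [h1, h2]⟩
      have h6 : B (Pi.single g 1 - Pi.single (g * a) 1) z = 0 := this
      rw [hBapply] at h6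
      simp [sub_mul, Finset.sum_sub_distrib, Pi.single_apply] at h6
      linarith
  have h4 := LinearMap.BilinForm.finrank_inf_orthogonal_add_finrank hB hrefl
    (antisymmFun a ⊓ vanishingFun D) (invariantFun k)
  rw [← h1, ← h2] at h4
  have h5 := two_mul_finrank_antisymmFun ha ha1 D hD
  have h6 := three_mul_finrank_invariantFun hk hk1
  omega

end FlowDimension

section Defect

open scoped Finset

variable {G : Type*} [Group G] [Fintype G]

theorem six_mul_finrank_flows_add_finrank_le {a k : G} (ha : a * a = 1) (ha1 : a ≠ 1)
    (hk : k * k * k = 1) (hk1 : k ≠ 1) (hgen : Subgroup.closure {a, k} = ⊤) {D : Set G}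
    (hD : ∀ g, g * a ∈ D ↔ g ∈ D) {D₀ : Finset G} (hD₀ : ↑D₀ ⊆ D)
    (hD₀k : ∀ g, g * k ∈ D₀ ↔ g ∈ D₀) (hD₀card : 6 ≤ D₀.card)
    {R : Submodule ℝ (G → ℝ)} (hR : R ≤ flows a k D) (hR0 : ∀ g ∉ D, ∃ z ∈ R, z g ≠ 0)
    (hRwedge : ∀ x ∈ R, ∀ z ∈ R, ∀ g, x g * z (g * k) = x (g * k) * z g) :
    6 * (finrank ℝ (flows a k D) + finrank ℝ R) + D₀.card ≤ Fintype.card G := by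
  classical
  have hkk : k * k ≠ 1 := fun h => hk1 (by simpa [h] using hk)
  have hak : a ≠ k := by
    rintro rfl
    exact hkk ha
  have hakk : a ≠ k * k := by
    rintro rfl
    apply hk1
    have : k * k * (k * k) = k * k * k * k := by simp only [mul_assoc]
    rwa [this, hk, one_mul] at ha
  let r : Setoid G :=
    { r := fun g h => ∀ z ∈ potentials a k D, z g = z h
      iseqv := ⟨fun g z _ => rfl, fun h z hz => (h z hz).symm,
        fun h h' z hz => (h z hz).trans (h' z hz)⟩ }
  let c : G → Quotient r := Quotient.mk r
  have hc : ∀ {g h}, c g = c h ↔ ∀ z ∈ potentials a k D, z g = z h := Quotient.eq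
  have hck : ∀ g, c (g * k) = c g := fun g => hc.2 fun z hz => hz.1 g
  have hca : ∀ g ∉ D, c (g * a) = c g := fun g hg => hc.2 fun z hz => hz.2 g hg
  have hout : ∀ q : Quotient r, c q.out = q := Quotient.out_eq
  -- indicators of sets closed under the moves are potentials
  have hind : ∀ S : Set G, (∀ g, g * k ∈ S ↔ g ∈ S) → (∀ g ∉ D, g * a ∈ S ↔ g ∈ S) →
      ∀ {g h}, c g = c h → (g ∈ S ↔ h ∈ S) := by
    intro S hS1 hS2 g h hgh
    have := hc.1 hgh (fun x => if x ∈ S then 1 else 0)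
      ⟨fun x => by simp only [hS1], fun x hx => by simp only [hS2 x hx]⟩
    by_cases h1 : g ∈ S <;> by_cases h2 : h ∈ S <;> simp [h1, h2] at this ⊢
  have hcD₀ : ∀ {g h}, c g = c h → (g ∈ D₀ ↔ h ∈ D₀) := by
    refine hind (D₀ : Set G) hD₀k fun g hg => ?_
    exact iff_of_false (fun h => hg ((hD g).1 (hD₀ h))) fun h => hg (hD₀ h)
  have hpot : finrank ℝ (potentials a k D) ≤ Fintype.card (Quotient r) := by
    rw [← finrank_fintype_fun_eq_card ℝ]
    let e : potentials a k D →ₗ[ℝ] (Quotient r → ℝ) :=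
      { toFun := fun z q => z.1 q.out
        map_add' := fun _ _ => rfl
        map_smul' := fun _ _ => rfl }
    refine LinearMap.finrank_le_finrank_of_injective (f := e) fun z w hzw => ?_
    refine Subtype.ext (funext fun g => ?_)
    have h1 : z.1 (c g).out = w.1 (c g).out := congrFun hzw (c g)
    rwa [hc.1 (hout (c g)) z.1 z.2, hc.1 (hout (c g)) w.1 w.2] at h1
  let nt : Quotient r → Prop := fun q => ∃ g ∉ D, c g = q
  have hRnt : finrank ℝ R ≤ Fintype.card {q // nt q} := by
    rw [← finrank_fintype_fun_eq_card ℝ]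
    let e : R →ₗ[ℝ] ({q // nt q} → ℝ) :=
      { toFun := fun z q => z.1 q.2.choose
        map_add' := fun _ _ => rfl
        map_smul' := fun _ _ => rfl }
    refine LinearMap.finrank_le_finrank_of_injective (f := e) ?_
    rw [← LinearMap.ker_eq_bot, LinearMap.ker_eq_bot']
    intro x hx
    refine Subtype.ext (funext fun g => ?_)
    change x.1 g = 0
    obtain ⟨hxa, hxk, hxD⟩ := mem_flows.1 (hR x.2)
    by_cases hg : g ∈ D
    · exact hxD g hg
    let S : Set G := {h | x.1 h = 0 ∧ x.1 (h * k) = 0 ∧ x.1 (h * k * k) = 0}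
    have hSk : ∀ h, h * k ∈ S ↔ h ∈ S := mul_mem_iff_of_forall_mul_mem hk (by
      rintro h ⟨h1, h2, h3⟩
      refine ⟨h2, h3, ?_⟩
      rwa [mul_assoc, mul_assoc, ← mul_assoc k, hk, mul_one])
    have hS0 : ∀ h ∉ D, x.1 h = 0 → h ∈ S := by
      intro h hh h0
      obtain ⟨z, hz, hz0⟩ := hR0 h hh
      have h1 := hRwedge x.1 x.2 z hz h
      rw [h0, zero_mul, eq_comm, mul_eq_zero, or_iff_left hz0] at h1
      have h2 := hxk h
      rw [h0, h1, zero_add, zero_add] at h2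
      exact ⟨h0, h1, h2⟩
    have hSa : ∀ h ∉ D, h * a ∈ S ↔ h ∈ S := by
      intro h hh
      have : x.1 (h * a) = 0 ↔ x.1 h = 0 := by rw [hxa, neg_eq_zero]
      exact ⟨fun h' => hS0 h hh (this.1 h'.1),
        fun h' => hS0 _ (fun h'' => hh ((hD h).1 h'')) (this.2 h'.1)⟩
    have hnt : nt (c g) := ⟨g, hg, rfl⟩
    have h0 : x.1 hnt.choose = 0 := congrFun hx ⟨c g, hnt⟩
    have hmem := hS0 _ hnt.choose_spec.1 h0
    exact ((hind S hSk hSa hnt.choose_spec.2).1 hmem).1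
  have hsumG : Fintype.card G = ∑ q, #{g | c g = q} :=
    Finset.card_eq_sum_card_fiberwise fun _ _ => Finset.mem_coe.2 (Finset.mem_univ _)
  have hsumF : Dᶜ.ncard = ∑ q, #{g | c g = q ∧ g ∉ D} := by
    rw [Set.ncard_eq_toFinset_card', Finset.card_eq_sum_card_fiberwise
      (f := c) (t := Finset.univ) fun _ _ => Finset.mem_coe.2 (Finset.mem_univ _)]
    refine Finset.sum_congr rfl fun q _ => congrArg Finset.card ?_
    ext g
    simp [and_comm]
  have hsumD₀ : D₀.card = ∑ q, #{g ∈ D₀ | c g = q} :=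
    Finset.card_eq_sum_card_fiberwise fun _ _ => Finset.mem_coe.2 (Finset.mem_univ _)
  have hclass : ∀ q, 3 * #{g | c g = q ∧ g ∉ D} + #{g ∈ D₀ | c g = q} + 6 +
      6 * (if nt q then 1 else 0) ≤ 3 * #{g | c g = q} := by
    intro q
    have hqk : ∀ g, g * k ∈ ({g | c g = q} : Finset G) ↔ g ∈ ({g | c g = q} : Finset G) :=
      fun g => by simp [hck]
    have h3 := three_dvd_card hk hk1 hqk
    by_cases hq : nt q
    · obtain ⟨g, hg, hgq⟩ := id hq
      have h6 : 6 ≤ #{g | c g = q} := by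
        have : #{g, g * k, g * k * k, g * a} ≤ #{g | c g = q} := Finset.card_le_card (by
          intro h
          simp only [Finset.mem_insert, Finset.mem_singleton, Finset.mem_filter_univ]
          rintro (rfl | rfl | rfl | rfl) <;> simp [hck, hca _ hg, hgq])
        have h4 : #{g, g * k, g * k * k, g * a} = 4 := by
          have h5 : k ≠ a := hak.symm
          have h6 : k * k ≠ a := hakk.symm
          rw [Finset.card_insert_of_notMem, Finset.card_insert_of_notMem,
            Finset.card_insert_of_notMem, Finset.card_singleton] <;>
            simp [mul_assoc, hk1, hkk, ha1, h5, h6]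
        omega
      have hD₀q : Disjoint D₀ ({g | c g = q} : Finset G) := by
        rw [Finset.disjoint_left]
        intro h hh hhq
        rw [Finset.mem_filter_univ] at hhq
        exact hg (hD₀ ((hcD₀ (hgq.trans hhq.symm)).2 hh))
      have h6' : #{g | c g = q} + 6 ≤ Fintype.card G := by
        have := Finset.card_le_univ (D₀ ∪ ({g | c g = q} : Finset G))
        rw [Finset.card_union_of_disjoint hD₀q] at this
        omega
      have hcut := four_le_cut ha ha1 hk hk1 hgen hqk h6 h6'
      have h0 : #{g ∈ D₀ | c g = q} = 0 := by
        rw [Finset.card_eq_zero, Finset.filter_eq_empty_iff]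
        intro h hh hhq
        exact Finset.disjoint_left.1 hD₀q hh (by simpa using hhq)
      have hF : #{g | c g = q ∧ g ∉ D} + cut a {g | c g = q} ≤ #{g | c g = q} := by
        rw [cut, ← Finset.card_union_of_disjoint]
        · refine Finset.card_le_card ?_
          intro h
          simp only [Finset.mem_union, Finset.mem_filter, Finset.mem_univ, true_and]
          rintro (h | h) <;> exact h.1
        · rw [Finset.disjoint_left]
          intro h
          simp only [Finset.mem_filter, Finset.mem_univ, true_and]
          rintro ⟨h1, h2⟩ ⟨-, h3⟩
          exact h3 ((hca h h2).trans h1)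
      rw [if_pos hq, h0]
      omega
    · have h0 : #{g | c g = q ∧ g ∉ D} = 0 := by
        rw [Finset.card_eq_zero, Finset.filter_eq_empty_iff]
        exact fun g _ hg => hq ⟨g, hg.2, hg.1⟩
      have h1 : #{g ∈ D₀ | c g = q} ≤ #{g | c g = q} :=
        Finset.card_le_card (Finset.filter_subset_filter _ (Finset.subset_univ _))
      have h2 : 0 < #{g | c g = q} := Finset.card_pos.2 ⟨q.out, by simpa using hout q⟩
      rw [if_neg hq, h0]
      omega
  have hsum := Finset.sum_le_sum fun q (_ : q ∈ Finset.univ) => hclass q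
  simp only [Finset.sum_add_distrib, ← Finset.mul_sum] at hsum
  rw [← hsumF, ← hsumD₀, ← hsumG, ← Finset.card_filter, ← Fintype.card_subtype, Finset.sum_const,
    Finset.card_univ, smul_eq_mul] at hsum
  have hdim := finrank_flows_add ha ha1 hk hk1 D hD
  omega

end Defect

section Main

open scoped Finset

variable {G : Type*} [Group G]

theorem card_le_six_mul_finrank_flows_add [Fintype G] [DecidableEq G] {a k : G} (ha : a * a = 1)
    (ha1 : a ≠ 1) (hk : k * k * k = 1) (hk1 : k ≠ 1) (hak : a ∉ ({1, k, k * k} : Set G))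
    {D₀ : Finset G} (hD₀ : D₀ = {1, k, k * k, a, a * k, a * k * k})
    (hcard : 6 < Fintype.card G) :
    Fintype.card G ≤ 6 * finrank ℝ (flows a k D₀) + 12 := by
  have haa : ∀ g : G, g * a * a = g := fun g => by rw [mul_assoc, ha, mul_one]
  let D₁ : Set G := {g | g ∈ D₀ ∨ g * a ∈ D₀}
  have hflows : flows a k D₀ = flows a k D₁ := by
    ext z
    rw [mem_flows, mem_flows]
    refine and_congr_right fun hza => and_congr_right fun _ => ⟨?_, fun h g hg => h g (.inl hg)⟩
    rintro h g (hg | hg)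
    · exact h g hg
    · rw [← neg_eq_zero, ← hza]
      exact h _ hg
  have hD₁ : ∀ g, g * a ∈ D₁ ↔ g ∈ D₁ := by
    intro g
    simp only [D₁, Set.mem_ofPred_eq, haa]
    exact or_comm
  have hD₁card : D₁.ncard ≤ 10 := by
    have hsub : D₁ ⊆ ((D₀ ∪ {k * a, k * k * a, a * k * a, a * k * k * a} : Finset G) : Set G) := by
      rintro g (hg | hg)
      · exact Finset.mem_coe.2 (Finset.mem_union_left _ hg)
      · rw [← haa g]
        generalize g * a = h at hg
        subst hD₀
        simp only [Finset.mem_insert, Finset.mem_singleton] at hg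
        rcases hg with rfl | rfl | rfl | rfl | rfl | rfl <;> simp [ha]
    have h1 := Set.ncard_le_ncard hsub
    rw [Set.ncard_coe_finset] at h1
    have h2 := Finset.card_union_le D₀ {k * a, k * k * a, a * k * a, a * k * k * a}
    have h3 : #{k * a, k * k * a, a * k * a, a * k * k * a} ≤ 4 := Finset.card_le_four
    have h4 : #D₀ ≤ 6 := hD₀ ▸ Finset.card_le_six
    omega
  obtain ⟨c, hc⟩ : ∃ c, c ∉ D₀ := by
    by_contra! h
    have h4 : #D₀ ≤ 6 := hD₀ ▸ Finset.card_le_six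
    rw [Finset.eq_univ_iff_forall.2 h, Finset.card_univ] at h4
    omega
  let K : Set G := {1, k, k * k}
  have hK : ∀ g, g * k ∈ K ↔ g ∈ K := mul_mem_iff_of_forall_mul_mem hk (by
    rintro g (rfl | rfl | rfl) <;> simp [K, hk])
  have hD₀K : ∀ g, g ∈ D₀ ↔ g ∈ K ∨ a * g ∈ K := by
    intro g
    have h1 : ∀ x, a * g = x ↔ g = a * x := fun x =>
      ⟨fun h => by rw [← h, ← mul_assoc, ha, one_mul], fun h => by rw [h, ← mul_assoc, ha, one_mul]⟩
    simp only [hD₀, K, Finset.mem_insert, Finset.mem_singleton, Set.mem_insert_iff,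
      Set.mem_singleton_iff, h1, mul_one, mul_assoc, or_assoc]
  have hpot : 3 ≤ finrank ℝ (potentials a k D₁) := by
    classical
    let e : (Fin 3 → ℝ) →ₗ[ℝ] potentials a k D₁ :=
      { toFun := fun x => ⟨fun g => if g ∈ K then x 0 else if a * g ∈ K then x 1 else x 2, by
          refine mem_potentials.2 ⟨fun g => ?_, fun g hg => ?_⟩
          · simp only [← mul_assoc, hK]
          · have h1 := mt (hD₀K g).2 fun h => hg (.inl h)
            have h2 := mt (hD₀K (g * a)).2 fun h => hg (.inr h)
            rw [not_or] at h1 h2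
            simp only [h1, h2, if_false]⟩
        map_add' := fun x y => by
          ext g
          simp only [Pi.add_apply, Submodule.coe_add]
          split_ifs <;> rfl
        map_smul' := fun r x => by
          ext g
          simp only [Pi.smul_apply, Submodule.coe_smul, RingHom.id_apply]
          split_ifs <;> rfl }
    rw [← Fintype.card_fin 3, ← finrank_fintype_fun_eq_card ℝ]
    refine LinearMap.finrank_le_finrank_of_injective (f := e) fun x y hxy => ?_
    have he : ∀ g, (e x).1 g = (e y).1 g := fun g => by rw [hxy]
    have hc' := mt (hD₀K c).2 hc
    rw [not_or] at hc'
    have h1K : (1 : G) ∈ K := .inl rfl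
    have h0 := he 1
    have h1 := he a
    have h2 := he c
    simp only [e, LinearMap.coe_mk, AddHom.coe_mk, if_pos h1K, if_neg hak, ha, hc', if_false,
      K] at h0 h1 h2
    ext i
    fin_cases i
    · simpa using h0
    · simpa using h1
    · simpa using h2
  have hdim := finrank_flows_add ha ha1 hk hk1 D₁ hD₁
  have := Set.ncard_add_ncard_compl D₁
  rw [Nat.card_eq_fintype_card] at this
  rw [hflows]
  omega

theorem exists_radical_flows_eq_bot [Fintype G] {a k : G} (ha : a * a = 1)
    (ha1 : a ≠ 1) (hk : k * k * k = 1) (hk1 : k ≠ 1) (hgen : Subgroup.closure {a, k} = ⊤)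
    {D₀ : Finset G} (hD₀k : ∀ g, g * k ∈ D₀ ↔ g ∈ D₀) (hD₀card : D₀.card = 6)
    (hF : Fintype.card G ≤ 6 * finrank ℝ (flows a k D₀) + 12) (hdvd : 12 ∣ Fintype.card G) :
    6 * finrank ℝ (flows a k D₀) + 12 = Fintype.card G ∧ ∃ y : G → ℝ,
      radical (∑ g, y g • wedge (LinearMap.proj g) (LinearMap.proj (g * k)))
        (flows a k D₀) = ⊥ := by
  classical
  obtain ⟨y, hy⟩ := exists_generic (flows a k) (fun g : G => (LinearMap.proj g : Dual ℝ (G → ℝ)))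
    fun g => LinearMap.proj (g * k)
  have halt := isAlt_sum_smul_wedge (fun g : G => (LinearMap.proj g : Dual ℝ (G → ℝ)))
    (fun g => LinearMap.proj (g * k)) y
  set M : LinearMap.BilinForm ℝ (G → ℝ) :=
    ∑ g, y g • wedge (LinearMap.proj g) (LinearMap.proj (g * k))
  obtain ⟨D, hD₀D, ⟨-, hMD⟩, hmax⟩ := Finite.exists_le_maximal
    (p := fun D : Set G => ↑D₀ ⊆ D ∧ radicalDefect M (flows a k D₀) ≤ radicalDefect M (flows a k D))
    (a := D₀) ⟨subset_rfl, le_rfl⟩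
  have hR0 : ∀ g ∉ D, ∃ z ∈ radical M (flows a k D), z g ≠ 0 := by
    intro g hg
    by_contra! h
    have h1 := radicalDefect_le_radicalDefect_inf_ker halt
      (f := (LinearMap.proj g : Dual ℝ (G → ℝ))) h
    have h2 : flows a k D ⊓ LinearMap.ker (LinearMap.proj g : Dual ℝ (G → ℝ)) =
        flows a k (insert g D) := by
      ext z
      rw [Submodule.mem_inf, mem_flows, mem_flows]
      simp only [LinearMap.mem_ker, LinearMap.proj_apply, Set.forall_mem_insert]
      tauto
    rw [h2] at h1
    exact hg (hmax ⟨hD₀D.trans (Set.subset_insert g D), hMD.trans h1⟩ (Set.subset_insert g D)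
      (Set.mem_insert g D))
  have hR := radical_le M (flows a k D)
  have hDa : ∀ g, g * a ∈ D → g ∈ D := by
    intro g hg
    by_contra hgD
    obtain ⟨z, hz, hz0⟩ := hR0 g hgD
    obtain ⟨hza, -, hzD⟩ := mem_flows.1 (hR hz)
    exact hz0 (neg_eq_zero.1 (hza g ▸ hzD _ hg))
  have hDa' : ∀ g, g * a ∈ D ↔ g ∈ D := fun g =>
    ⟨hDa g, fun h => hDa _ (by rwa [mul_assoc, ha, mul_one])⟩
  have hle := six_mul_finrank_flows_add_finrank_le ha ha1 hk hk1 hgen hDa' hD₀D hD₀k hD₀card.ge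
    hR hR0 fun x hx z hz g => sub_eq_zero.1 (by simpa using hy D g x hx z hz)
  obtain ⟨m, hm⟩ := even_radicalDefect halt (flows a k D)
  unfold radicalDefect at hm hMD
  have h0 : finrank ℝ (radical M (flows a k D₀)) = 0 := by omega
  exact ⟨by omega, y, Submodule.finrank_eq_zero.1 h0⟩

theorem exists_perm_isCycleOn_compl [Fintype G] [DecidableEq G] {a k : G} (ha : a * a = 1)
    (ha1 : a ≠ 1) (hk : k * k * k = 1) (hk1 : k ≠ 1) (hgen : Subgroup.closure {a, k} = ⊤)
    (hdvd : 12 ∣ Fintype.card G) :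
    ∃ f : Equiv.Perm G, (∀ g, f g = g * a ∨ f g = g * a * k) ∧
      f.IsCycleOn ({1, a}ᶜ : Finset G) := by
  have hcard : 0 < Fintype.card G := Fintype.card_pos
  have hkk : k * k ≠ 1 := fun h => hk1 (by simpa [h] using hk)
  have hak : a ≠ k := by
    rintro rfl
    exact hkk ha
  have hakk : a ≠ k * k := by
    rintro rfl
    apply hk1
    have : k * k * (k * k) = k * k * k * k := by simp only [mul_assoc]
    rwa [this, hk, one_mul] at ha
  have hkkk : k * (k * k) = 1 := by rw [← mul_assoc, hk]
  let D₀ : Finset G := {1, k, k * k, a, a * k, a * k * k}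
  have hD₀card : #D₀ = 6 := by
    have haa : ∀ x, a * (a * x) = x := fun x => by rw [← mul_assoc, ha, one_mul]
    have h1 : a * k ≠ 1 := fun h => hak (by rw [← haa k, h, mul_one])
    have h2 : a * (k * k) ≠ 1 := fun h => hakk (by rw [← haa (k * k), h, mul_one])
    have h3 : k ≠ a * (k * k) := fun h => h1 (by
      rw [← mul_assoc] at h
      exact right_eq_mul.1 h)
    rw [Finset.card_insert_of_notMem, Finset.card_insert_of_notMem, Finset.card_insert_of_notMem,
      Finset.card_insert_of_notMem, Finset.card_insert_of_notMem, Finset.card_singleton] <;>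
      simp [mul_assoc, hk1, hk1.symm, hkk, hkk.symm, ha1, ha1.symm, hak.symm, hakk.symm, h1.symm,
        h2.symm, h3]
  have hD₀k : ∀ g, g * k ∈ D₀ ↔ g ∈ D₀ := by
    refine mul_mem_iff_of_forall_mul_mem (U := (D₀ : Set G)) hk fun g hg => ?_
    simp only [D₀, Finset.mem_coe, Finset.mem_insert, Finset.mem_singleton] at hg ⊢
    rcases hg with rfl | rfl | rfl | rfl | rfl | rfl <;> simp [mul_assoc, hkkk]
  obtain ⟨hfin, y, hy⟩ := exists_radical_flows_eq_bot ha ha1 hk hk1 hgen hD₀k hD₀card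
    (card_le_six_mul_finrank_flows_add ha ha1 hk hk1 (by simp [ha1, hak, hakk]) rfl (by omega)) hdvd
  obtain ⟨J, hJ, hJ0⟩ := exists_finset_two_mul_card_eq_finrank
    (fun g : G => (LinearMap.proj g : Dual ℝ (G → ℝ)).domRestrict (flows a k D₀))
    (fun g => (LinearMap.proj (g * k) : Dual ℝ (G → ℝ)).domRestrict (flows a k D₀)) y (by
      rw [eq_bot_iff]
      rintro x ⟨-, hx⟩
      rw [Submodule.mem_bot, ← Submodule.coe_eq_zero, ← Submodule.mem_bot ℝ, ← hy]
      refine ⟨x.2, fun z hz => ?_⟩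
      have := hx ⟨z, hz⟩ trivial
      simpa [LinearMap.sum_apply] using this)
  let U : Finset G := D₀ ∪ (J ∪ J.image (· * k) ∪ J.image (· * k * k))
  have hU : #U ≤ 6 + 3 * #J := by
    have h1 := Finset.card_union_le D₀ (J ∪ J.image (· * k) ∪ J.image (· * k * k))
    have h2 := Finset.card_union_le (J ∪ J.image (· * k)) (J.image (· * k * k))
    have h3 := Finset.card_union_le J (J.image (· * k))
    have h4 : #(J.image (· * k)) ≤ #J := Finset.card_image_le
    have h5 : #(J.image (· * k * k)) ≤ #J := Finset.card_image_le
    simp only [U]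
    omega
  have hUk : ∀ g, g * k ∈ U ↔ g ∈ U := by
    refine mul_mem_iff_of_forall_mul_mem (U := (U : Set G)) hk fun g hg => ?_
    simp only [U, Finset.mem_coe, Finset.mem_union, Finset.mem_image] at hg ⊢
    rcases hg with hg | (hg | ⟨h, hh, rfl⟩) | ⟨h, hh, rfl⟩
    · exact .inl ((hD₀k g).2 hg)
    · exact .inr (.inl (.inr ⟨g, hg, rfl⟩))
    · exact .inr (.inr ⟨h, hh, rfl⟩)
    · refine .inr (.inl (.inl ?_))
      rwa [mul_assoc, mul_assoc, hkkk, mul_one]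
  have hT : ((U : Set G)ᶜ).ncard = Fintype.card G - #U := by
    rw [← Finset.coe_compl, Set.ncard_coe_finset, Finset.card_compl]
  refine exists_perm_isCycleOn ha ha1 hk hk1 (U : Set G)ᶜ (fun g => not_congr (hUk g)) ?_
    (by simp [U, D₀]) (by simp [U, D₀]) (by omega)
  rw [compl_compl, eq_bot_iff]
  intro z hz
  obtain ⟨hza, hzk, hzU⟩ := mem_flows.1 hz
  have hzF : z ∈ flows a k D₀ :=
    mem_flows.2 ⟨hza, hzk, fun g hg => hzU g (Finset.mem_union_left _ hg)⟩
  refine congrArg Subtype.val (hJ0 ⟨z, hzF⟩ fun g hg => ?_)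
  have hgU : g ∈ U :=
    Finset.mem_union_right _ (Finset.mem_union_left _ (Finset.mem_union_left _ hg))
  exact ⟨hzU g hgU, hzU _ ((hUk g).2 hgU)⟩

end Main

/-- If `G` is a finite group generated by an involution `a` and an element `b` of order
`s ≥ 3` with `ab` of order `3`, and `|G| ≡ 0 (mod 4)`, then `Cay(G, {a, b, b⁻¹})`
contains a cycle of length `|G| - 2`. -/
theorem stmt1 {G : Type*} [Group G] [Fintype G] (a b : G) (s : ℕ)
    (hs : 3 ≤ s) (ha : orderOf a = 2) (hb : orderOf b = s) (hab : orderOf (a * b) = 3)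
    (hgen : Subgroup.closure ({a, b} : Set G) = ⊤)
    (hcard : Fintype.card G % 4 = 0) :
    ∃ (v : G) (p : (cayleyGraph a b).Walk v v),
      p.IsCycle ∧ p.length = Fintype.card G - 2 := by
  classical
  have ha2 : a * a = 1 := by rw [← pow_two, ← ha, pow_orderOf_eq_one]
  have ha1 : a ≠ 1 := by
    rintro rfl
    simp at ha
  have hb1 : b ≠ 1 := by
    rintro rfl
    simp at hb
    omega
  obtain ⟨k, hkab⟩ : ∃ k, k = a * b := ⟨_, rfl⟩
  rw [← hkab] at hab
  have hakb : a * k = b := by rw [hkab, ← mul_assoc, ha2, one_mul]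
  have hk3 : k * k * k = 1 := by rw [← pow_three', ← hab, pow_orderOf_eq_one]
  have hk1 : k ≠ 1 := by
    intro h
    simp [h] at hab
  have hgen' : Subgroup.closure {a, k} = ⊤ := by
    rw [eq_top_iff, ← hgen, Subgroup.closure_le]
    have h1 : a ∈ Subgroup.closure {a, k} := Subgroup.subset_closure (by simp)
    have h2 : k ∈ Subgroup.closure {a, k} := Subgroup.subset_closure (by simp)
    rintro g (rfl | rfl)
    · exact h1
    · rw [← hakb]
      exact mul_mem h1 h2
  have h3 : 3 ∣ Fintype.card G := hab ▸ orderOf_dvd_card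
  have hpos : 0 < Fintype.card G := Fintype.card_pos
  obtain ⟨f, hf, hcyc⟩ := exists_perm_isCycleOn_compl ha2 ha1 hk3 hk1 hgen' (by omega)
  have hs2 : ({1, a}ᶜ : Finset G).card = Fintype.card G - 2 := by
    rw [Finset.card_compl, Finset.card_pair ha1.symm]
  rw [← hs2]
  refine (cayleyGraph a b).exists_isCycle_length_eq_of_isCycleOn f hcyc (by omega) fun g => ?_
  rw [cayleyGraph, SimpleGraph.fromRel_adj]
  rcases hf g with h | h
  · rw [h]
    exact ⟨by simpa using ha1, .inl (by simp)⟩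
  · rw [h, mul_assoc, hakb]
    exact ⟨by simpa using hb1, .inl (by simp)⟩
end
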